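/- Let f(Z), g(Z) ∈ ℤ[Z] satisfy the nondegeneracy condition. Then for every ε > 0 there is a constant C (depending only on f, g, ε) such that for all real T ≥ 1, x ≥ 2 and every sequence of integers 𝔄 = (a_p) indexed by the primes, one has Σ_{r,s ∈ F(T), Δ(r+s) ≠ 0} π_{E(r+s)}(𝔄; x) ≤ C (T⁵ + T³ x^{5/4+ε} + T⁴ x^{3/4+ε}), where the sum runs over ordered pairs (r, s) ∈ F(T) × F(T). -/

import Mathlib

open Polynomial Finset

attribute [local instance 10] Classical.propDecidable

noncomputable section

/-- The discriminant polynomial `Δ = -16(4f³+27g²)`. -/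
def Dpoly (f g : Polynomial ℤ) : Polynomial ℤ := -16 * (4 * f ^ 3 + 27 * g ^ 2)

/-- Nondegeneracy: `Δ ≠ 0` as a polynomial and the `j`-invariant
`j = -1728(4f)³/Δ` is not a constant rational function, i.e. `-1728(4f)³`
is not a rational multiple of `Δ`. -/
def Nondeg (f g : Polynomial ℤ) : Prop :=
  Dpoly f g ≠ 0 ∧
    ¬∃ c : ℚ, (-1728 : Polynomial ℚ) * (4 * f.map (Int.castRingHom ℚ)) ^ 3 =
      Polynomial.C c * (Dpoly f g).map (Int.castRingHom ℚ)

/-- The set `F(T) = {u/v ∈ ℚ : gcd(u,v) = 1, 1 ≤ u, v ≤ T}`. -/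
def FT (T : ℝ) : Finset ℚ :=
  ((Finset.Icc (1 : ℤ) ⌊T⌋ ×ˢ Finset.Icc (1 : ℤ) ⌊T⌋).filter
      fun w => Int.gcd w.1 w.2 = 1).image fun w => (w.1 : ℚ) / (w.2 : ℚ)

/-- Reduction of a rational number `t` modulo `p`, as `num·den⁻¹` in `ZMod p`. -/
def redQ (p : ℕ) (t : ℚ) : ZMod p := (t.num : ZMod p) * (t.den : ZMod p)⁻¹

/-- The number of `𝔽_p`-points of the curve `Y² = X³ + AX + B`
(affine points together with the point at infinity). -/
def numPoints (p : ℕ) (A B : ZMod p) : ℕ :=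
  1 + Nat.card {P : ZMod p × ZMod p // P.2 ^ 2 = P.1 ^ 3 + A * P.1 + B}

/-- The Frobenius trace `p + 1 - #E(𝔽_p)` of `Y² = X³ + AX + B` over `𝔽_p`. -/
def frobTrace (p : ℕ) (A B : ZMod p) : ℤ := (p : ℤ) + 1 - numPoints p A B

/-- `a_p(E(t))`: the Frobenius trace of the reduction modulo `p` of the curve
`E(t) : Y² = X³ + f(t)X + g(t)`. -/
def apE (f g : Polynomial ℤ) (p : ℕ) (t : ℚ) : ℤ :=
  frobTrace p ((f.map (Int.castRingHom (ZMod p))).eval (redQ p t))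
    ((g.map (Int.castRingHom (ZMod p))).eval (redQ p t))

/-- Good reduction of `E(t)` at `p`: the denominator of `t` is coprime to `p`
and `Δ(t) ≢ 0 (mod p)`. -/
def goodRed (f g : Polynomial ℤ) (p : ℕ) (t : ℚ) : Prop :=
  ¬(p ∣ t.den) ∧ ((Dpoly f g).map (Int.castRingHom (ZMod p))).eval (redQ p t) ≠ 0

/-- `π_{E(t)}(𝔄; x)`: the number of primes `p ≤ x` of good reduction for `E(t)`
with `a_p(E(t)) = a_p`. -/
def piSeq (f g : Polynomial ℤ) (a : ℕ → ℤ) (t : ℚ) (x : ℝ) : ℕ :=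
  ((Finset.Icc 1 ⌊x⌋₊).filter fun p =>
      p.Prime ∧ goodRed f g p t ∧ apE f g p t = a p).card

/-- `π_{E(t)}(K; x)` for `K = ℚ(√d)`: the number of primes `p ≤ x` of good
reduction for `E(t)` with `a_p(E(t)) ≠ 0` and `a_p(E(t))² - 4p = d·m²`. -/
def piK (f g : Polynomial ℤ) (d : ℤ) (t : ℚ) (x : ℝ) : ℕ :=
  ((Finset.Icc 1 ⌊x⌋₊).filter fun p =>
      p.Prime ∧ goodRed f g p t ∧ apE f g p t ≠ 0 ∧
        ∃ m : ℤ, 0 < m ∧ (apE f g p t) ^ 2 - 4 * (p : ℤ) = d * m ^ 2).card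

/-- The Frobenius angle `ψ_p(E(t)) ∈ [0, π]`, with `cos ψ_p = a_p/(2√p)`. -/
def psiE (f g : Polynomial ℤ) (p : ℕ) (t : ℚ) : ℝ :=
  Real.arccos ((apE f g p t : ℝ) / (2 * Real.sqrt p))

/-- `π_{E(t)}(α, β; x)`: the number of primes `p ≤ x` of good reduction for
`E(t)` with `ψ_p(E(t)) ∈ [α, β]`. -/
def piAngle (f g : Polynomial ℤ) (α β : ℝ) (t : ℚ) (x : ℝ) : ℕ :=
  ((Finset.Icc 1 ⌊x⌋₊).filter fun p =>
      p.Prime ∧ goodRed f g p t ∧ psiE f g p t ∈ Set.Icc α β).card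

/-- The Sato–Tate density `μ_ST(α, β) = (2/π) ∫_α^β sin²θ dθ`. -/
def muST (α β : ℝ) : ℝ := (2 / Real.pi) * ∫ θ in α..β, Real.sin θ ^ 2

/-- `π(x)`: the number of primes `p ≤ x`. -/
def primePi (x : ℝ) : ℕ := ((Finset.Icc 1 ⌊x⌋₊).filter Nat.Prime).card

/-- `e_p(w) = exp(2πi w/p)`. -/
def ep (p : ℕ) (w : ZMod p) : ℂ :=
  Complex.exp (2 * (Real.pi : ℂ) * Complex.I * (w.val : ℂ) / (p : ℂ))

/-- Derivations of a commutative ring into itself. -/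
abbrev ZDer (A : Type*) [CommRing A] := Derivation ℤ A A

section DerivationIterate

variable {A : Type*} [CommRing A]

theorem derivation_iterate_mul (D : ZDer A) (n : ℕ) (a b : A) :
    D^[n] (a * b) =
      ∑ ij ∈ antidiagonal n, n.choose ij.1 • (D^[ij.1] a * D^[ij.2] b) := by
  induction n with
  | zero => simp
  | succ n ih =>
    rw [sum_antidiagonal_choose_succ_nsmul (M := A) (fun i j => D^[i] a * D^[j] b) n]
    simp only [Function.iterate_succ_apply', ih, map_sum, map_nsmul, Derivation.leibniz, smul_add,
      sum_add_distrib, smul_eq_mul]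
    congr 1
    refine sum_congr rfl fun ⟨i, j⟩ hij ↦ ?_
    rw [n.choose_symm_of_eq_add (mem_antidiagonal.1 hij).symm, mul_comm]

theorem derivation_iterate_char (p : ℕ) [hp : Fact p.Prime] [CharP A p] (D : ZDer A)
    (a b : A) : D^[p] (a * b) = a * D^[p] b + b * D^[p] a := by
  rw [derivation_iterate_mul, Finset.Nat.sum_antidiagonal_eq_sum_range_succ_mk,
    Finset.sum_range_succ, ← Nat.succ_pred_eq_of_pos hp.out.pos, Finset.sum_range_succ']
  rw [Finset.sum_eq_zero]
  · simp [mul_comm]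
  · intro i hi
    rw [Finset.mem_range] at hi
    have : (p : ℕ) ∣ p.choose (i + 1) :=
      hp.out.dvd_choose_self (by omega) (by have := hp.out.pos; simp only [Nat.pred_eq_sub_one] at hi; omega)
    have h2 : ((p.choose (i + 1) : ℕ) : A) = 0 := (CharP.cast_eq_zero_iff A p _).2 this
    rw [Nat.succ_pred_eq_of_pos hp.out.pos, nsmul_eq_mul, h2, zero_mul]

/-- In characteristic `p`, the `p`-th iterate of a derivation is a derivation. -/
def Derivation.frobIterate (p : ℕ) [Fact p.Prime] [CharP A p] (D : ZDer A) :
    ZDer A :=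
  Derivation.mk' ((D : A →ₗ[ℤ] A) ^ p) fun a b => by
    simpa [Module.End.pow_apply] using derivation_iterate_char p D a b

theorem Derivation.frobIterate_apply (p : ℕ) [Fact p.Prime] [CharP A p] (D : ZDer A)
    (a : A) : D.frobIterate p a = D^[p] a := by
  simp [Derivation.frobIterate, Module.End.pow_apply]

end DerivationIterate

section CoeffDerivation

variable {R : Type*} [CommRing R]

/-- The lift to dual numbers defining `mvDer`. -/
def mvDerHom (d : ZDer R) (w : Fin 2 → MvPolynomial (Fin 2) R) :
    MvPolynomial (Fin 2) R →+* TrivSqZeroExt (MvPolynomial (Fin 2) R) (MvPolynomial (Fin 2) R) :=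
  MvPolynomial.eval₂Hom
    { toFun := fun r => TrivSqZeroExt.inl (MvPolynomial.C r) + TrivSqZeroExt.inr (MvPolynomial.C (d r))
      map_one' := by ext <;> simp
      map_zero' := by ext <;> simp
      map_add' := fun a b => by ext <;> simp
      map_mul' := fun a b => by ext <;> simp [mul_comm] }
    (fun i => TrivSqZeroExt.inl (MvPolynomial.X i) + TrivSqZeroExt.inr (w i))

theorem fst_mvDerHom (d : ZDer R) (w : Fin 2 → MvPolynomial (Fin 2) R)
    (F : MvPolynomial (Fin 2) R) : (mvDerHom d w F).fst = F := by
  have : (TrivSqZeroExt.fstHom R (MvPolynomial (Fin 2) R) (MvPolynomial (Fin 2) R)).toRingHom.comp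
      (mvDerHom d w) = RingHom.id _ := by
    apply MvPolynomial.ringHom_ext
    · intro r; simp [mvDerHom]
    · intro i; simp [mvDerHom]
  exact congrArg (fun φ => φ F) this

/-- The derivation of `R[U, V]` extending `d` with prescribed values on the variables. -/
def mvDer (d : ZDer R) (w : Fin 2 → MvPolynomial (Fin 2) R) :
    ZDer (MvPolynomial (Fin 2) R) :=
  Derivation.mk' (AddMonoidHom.toIntLinearMap
    { toFun := fun F => (mvDerHom d w F).snd
      map_zero' := by simp
      map_add' := by simp }) fun a b => by
        simp [fst_mvDerHom, mul_comm]

@[simp] theorem mvDer_C (d : ZDer R) (w : Fin 2 → MvPolynomial (Fin 2) R) (r : R) :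
    mvDer d w (MvPolynomial.C r) = MvPolynomial.C (d r) := by
  simp [mvDer, mvDerHom]

@[simp] theorem mvDer_X (d : ZDer R) (w : Fin 2 → MvPolynomial (Fin 2) R) (i : Fin 2) :
    mvDer d w (MvPolynomial.X i) = w i := by
  simp [mvDer, mvDerHom]

end CoeffDerivation

theorem map_iterate_sum {M ι : Type*} [AddCommMonoid M] {F : Type*} [FunLike F M M]
    [AddMonoidHomClass F M M] (D : F) (n : ℕ) (s : Finset ι) (u : ι → M) :
    D^[n] (∑ i ∈ s, u i) = ∑ i ∈ s, D^[n] (u i) := by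
  induction n with
  | zero => rfl
  | succ n ih => simp only [Function.iterate_succ_apply', ih, map_sum]

section HomogeneousDerivative

variable {R : Type*} [CommRing R]

/-- The `R`-derivation `H ∂/∂U + G ∂/∂V` of `R[U, V]`. -/
def dirDer (H G : R) : Derivation R (MvPolynomial (Fin 2) R) (MvPolynomial (Fin 2) R) :=
  (MvPolynomial.C H : MvPolynomial (Fin 2) R) • (MvPolynomial.pderiv 0 :
      Derivation R (MvPolynomial (Fin 2) R) (MvPolynomial (Fin 2) R)) +
    (MvPolynomial.C G : MvPolynomial (Fin 2) R) • (MvPolynomial.pderiv 1 :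
      Derivation R (MvPolynomial (Fin 2) R) (MvPolynomial (Fin 2) R))

theorem dirDer_apply (H G : R) (F : MvPolynomial (Fin 2) R) :
    dirDer H G F = MvPolynomial.C H * MvPolynomial.pderiv 0 F +
      MvPolynomial.C G * MvPolynomial.pderiv 1 F := rfl

theorem eval_dirDer (H G : R) {F : MvPolynomial (Fin 2) R} {n : ℕ} (hF : F.IsHomogeneous n) :
    MvPolynomial.eval ![H, G] (dirDer H G F) = n * MvPolynomial.eval ![H, G] F := by
  have h := congrArg (MvPolynomial.eval ![H, G]) hF.sum_X_mul_pderiv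
  simpa [dirDer_apply, Fin.sum_univ_two] using h

theorem isHomogeneous_dirDer (H G : R) {F : MvPolynomial (Fin 2) R} {n : ℕ}
    (hF : F.IsHomogeneous n) : (dirDer H G F).IsHomogeneous (n - 1) := by
  rw [dirDer_apply]
  exact (hF.pderiv.C_mul H).add (hF.pderiv.C_mul G)

theorem dirDer_iterate (H G : R) {F : MvPolynomial (Fin 2) R} {n : ℕ} (hF : F.IsHomogeneous n) :
    (dirDer H G)^[n] F = MvPolynomial.C ((n.factorial : R) * MvPolynomial.eval ![H, G] F) := by
  induction n generalizing F with
  | zero =>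
    rw [← MvPolynomial.totalDegree_zero_iff_isHomogeneous,
      MvPolynomial.totalDegree_eq_zero_iff_eq_C] at hF
    rw [hF]; simp
  | succ n ih =>
    rw [Function.iterate_succ_apply, ih (by simpa using isHomogeneous_dirDer H G hF),
      eval_dirDer H G hF, Nat.factorial_succ]
    congr 1
    push_cast; ring

theorem dirDer_iterate_eq_zero (H G : R) {F : MvPolynomial (Fin 2) R} {n m : ℕ}
    (hF : F.IsHomogeneous n) (hm : n < m) : (dirDer H G)^[m] F = 0 := by
  obtain ⟨k, rfl⟩ := Nat.exists_eq_add_of_lt hm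
  rw [show n + k + 1 = k + 1 + n by ring, Function.iterate_add_apply, dirDer_iterate H G hF,
    Function.iterate_succ_apply]
  simp [iterate_map_zero]

theorem dirDer_iterate_top (H G : R) (F : MvPolynomial (Fin 2) R) {B : ℕ}
    (hF : F.totalDegree ≤ B) :
    (dirDer H G)^[B] F = MvPolynomial.C ((B.factorial : R) *
      MvPolynomial.eval ![H, G] (MvPolynomial.homogeneousComponent B F)) := by
  rcases hF.lt_or_eq with h | h
  · rw [MvPolynomial.homogeneousComponent_eq_zero _ _ h]
    conv_lhs => rw [← MvPolynomial.sum_homogeneousComponent F]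
    rw [map_iterate_sum, Finset.sum_eq_zero]
    · simp
    · intro i hi
      rw [Finset.mem_range] at hi
      exact dirDer_iterate_eq_zero H G (MvPolynomial.homogeneousComponent_isHomogeneous i F)
        (by omega)
  · conv_lhs => rw [← MvPolynomial.sum_homogeneousComponent F]
    rw [map_iterate_sum, h, Finset.sum_range_succ, Finset.sum_eq_zero,
      dirDer_iterate H G (MvPolynomial.homogeneousComponent_isHomogeneous B F), zero_add]
    intro i hi
    rw [Finset.mem_range] at hi
    exact dirDer_iterate_eq_zero H G (MvPolynomial.homogeneousComponent_isHomogeneous i F) hi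

end HomogeneousDerivative

section EulerDerivation

variable {K : Type*} [Field K]

/-- The derivation `X (X - 1) d/dX`. -/
def eulerD (K : Type*) [Field K] : ZDer K[X] :=
  ((X * (X - 1) : K[X]) • (derivative' : Derivation K K[X] K[X])).restrictScalars ℤ

theorem eulerD_apply (P : K[X]) : eulerD K P = X * (X - 1) * derivative P := rfl

theorem natDegree_eulerD_le (P : K[X]) : (eulerD K P).natDegree ≤ P.natDegree + 1 := by
  rw [eulerD_apply]
  by_cases h : P.natDegree = 0
  · rw [Polynomial.eq_C_of_natDegree_eq_zero h]; simp
  · refine natDegree_mul_le.trans ?_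
    have h1 : (X * (X - 1) : K[X]).natDegree ≤ 2 := by compute_degree
    have h2 := natDegree_derivative_le P
    omega

theorem coeff_zero_eulerD (P : K[X]) : (eulerD K P).coeff 0 = 0 := by
  rw [eulerD_apply, mul_assoc, mul_coeff_zero]; simp

theorem eulerD_iterate_char (p : ℕ) [Fact p.Prime] [CharP K p] (P : K[X]) : (eulerD K)^[p] P = eulerD K P := by
  set ψ : ZDer K[X] := (eulerD K).frobIterate p - eulerD K with hψ
  have hap : ∀ P, ψ P = (eulerD K)^[p] P - eulerD K P := fun P => by
    rw [hψ, Derivation.sub_apply, Derivation.frobIterate_apply]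
  suffices h : ψ P = 0 by rw [hap] at h; exact sub_eq_zero.1 h
  have hp := (Fact.out : p.Prime)
  have hC : ∀ c, ψ (C c) = 0 := fun c => by
    have h0 : eulerD K (C c) = 0 := by simp [eulerD_apply]
    obtain ⟨n, hn⟩ := Nat.exists_eq_succ_of_ne_zero hp.ne_zero
    rw [hap, h0]
    rw [hn, Function.iterate_succ_apply, h0, iterate_map_zero, sub_zero]
  have hX : ψ X = 0 := by
    have h1 : eulerD K (X ^ (p - 1)) = X ^ (p - 1) - X ^ p := by
      obtain ⟨n, hn⟩ : ∃ n, p = n + 2 := ⟨p - 2, by have := hp.two_le; omega⟩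
      have hn' : ((n : K[X])) + 2 = 0 := by
        have := CharP.cast_eq_zero K[X] p
        rw [hn] at this; push_cast at this; exact_mod_cast this
      have e1 : p - 1 = n + 1 := by omega
      have e2 : X ^ p = (X : K[X]) ^ (n + 2) := by congr 1
      rw [eulerD_apply, e1, e2, derivative_X_pow]
      simp only [add_tsub_cancel_right, Nat.cast_add, Nat.cast_one, map_add, map_natCast, map_one]
      linear_combination (X ^ (n + 2) - X ^ (n + 1) : K[X]) * hn'
    have h2 : eulerD K (X ^ p) = 0 := by simp [eulerD_apply]
    have h3 : ∀ n, (eulerD K)^[n + 1] (X ^ (p - 1)) = X ^ (p - 1) - X ^ p := by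
      intro n
      induction n with
      | zero => simpa using h1
      | succ n ih => rw [Function.iterate_succ_apply', ih, map_sub, h1, h2, sub_zero]
    have h4 : ψ (X ^ (p - 1)) = 0 := by
      obtain ⟨n, hn⟩ := Nat.exists_eq_succ_of_ne_zero hp.ne_zero
      have h5 := h3 n
      rw [show n + 1 = p from hn.symm] at h5
      rw [hap, h5, h1, sub_self]
    rw [Derivation.leibniz_pow, smul_eq_mul, nsmul_eq_mul, mul_eq_zero, mul_eq_zero] at h4
    rcases h4 with h4 | h4 | h4
    · exfalso
      rw [CharP.cast_eq_zero_iff K[X] p] at h4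
      have := Nat.le_of_dvd (by have := hp.two_le; omega) h4
      have := hp.two_le
      omega
    · exact absurd h4 (pow_ne_zero _ X_ne_zero)
    · exact h4
  induction P using Polynomial.induction_on' with
  | add P Q hP hQ => rw [map_add, hP, hQ, add_zero]
  | monomial n a =>
    rw [← C_mul_X_pow_eq_monomial, Derivation.leibniz, hC, Derivation.leibniz_pow, hX]; simp

end EulerDerivation

section OdeDerivation

variable {K : Type*} [Field K]

/-- The derivation of `K[X][U, V]` with `U' = V` and `V' = q U`. -/
def odeDer (q : K[X]) : ZDer (MvPolynomial (Fin 2) K[X]) :=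
  mvDer (eulerD K) ![MvPolynomial.X 1, MvPolynomial.C q * MvPolynomial.X 0]

@[simp] theorem odeDer_C (q r : K[X]) :
    odeDer q (MvPolynomial.C r) = MvPolynomial.C (eulerD K r) := by simp [odeDer]

@[simp] theorem odeDer_X_zero (q : K[X]) :
    odeDer q (MvPolynomial.X 0) = MvPolynomial.X 1 := by simp [odeDer]

@[simp] theorem odeDer_X_one (q : K[X]) :
    odeDer q (MvPolynomial.X 1) = MvPolynomial.C q * MvPolynomial.X 0 := by simp [odeDer]

theorem odeDer_iterate_C (q r : K[X]) (n : ℕ) :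
    (odeDer q)^[n] (MvPolynomial.C r) = MvPolynomial.C ((eulerD K)^[n] r) := by
  induction n with
  | zero => rfl
  | succ n ih => rw [Function.iterate_succ_apply', ih, odeDer_C, Function.iterate_succ_apply']

theorem eval_odeDer {q H G : K[X]} (hH : eulerD K H = G) (hG : eulerD K G = q * H)
    (F : MvPolynomial (Fin 2) K[X]) :
    MvPolynomial.eval ![H, G] (odeDer q F) = eulerD K (MvPolynomial.eval ![H, G] F) := by
  induction F using MvPolynomial.induction_on with
  | C a => simp
  | add F E hF hE => simp [hF, hE]
  | mul_X F i hF =>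
    rw [Derivation.leibniz, map_add, smul_eq_mul, smul_eq_mul, map_mul, map_mul, map_mul, hF,
      Derivation.leibniz, smul_eq_mul, smul_eq_mul]
    congr 1
    fin_cases i
    · simp [hH]
    · simp [hG]

theorem eval_odeDer_iterate {q H G : K[X]} (hH : eulerD K H = G) (hG : eulerD K G = q * H)
    (F : MvPolynomial (Fin 2) K[X]) (n : ℕ) :
    MvPolynomial.eval ![H, G] ((odeDer q)^[n] F) =
      (eulerD K)^[n] (MvPolynomial.eval ![H, G] F) := by
  induction n with
  | zero => rfl
  | succ n ih => rw [Function.iterate_succ_apply', eval_odeDer hH hG, ih,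
      Function.iterate_succ_apply']

theorem odeDer_iterate_X_zero {q : K[X]} (hq : q.coeff 0 = 0) (n : ℕ) :
    ∃ u v : K[X], (odeDer q)^[n + 2] (MvPolynomial.X 0) =
      MvPolynomial.C u * MvPolynomial.X 0 + MvPolynomial.C v * MvPolynomial.X 1 ∧
      u.coeff 0 = 0 ∧ v.coeff 0 = 0 := by
  induction n with
  | zero => exact ⟨q, 0, by simp, hq, by simp⟩
  | succ n ih =>
    obtain ⟨u, v, h, hu, hv⟩ := ih
    refine ⟨eulerD K u + q * v, u + eulerD K v, ?_, ?_, ?_⟩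
    · rw [show n + 1 + 2 = (n + 2) + 1 by ring, Function.iterate_succ_apply', h]
      simp only [map_add, Derivation.leibniz, odeDer_C, odeDer_X_zero, odeDer_X_one, smul_eq_mul,
        map_mul]
      ring
    · simp [coeff_zero_eulerD, mul_coeff_zero, hq]
    · simp [coeff_zero_eulerD, hu]

/-- The derivation `δ ^ p - δ` attached to `odeDer`. -/
def odeFrob (p : ℕ) [Fact p.Prime] [CharP K p] (q : K[X]) : ZDer (MvPolynomial (Fin 2) K[X]) :=
  (odeDer q).frobIterate p - odeDer q

variable (p : ℕ) [Fact p.Prime] [CharP K p]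

theorem odeFrob_apply (q : K[X]) (F : MvPolynomial (Fin 2) K[X]) :
    odeFrob p q F = (odeDer q)^[p] F - odeDer q F := by
  rw [odeFrob, Derivation.sub_apply, Derivation.frobIterate_apply]

@[simp] theorem odeFrob_C (q r : K[X]) : odeFrob p q (MvPolynomial.C r) = 0 := by
  rw [odeFrob_apply, odeDer_iterate_C, eulerD_iterate_char, odeDer_C, sub_self]

theorem odeFrob_factor {q H G : K[X]} (hq : q.coeff 0 = 0) (hH : eulerD K H = G)
    (hG : eulerD K G = q * H) :
    ∃ u v : K[X], v ≠ 0 ∧ u * H + v * G = 0 ∧ ∀ F,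
      MvPolynomial.C H * odeFrob p q F =
        (MvPolynomial.C u * MvPolynomial.X 0 + MvPolynomial.C v * MvPolynomial.X 1) *
          dirDer H G F := by
  have hp := (Fact.out : p.Prime)
  obtain ⟨n, hn⟩ : ∃ n, n + 2 = p := ⟨p - 2, by have := hp.two_le; omega⟩
  obtain ⟨u, v, h, -, hv⟩ := odeDer_iterate_X_zero hq n
  rw [hn] at h
  have hU : odeFrob p q (MvPolynomial.X 0) =
      MvPolynomial.C u * MvPolynomial.X 0 + MvPolynomial.C (v - 1) * MvPolynomial.X 1 := by
    rw [odeFrob_apply, h, odeDer_X_zero]; simp only [map_sub, map_one]; ring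
  have hrel : u * H + (v - 1) * G = 0 := by
    have h1 := congrArg (MvPolynomial.eval ![H, G]) hU
    rw [odeFrob_apply, map_sub, eval_odeDer_iterate hH hG, eval_odeDer hH hG, eulerD_iterate_char,
      sub_self] at h1
    simpa using h1.symm
  refine ⟨u, v - 1, fun h0 => ?_, hrel, ?_⟩
  · have := congrArg (fun P => P.coeff 0) h0
    simp [hv] at this
  have hV : MvPolynomial.C H * odeFrob p q (MvPolynomial.X 1) =
      MvPolynomial.C G * odeFrob p q (MvPolynomial.X 0) := by
    have h0 : odeDer q (MvPolynomial.C G * MvPolynomial.X 0 - MvPolynomial.C H * MvPolynomial.X 1)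
        = 0 := by
      simp only [map_sub, Derivation.leibniz, odeDer_C, odeDer_X_zero, odeDer_X_one, smul_eq_mul,
        hH, hG, map_mul]
      ring
    have h1 : odeFrob p q
        (MvPolynomial.C G * MvPolynomial.X 0 - MvPolynomial.C H * MvPolynomial.X 1) = 0 := by
      rw [odeFrob_apply, h0, ← hn, Function.iterate_succ_apply, h0, iterate_map_zero, sub_self]
    rw [map_sub, Derivation.leibniz, Derivation.leibniz, odeFrob_C, odeFrob_C] at h1
    simp only [smul_eq_mul, mul_zero, add_zero] at h1
    exact (sub_eq_zero.1 h1).symm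
  intro F
  induction F using MvPolynomial.induction_on with
  | C a => simp
  | add F E hF hE => rw [map_add, map_add, mul_add, mul_add, hF, hE]
  | mul_X F i hF =>
    have hi : MvPolynomial.C H * odeFrob p q (MvPolynomial.X i) =
        (MvPolynomial.C u * MvPolynomial.X 0 + MvPolynomial.C (v - 1) * MvPolynomial.X 1) *
          dirDer H G (MvPolynomial.X i) := by
      fin_cases i
      · simp [hU, dirDer_apply, mul_comm]
      · simp only [Fin.mk_one, Fin.isValue]
        rw [hV, hU]; simp [dirDer_apply, mul_comm]
    rw [Derivation.leibniz, Derivation.leibniz]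
    simp only [smul_eq_mul]
    linear_combination F * hi + MvPolynomial.X i * hF

theorem odeFrob_iterate {q H G u v : K[X]} (hrel : u * H + v * G = 0)
    (h : ∀ F, MvPolynomial.C H * odeFrob p q F =
        (MvPolynomial.C u * MvPolynomial.X 0 + MvPolynomial.C v * MvPolynomial.X 1) *
          dirDer H G F) (F : MvPolynomial (Fin 2) K[X]) (j : ℕ) :
    (fun E => MvPolynomial.C H * odeFrob p q E)^[j] F =
      (MvPolynomial.C u * MvPolynomial.X 0 + MvPolynomial.C v * MvPolynomial.X 1) ^ j *
        (dirDer H G)^[j] F := by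
  have h0 : dirDer H G (MvPolynomial.C u * MvPolynomial.X 0 +
      MvPolynomial.C v * MvPolynomial.X 1) = 0 := by
    have := congrArg (MvPolynomial.C (σ := Fin 2)) hrel
    simp only [map_add, map_mul, map_zero] at this
    simp [dirDer_apply]
    linear_combination this
  induction j with
  | zero => simp
  | succ j ih =>
    rw [Function.iterate_succ_apply', ih, h, Derivation.leibniz, Derivation.leibniz_pow, h0,
      Function.iterate_succ_apply']
    simp only [smul_eq_mul, mul_zero, add_zero, smul_zero]
    ring

end OdeDerivation

section CramerAlternative

variable {K : Type*} [Field K]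

theorem natDegree_det_le_mul {s d : ℕ} (M : Matrix (Fin s) (Fin s) K[X])
    (h : ∀ i j, (M i j).natDegree ≤ d) : M.det.natDegree ≤ s * d := by
  rw [Matrix.det_apply]
  refine natDegree_sum_le_of_forall_le _ _ fun σ _ => ?_
  refine (natDegree_smul_le _ _).trans ((natDegree_prod_le _ _).trans ?_)
  refine (Finset.sum_le_sum fun i _ => h _ _).trans ?_
  simp

theorem natDegree_signed_det_le {s d : ℕ} (M : Matrix (Fin s) (Fin s) K[X]) (m : ℕ)
    (h : ∀ i j, (M i j).natDegree ≤ d) : ((-1) ^ m * M.det).natDegree ≤ s * d := by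
  refine natDegree_mul_le.trans ?_
  have h1 : ((-1 : K[X]) ^ m).natDegree ≤ 0 := by
    refine natDegree_pow_le.trans ?_
    simp
  have := natDegree_det_le_mul M h
  omega

theorem exists_orthogonal_or_combination {J ι : Type*} [Fintype J] [Fintype ι]
    (M : J → ι → K[X]) (k : ι) {d n : ℕ} (hd : ∀ j i, (M j i).natDegree ≤ d)
    (hn : Fintype.card ι ≤ n) :
    (∃ c : ι → K[X], (∀ i, (c i).natDegree ≤ n * d) ∧ c k ≠ 0 ∧ ∀ j, ∑ i, c i * M j i = 0) ∨
    ∃ (t : K[X]) (c : J → K[X]), t ≠ 0 ∧ t.natDegree ≤ n * d ∧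
      ∀ i, ∑ j, c j * M j i = if i = k then t else 0 := by
  set P : ℕ → Prop := fun s => ∃ (f : Fin s → J) (g : Fin s → ι), (∀ x, g x ≠ k) ∧
    (Matrix.of fun x y => M (f x) (g y)).det ≠ 0 with hP
  have hcard : ∀ s, P s → s + 1 ≤ n := by
    rintro s ⟨f, g, hg, hdet⟩
    have hinj : Function.Injective g := by
      intro x y hxy
      by_contra hne
      exact hdet (Matrix.det_zero_of_column_eq hne fun z => by simp [hxy])
    have hinj' : Function.Injective (Fin.cons k g : Fin (s + 1) → ι) :=
      Fin.cons_injective_iff.2 ⟨fun ⟨x, hx⟩ => hg x hx, hinj⟩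
    have := Fintype.card_le_of_injective _ hinj'
    rw [Fintype.card_fin] at this
    omega
  obtain ⟨s, hs, hs1⟩ : ∃ s, P s ∧ ¬ P (s + 1) := by
    by_contra! hcon
    have hall : ∀ s, P s := fun s => by
      induction s with
      | zero => exact ⟨Fin.elim0, Fin.elim0, fun x => x.elim0, by simp⟩
      | succ s ih => exact hcon s ih
    have := hcard n (hall n)
    omega
  have hsn := hcard s hs
  obtain ⟨f, g, hg, hdet⟩ := hs
  have hbord : ∀ j i, i ≠ k → (Matrix.of fun (x y : Fin (s + 1)) =>
      M ((Fin.cons j f : Fin (s + 1) → J) x) ((Fin.cons i g : Fin (s + 1) → ι) y)).det = 0 := by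
    intro j i hi
    by_contra hne
    exact hs1 ⟨_, _, fun x => by refine Fin.cases hi (fun x => ?_) x; simpa using hg x, hne⟩
  have hsd : s * d ≤ n * d := Nat.mul_le_mul_right d (by omega)
  by_cases hk : ∀ j, (Matrix.of fun (x y : Fin (s + 1)) =>
      M ((Fin.cons j f : Fin (s + 1) → J) x) ((Fin.cons k g : Fin (s + 1) → ι) y)).det = 0
  · left
    set b : Fin (s + 1) → K[X] := fun y => (-1) ^ (y : ℕ) *
      (Matrix.of fun x z => M (f x) ((Fin.cons k g : Fin (s + 1) → ι) (y.succAbove z))).det with hb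
    refine ⟨fun i => ∑ y with (Fin.cons k g : Fin (s + 1) → ι) y = i, b y, fun i => ?_, ?_, ?_⟩
    · refine natDegree_sum_le_of_forall_le _ _ fun y _ => ?_
      exact (natDegree_signed_det_le _ _ fun _ _ => hd _ _).trans hsd
    · have : (univ.filter fun y => (Fin.cons k g : Fin (s + 1) → ι) y = k) = {0} := by
        ext y
        refine Fin.cases (by simp) (fun y => ?_) y
        simpa using hg y
      simp only [this, Finset.sum_singleton]
      simpa [hb] using hdet
    · intro j
      have h := hk j
      rw [Matrix.det_succ_row_zero] at h
      rw [← h]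
      simp_rw [Finset.sum_mul]
      rw [Finset.sum_comm' (t' := univ)
        (s' := fun y => {(Fin.cons k g : Fin (s + 1) → ι) y}) (by simp [eq_comm])]
      refine Finset.sum_congr rfl fun y _ => ?_
      rw [Finset.sum_singleton]
      simp only [hb, Matrix.of_apply, Fin.cons_zero]
      rw [mul_right_comm]
      rfl
  · right
    push Not at hk
    obtain ⟨j, hj⟩ := hk
    set b : Fin (s + 1) → K[X] := fun x => (-1) ^ (x : ℕ) *
      (Matrix.of fun z y => M ((Fin.cons j f : Fin (s + 1) → J) (x.succAbove z)) (g y)).det with hb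
    refine ⟨_, fun i => ∑ x with (Fin.cons j f : Fin (s + 1) → J) x = i, b x, hj, ?_, ?_⟩
    · exact (natDegree_det_le_mul _ fun _ _ => hd _ _).trans (Nat.mul_le_mul_right d hsn)
    · intro i
      have h : ∑ x, b x * M ((Fin.cons j f : Fin (s + 1) → J) x) i =
          (Matrix.of fun (x y : Fin (s + 1)) =>
      M ((Fin.cons j f : Fin (s + 1) → J) x) ((Fin.cons i g : Fin (s + 1) → ι) y)).det := by
        rw [Matrix.det_succ_column_zero]
        refine Finset.sum_congr rfl fun x _ => ?_
        simp only [hb, Matrix.of_apply, Fin.cons_zero]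
        rw [mul_right_comm]
        rfl
      simp_rw [Finset.sum_mul]
      rw [Finset.sum_comm' (t' := univ)
        (s' := fun y => {(Fin.cons j f : Fin (s + 1) → J) y}) (by simp [eq_comm])]
      simp only [Finset.sum_singleton]
      rw [h]
      split_ifs with hik
      · rw [hik]
      · exact hbord j i hik

end CramerAlternative

section BoundedPolynomials

variable {K : Type*} [Field K]

/-- The exponent of `U ^ a V ^ b`. -/
def expo (a b : ℕ) : Fin 2 →₀ ℕ := Finsupp.single 0 a + Finsupp.single 1 b

@[simp] theorem expo_zero (a b : ℕ) : expo a b 0 = a := by simp [expo]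

@[simp] theorem expo_one (a b : ℕ) : expo a b 1 = b := by simp [expo]

theorem expo_eta (m : Fin 2 →₀ ℕ) : expo (m 0) (m 1) = m := by
  ext i; fin_cases i <;> simp

theorem degree_fin_two (m : Fin 2 →₀ ℕ) : m.degree = m 0 + m 1 := by
  rw [Finsupp.degree_eq_sum]; simp [Fin.sum_univ_two]

theorem monomial_expo (a b : ℕ) (r : K[X]) : MvPolynomial.monomial (expo a b) r =
    MvPolynomial.C r * MvPolynomial.X 0 ^ a * MvPolynomial.X 1 ^ b := by
  rw [MvPolynomial.monomial_eq, Finsupp.prod_fintype _ _ (by simp), Fin.prod_univ_two]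
  simp [mul_assoc]

/-- Polynomials in `U, V` of total degree at most `B` with coefficients of degree at most `D`. -/
def bddPoly (K : Type*) [Field K] (B D : ℕ) : AddSubgroup (MvPolynomial (Fin 2) K[X]) where
  carrier := {F | ∀ m, (MvPolynomial.coeff m F).natDegree ≤ D ∧
    (B < m 0 + m 1 → MvPolynomial.coeff m F = 0)}
  zero_mem' := fun m => by simp
  add_mem' := fun {F E} hF hE m => by
    rw [MvPolynomial.coeff_add]
    exact ⟨(natDegree_add_le _ _).trans (max_le (hF m).1 (hE m).1),
      fun h => by rw [(hF m).2 h, (hE m).2 h, add_zero]⟩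
  neg_mem' := fun {F} hF m => by
    rw [MvPolynomial.coeff_neg, natDegree_neg]
    exact ⟨(hF m).1, fun h => by rw [(hF m).2 h, neg_zero]⟩

theorem monomial_mem_bddPoly {B D a b : ℕ} {r : K[X]} (hab : a + b ≤ B) (hr : r.natDegree ≤ D) :
    MvPolynomial.C r * MvPolynomial.X 0 ^ a * MvPolynomial.X 1 ^ b ∈ bddPoly K B D := by
  intro m
  rw [← monomial_expo, MvPolynomial.coeff_monomial]
  split_ifs with h
  · subst h
    refine ⟨hr, fun h => ?_⟩
    simp at h
    omega
  · simp

theorem eq_sum_monomial (F : MvPolynomial (Fin 2) K[X]) : F = ∑ m ∈ F.support,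
    MvPolynomial.C (MvPolynomial.coeff m F) * MvPolynomial.X 0 ^ (m 0) *
      MvPolynomial.X 1 ^ (m 1) := by
  conv_lhs => rw [MvPolynomial.as_sum F]
  refine Finset.sum_congr rfl fun m _ => ?_
  rw [← monomial_expo, expo_eta]

theorem natDegree_natCast_mul_le (n : ℕ) (r : K[X]) : ((n : K[X]) * r).natDegree ≤ r.natDegree := by
  refine natDegree_mul_le.trans ?_
  simp

theorem odeDer_mem_bddPoly {q : K[X]} (hq : q.natDegree ≤ 2) {B D : ℕ}
    {F : MvPolynomial (Fin 2) K[X]} (hF : F ∈ bddPoly K B D) :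
    odeDer q F ∈ bddPoly K B (D + 2) := by
  rw [eq_sum_monomial F, map_sum]
  refine sum_mem fun m hm => ?_
  have hab : m 0 + m 1 ≤ B := by
    by_contra h
    exact (MvPolynomial.mem_support_iff.1 hm) ((hF m).2 (not_le.1 h))
  have hr := (hF m).1
  generalize MvPolynomial.coeff m F = r at *
  generalize m 0 = a at *
  generalize m 1 = b at *
  have key : odeDer q (MvPolynomial.C r * MvPolynomial.X 0 ^ a * MvPolynomial.X 1 ^ b) =
      MvPolynomial.C (eulerD K r) * MvPolynomial.X 0 ^ a * MvPolynomial.X 1 ^ b +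
      MvPolynomial.C ((a : K[X]) * r) * MvPolynomial.X 0 ^ (a - 1) * MvPolynomial.X 1 ^ (b + 1) +
      MvPolynomial.C ((b : K[X]) * (r * q)) * MvPolynomial.X 0 ^ (a + 1) *
        MvPolynomial.X 1 ^ (b - 1) := by
    simp only [Derivation.leibniz, Derivation.leibniz_pow, odeDer_C, odeDer_X_zero, odeDer_X_one,
      smul_eq_mul, nsmul_eq_mul, map_mul, map_natCast]
    ring
  rw [key]
  refine add_mem (add_mem (monomial_mem_bddPoly hab ?_) ?_) ?_
  · have := natDegree_eulerD_le r; omega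
  · rcases Nat.eq_zero_or_pos a with rfl | ha
    · simp
    · exact monomial_mem_bddPoly (by omega) ((natDegree_natCast_mul_le _ _).trans (by omega))
  · rcases Nat.eq_zero_or_pos b with rfl | hb
    · simp
    · refine monomial_mem_bddPoly (by omega) ((natDegree_natCast_mul_le _ _).trans ?_)
      exact natDegree_mul_le.trans (by omega)

theorem odeDer_iterate_mem_bddPoly {q : K[X]} (hq : q.natDegree ≤ 2) {B D : ℕ}
    {F : MvPolynomial (Fin 2) K[X]} (hF : F ∈ bddPoly K B D) (n : ℕ) :
    (odeDer q)^[n] F ∈ bddPoly K B (D + 2 * n) := by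
  induction n with
  | zero => exact hF
  | succ n ih =>
    rw [Function.iterate_succ_apply']
    exact odeDer_mem_bddPoly hq ih

theorem totalDegree_le_of_mem_bddPoly {B D : ℕ} {F : MvPolynomial (Fin 2) K[X]}
    (hF : F ∈ bddPoly K B D) : F.totalDegree ≤ B := by
  refine Finset.sup_le fun m hm => ?_
  change m.degree ≤ B
  rw [degree_fin_two]
  by_contra h
  exact (MvPolynomial.mem_support_iff.1 hm) ((hF m).2 (not_le.1 h))

theorem homogeneousComponent_eq_sum (F : MvPolynomial (Fin 2) K[X]) (e : ℕ) :
    MvPolynomial.homogeneousComponent e F = ∑ i ∈ range (e + 1),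
      MvPolynomial.C (MvPolynomial.coeff (expo i (e - i)) F) * MvPolynomial.X 0 ^ i *
        MvPolynomial.X 1 ^ (e - i) := by
  ext1 m
  rw [MvPolynomial.coeff_homogeneousComponent, degree_fin_two, MvPolynomial.coeff_sum]
  simp_rw [← monomial_expo, MvPolynomial.coeff_monomial]
  split_ifs with h
  · rw [Finset.sum_eq_single (m 0)]
    · rw [show e - m 0 = m 1 by omega, expo_eta, if_pos rfl]
    · intro i _ hi
      rw [if_neg]
      rintro rfl
      simp at hi
    · intro h1
      exact absurd (Finset.mem_range.2 (by omega)) h1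
  · rw [Finset.sum_eq_zero]
    intro i hi
    rw [Finset.mem_range] at hi
    rw [if_neg]
    rintro rfl
    simp at h
    omega

end BoundedPolynomials

section ZeroEstimate

variable {K : Type*} [Field K]

/-- The elements having a nonzero `R`-multiple in the submodule `N`. -/
def saturation {R M : Type*} [CommRing R] [IsDomain R] [AddCommGroup M] [Module R M]
    (N : Submodule R M) : Submodule R M where
  carrier := {w | ∃ t : R, t ≠ 0 ∧ t • w ∈ N}
  zero_mem' := ⟨1, one_ne_zero, by simp⟩
  add_mem' := by
    rintro a b ⟨s, hs, ha⟩ ⟨t, ht, hb⟩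
    refine ⟨s * t, mul_ne_zero hs ht, ?_⟩
    rw [smul_add]
    refine add_mem ?_ ?_
    · rw [mul_comm, mul_smul]; exact N.smul_mem _ ha
    · rw [mul_smul]; exact N.smul_mem _ hb
  smul_mem' := by
    rintro c a ⟨s, hs, ha⟩
    exact ⟨s, hs, by rw [smul_comm]; exact N.smul_mem _ ha⟩

theorem mem_saturation_of_smul {R M : Type*} [CommRing R] [IsDomain R] [AddCommGroup M]
    [Module R M] {N : Submodule R M} {w : M} {s : R} (hs : s ≠ 0) (h : s • w ∈ saturation N) :
    w ∈ saturation N := by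
  obtain ⟨t, ht, h⟩ := h
  exact ⟨t * s, mul_ne_zero ht hs, by rwa [mul_smul]⟩

theorem le_saturation {R M : Type*} [CommRing R] [IsDomain R] [AddCommGroup M] [Module R M]
    (N : Submodule R M) : N ≤ saturation N := fun w hw => ⟨1, one_ne_zero, by simpa⟩

theorem odeDer_smul (q r : K[X]) (F : MvPolynomial (Fin 2) K[X]) :
    odeDer q (r • F) = eulerD K r • F + r • odeDer q F := by
  rw [MvPolynomial.smul_eq_C_mul, Derivation.leibniz, odeDer_C, MvPolynomial.smul_eq_C_mul,
    MvPolynomial.smul_eq_C_mul, smul_eq_mul, smul_eq_mul]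
  ring

/-- The `K[X]`-span of the first `r` iterates of `odeDer q` at `F`. -/
def iterSpan (q : K[X]) (F : MvPolynomial (Fin 2) K[X]) (r : ℕ) :
    Submodule K[X] (MvPolynomial (Fin 2) K[X]) :=
  Submodule.span K[X] (Set.range fun j : Fin r => (odeDer q)^[j] F)

theorem odeDer_mem_saturation {q c : K[X]} {F : MvPolynomial (Fin 2) K[X]} {r : ℕ} (hc : c ≠ 0)
    (h : c • (odeDer q)^[r] F ∈ iterSpan q F r) {w : MvPolynomial (Fin 2) K[X]}
    (hw : w ∈ saturation (iterSpan q F r)) : odeDer q w ∈ saturation (iterSpan q F r) := by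
  have h1 : ∀ y ∈ iterSpan q F r, c • odeDer q y ∈ iterSpan q F r := by
    intro y hy
    induction hy using Submodule.span_induction with
    | mem y hy =>
      obtain ⟨j, rfl⟩ := hy
      simp only
      rw [← Function.iterate_succ_apply' (f := odeDer q)]
      by_cases hj : (j : ℕ) + 1 < r
      · exact Submodule.smul_mem _ _ (Submodule.subset_span ⟨⟨j + 1, hj⟩, rfl⟩)
      · rw [show (j : ℕ).succ = r by have := j.2; omega]
        exact h
    | zero => simp
    | add x y _ _ hx hy => rw [map_add, smul_add]; exact add_mem hx hy
    | smul a x hx' hx =>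
      rw [odeDer_smul, smul_add]
      refine add_mem (Submodule.smul_mem _ _ (Submodule.smul_mem _ _ hx')) ?_
      rw [smul_comm]
      exact Submodule.smul_mem _ _ hx
  obtain ⟨t, ht, hw⟩ := hw
  refine ⟨c * t * t, mul_ne_zero (mul_ne_zero hc ht) ht, ?_⟩
  have h2 := Submodule.smul_mem _ t (h1 _ hw)
  rw [odeDer_smul] at h2
  have h3 := Submodule.smul_mem _ (c * eulerD K t) hw
  have h4 := sub_mem h2 h3
  convert h4 using 1
  module

theorem mem_saturation_iterSpan {q c : K[X]} {F : MvPolynomial (Fin 2) K[X]} {r : ℕ} (hc : c ≠ 0)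
    (h : c • (odeDer q)^[r] F ∈ iterSpan q F r) : F ∈ saturation (iterSpan q F r) := by
  rcases Nat.eq_zero_or_pos r with rfl | hr
  · exact ⟨c, hc, by simpa using h⟩
  · exact le_saturation _ (Submodule.subset_span ⟨⟨0, hr⟩, rfl⟩)

theorem exists_smul_iterate_mem {q : K[X]} (hq : q.natDegree ≤ 2) {B D : ℕ}
    {F : MvPolynomial (Fin 2) K[X]} (hF : F ∈ bddPoly K B D) :
    ∃ r ≤ (B + 1) ^ 2, ∃ c : K[X], c ≠ 0 ∧ c • (odeDer q)^[r] F ∈ iterSpan q F r := by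
  set v : Fin ((B + 1) ^ 2 + 1) → (Fin (B + 1) × Fin (B + 1) → K[X]) := fun j i =>
    MvPolynomial.coeff (expo i.1 i.2) ((odeDer q)^[j] F) with hv
  have hdep : ¬ LinearIndependent K[X] v := by
    intro h
    have := h.fintype_card_le_finrank
    simp [sq] at this
  rw [Fintype.not_linearIndependent_iff] at hdep
  obtain ⟨c, hc, i₀, hi₀⟩ := hdep
  obtain ⟨r, hr, hmax⟩ := Finset.exists_max_image (univ.filter fun i => c i ≠ 0) id
    ⟨i₀, by simpa using hi₀⟩
  have hr' : c r ≠ 0 := by simpa using hr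
  refine ⟨r, by have := r.2; omega, c r, hr', ?_⟩
  have hF' : ∀ j : Fin ((B + 1) ^ 2 + 1), c j • (odeDer q)^[j] F ∈ iterSpan q F r ∨ j = r := by
    intro j
    rcases lt_trichotomy j r with hj | hj | hj
    · exact Or.inl (Submodule.smul_mem _ _ (Submodule.subset_span ⟨⟨j, hj⟩, rfl⟩))
    · exact Or.inr hj
    · left
      have : c j = 0 := by
        by_contra hne
        exact absurd (hmax j (by simpa using hne)) (not_le.2 hj)
      simp [this]
  have hsum : ∑ j, c j • (odeDer q)^[j] F = 0 := by
    ext1 m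
    by_cases hm : m 0 + m 1 ≤ B
    · have := congrFun hc (⟨m 0, by omega⟩, ⟨m 1, by omega⟩)
      simp only [hv, Finset.sum_apply, Pi.smul_apply, smul_eq_mul, Pi.zero_apply, expo_eta] at this
      simpa [MvPolynomial.coeff_sum] using this
    · rw [MvPolynomial.coeff_sum, Finset.sum_eq_zero]
      · simp
      · intro j _
        rw [MvPolynomial.coeff_smul, (odeDer_iterate_mem_bddPoly hq hF j m).2 (by omega), smul_zero]
  rw [← Finset.add_sum_erase _ _ (Finset.mem_univ r)] at hsum
  rw [eq_neg_of_add_eq_zero_left hsum]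
  refine neg_mem (sum_mem fun j hj => ?_)
  exact (hF' j).resolve_right (Finset.ne_of_mem_erase hj)

theorem dvd_eulerD_iterate (p : ℕ) [CharP K p] {P : K[X]} (h : X ^ p ∣ P) (n : ℕ) :
    X ^ p ∣ (eulerD K)^[n] P := by
  induction n with
  | zero => exact h
  | succ n ih =>
    rw [Function.iterate_succ_apply']
    obtain ⟨Q, hQ⟩ := ih
    rw [hQ, eulerD_apply, derivative_mul, derivative_X_pow, CharP.cast_eq_zero K p]
    exact ⟨X * (X - 1) * derivative Q, by simp; ring⟩

variable (p : ℕ) [Fact p.Prime] [CharP K p]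

theorem frob_pow_mem_saturation {q H G : K[X]} (hq : q.coeff 0 = 0)
    (hH : eulerD K H = G) (hG : eulerD K G = q * H) :
    ∃ u v : K[X], v ≠ 0 ∧ u * H + v * G = 0 ∧ ∀ (F : MvPolynomial (Fin 2) K[X]) (B r : ℕ)
      (c : K[X]), c ≠ 0 → c • (odeDer q)^[r] F ∈ iterSpan q F r → F.totalDegree ≤ B → B < p →
      MvPolynomial.eval ![H, G] (MvPolynomial.homogeneousComponent B F) ≠ 0 →
      (MvPolynomial.C u * MvPolynomial.X 0 + MvPolynomial.C v * MvPolynomial.X 1) ^ B ∈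
        saturation (iterSpan q F r) := by
  obtain ⟨u, v, hv, hrel, h⟩ := odeFrob_factor p hq hH hG
  refine ⟨u, v, hv, hrel, fun F B r c hc hr hFB hBp hne => ?_⟩
  have hstab : ∀ n, ∀ w ∈ saturation (iterSpan q F r),
      (odeDer q)^[n] w ∈ saturation (iterSpan q F r) := fun n w hw => by
    induction n with
    | zero => exact hw
    | succ n ih => rw [Function.iterate_succ_apply']; exact odeDer_mem_saturation hc hr ih
  have hiter : ∀ j, (fun E => MvPolynomial.C H * odeFrob p q E)^[j] F ∈
      saturation (iterSpan q F r) := fun j => by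
    induction j with
    | zero => exact mem_saturation_iterSpan hc hr
    | succ n ih =>
      rw [Function.iterate_succ_apply', ← MvPolynomial.smul_eq_C_mul, odeFrob_apply]
      exact Submodule.smul_mem _ _ (sub_mem (hstab _ _ ih) (hstab 1 _ ih))
  have hB := hiter B
  rw [odeFrob_iterate p hrel h, dirDer_iterate_top H G F hFB, mul_comm,
    ← MvPolynomial.smul_eq_C_mul] at hB
  refine mem_saturation_of_smul (mul_ne_zero ?_ hne) hB
  intro h0
  rw [CharP.cast_eq_zero_iff K[X] p, (Fact.out : p.Prime).dvd_factorial] at h0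
  omega

end ZeroEstimate

section ZeroEstimateMain

variable {K : Type*} [Field K]

/-- No nonzero binary form with coefficients of degree less than `N` vanishes at `(H, G)`. -/
def FormIndependent (H G : K[X]) (N : ℕ) : Prop :=
  ∀ (e : ℕ) (c : ℕ → K[X]), (∀ i, (c i).natDegree < N) →
    ∑ i ∈ range (e + 1), c i * H ^ i * G ^ (e - i) = 0 → ∀ i ≤ e, c i = 0

/-- Pairing of a coefficient vector with the coefficients of a polynomial. -/
def coeffPairing {B : ℕ} (c : Fin (B + 1) × Fin (B + 1) → K[X]) :
    MvPolynomial (Fin 2) K[X] →ₗ[K[X]] K[X] where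
  toFun F := ∑ i, c i * MvPolynomial.coeff (expo i.1 i.2) F
  map_add' F E := by simp [mul_add, Finset.sum_add_distrib]
  map_smul' r F := by
    simp only [MvPolynomial.coeff_smul, smul_eq_mul, RingHom.id_apply, Finset.mul_sum]
    exact Finset.sum_congr rfl fun i _ => by ring

theorem coeffPairing_monomial {B : ℕ} (c : Fin (B + 1) × Fin (B + 1) → K[X]) {a b : ℕ}
    (ha : a < B + 1) (hb : b < B + 1) (r : K[X]) :
    coeffPairing c (MvPolynomial.C r * MvPolynomial.X 0 ^ a * MvPolynomial.X 1 ^ b) =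
      c (⟨a, ha⟩, ⟨b, hb⟩) * r := by
  rw [← monomial_expo]
  change ∑ i, c i * MvPolynomial.coeff (expo i.1 i.2) (MvPolynomial.monomial (expo a b) r) = _
  rw [Finset.sum_eq_single (⟨a, ha⟩, ⟨b, hb⟩)]
  · simp [MvPolynomial.coeff_monomial]
  · intro i _ hi
    rw [MvPolynomial.coeff_monomial, if_neg, mul_zero]
    intro h
    apply hi
    have h0 := DFunLike.congr_fun h 0
    have h1 := DFunLike.congr_fun h 1
    simp at h0 h1
    exact Prod.ext (Fin.ext h0.symm) (Fin.ext h1.symm)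
  · simp

theorem linear_form_pow (u v : K[X]) (e : ℕ) :
    (MvPolynomial.C u * MvPolynomial.X 0 + MvPolynomial.C v * MvPolynomial.X 1 :
      MvPolynomial (Fin 2) K[X]) ^ e = ∑ a ∈ range (e + 1),
      MvPolynomial.C (u ^ a * v ^ (e - a) * (e.choose a : K[X])) * MvPolynomial.X 0 ^ a *
        MvPolynomial.X 1 ^ (e - a) := by
  rw [add_pow]
  refine Finset.sum_congr rfl fun a _ => ?_
  simp only [mul_pow, map_mul, map_pow, map_natCast]
  ring

theorem coeffPairing_linear_form_ne_zero {H G u v : K[X]} {N B e : ℕ} (hN : 0 < N)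
    (hind : FormIndependent H G N) (hv : v ≠ 0) (hrel : u * H + v * G = 0) (he : e < B + 1)
    (c : Fin (B + 1) × Fin (B + 1) → K[X]) (hc : ∀ i, (c i).natDegree < N)
    (hc0 : c (⟨e, he⟩, ⟨0, by omega⟩) ≠ 0) :
    coeffPairing c ((MvPolynomial.C u * MvPolynomial.X 0 +
      MvPolynomial.C v * MvPolynomial.X 1) ^ e) ≠ 0 := by
  intro h0
  rw [linear_form_pow, map_sum] at h0
  set b : ℕ → K[X] := fun i => if h : e - i < B + 1 then
    (((-1 : ℤ) ^ (e - i) * (e.choose i : ℤ) : ℤ) : K[X]) * c (⟨e - i, h⟩, ⟨e - (e - i), by omega⟩) else 0 with hb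
  have hbdeg : ∀ i, (b i).natDegree < N := by
    intro i
    simp only [hb]
    split_ifs with h
    · refine lt_of_le_of_lt natDegree_mul_le ?_
      rw [natDegree_intCast, zero_add]
      exact hc _
    · simpa using hN
  have hsum : v ^ e * ∑ i ∈ range (e + 1), b i * H ^ i * G ^ (e - i) = 0 := by
    rw [← mul_zero (H ^ e), ← h0, Finset.mul_sum, Finset.mul_sum, ← Finset.sum_range_reflect]
    refine Finset.sum_congr rfl fun a ha => ?_
    rw [Finset.mem_range] at ha
    have e1 : e + 1 - 1 - a = e - a := by omega
    have e2 : e - (e - a) = a := by omega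
    rw [e1, coeffPairing_monomial c (by omega : a < B + 1) (by omega : e - a < B + 1)]
    simp only [hb, e2]
    rw [dif_pos (by omega : a < B + 1), Nat.choose_symm (by omega : a ≤ e)]
    have hsplit : ∀ z : K[X], z ^ e = z ^ a * z ^ (e - a) := fun z => by
      rw [← pow_add]; congr 1; omega
    have huv : u ^ a * H ^ a = (-1) ^ a * (v ^ a * G ^ a) := by
      rw [← mul_pow, ← mul_pow, ← mul_pow]
      congr 1
      linear_combination hrel
    rw [hsplit v, hsplit H]
    push_cast
    linear_combination (-(H ^ (e - a) * c (⟨a, by omega⟩, ⟨e - a, by omega⟩) * v ^ (e - a) * (e.choose a : K[X]))) * huv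
  have hz := hind e b hbdeg ((mul_eq_zero.1 hsum).resolve_left (pow_ne_zero _ hv)) 0 (by omega)
  simp only [hb] at hz
  rw [dif_pos (by omega)] at hz
  simp only [Nat.sub_zero, Nat.choose_zero_right, Nat.cast_one, mul_one, Nat.sub_self] at hz
  rcases mul_eq_zero.1 hz with hz | hz
  · push_cast at hz
    exact absurd hz (pow_ne_zero _ (neg_ne_zero.2 one_ne_zero))
  · exact hc0 hz

theorem odeDer_zero_estimate (p : ℕ) [Fact p.Prime] [CharP K p] {q H G : K[X]} {N B D : ℕ}
    (hq : q.coeff 0 = 0) (hq2 : q.natDegree ≤ 2)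
    (hH : eulerD K H = G) (hG : eulerD K G = q * H) (hH0 : H.coeff 0 ≠ 0)
    (hind : FormIndependent H G N) (hB : B < p) (hDN : D < N)
    (hN : (B + 1) ^ 2 * (D + 2 * (B + 1) ^ 2) < N) (hp : (B + 1) ^ 2 * (D + 2 * (B + 1) ^ 2) < p)
    {F : MvPolynomial (Fin 2) K[X]} (hF : F ∈ bddPoly K B D)
    (hdvd : X ^ p ∣ MvPolynomial.eval ![H, G] F) : F = 0 := by
  by_contra hF0
  obtain ⟨r, hr, c, hc, hcr⟩ := exists_smul_iterate_mem hq2 hF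
  obtain ⟨u, v, hv, hrel, hfrob⟩ := frob_pow_mem_saturation p hq hH hG
  set e := F.totalDegree with he
  have heB : e ≤ B := totalDegree_le_of_mem_bddPoly hF
  have htop : MvPolynomial.eval ![H, G] (MvPolynomial.homogeneousComponent e F) ≠ 0 := by
    intro h0
    have hcomp : MvPolynomial.homogeneousComponent e F = 0 := by
      rw [homogeneousComponent_eq_sum] at h0 ⊢
      simp only [map_sum, map_mul, MvPolynomial.eval_C, map_pow, MvPolynomial.eval_X,
        Matrix.cons_val_zero, Matrix.cons_val_one] at h0
      have := hind e (fun i => MvPolynomial.coeff (expo i (e - i)) F)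
        (fun i => lt_of_le_of_lt (hF _).1 hDN) h0
      refine Finset.sum_eq_zero fun i hi => ?_
      rw [this i (by rw [Finset.mem_range] at hi; omega)]
      simp
    obtain ⟨m, hm, hme⟩ := Finset.exists_mem_eq_sup F.support
      (MvPolynomial.support_nonempty.2 hF0) (fun s => s.sum fun _ e => e)
    have hdeg : m.degree = e := by rw [he, MvPolynomial.totalDegree, hme]; rfl
    have := MvPolynomial.coeff_homogeneousComponent e F m
    rw [hcomp, if_pos hdeg] at this
    exact (MvPolynomial.mem_support_iff.1 hm) (by simpa using this.symm)
  obtain ⟨t, ht, htN⟩ := hfrob F e r c hc hcr le_rfl (by omega) htop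
  set M : Fin r → (Fin (B + 1) × Fin (B + 1)) → K[X] := fun j i =>
    MvPolynomial.coeff (expo i.1 i.2) ((odeDer q)^[j] F) with hM
  have hMd : ∀ j i, (M j i).natDegree ≤ D + 2 * (B + 1) ^ 2 := fun j i =>
    (odeDer_iterate_mem_bddPoly hq2 hF j _).1.trans (by have := j.2; omega)
  rcases exists_orthogonal_or_combination M (⟨e, by omega⟩, ⟨0, by omega⟩) hMd
    (n := (B + 1) ^ 2) (by simp [sq]) with ⟨b, hb, hb0, hbo⟩ | ⟨s, b, hs, hsd, hsum⟩
  · refine coeffPairing_linear_form_ne_zero (by omega) hind hv hrel (by omega) b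
      (fun i => lt_of_le_of_lt (hb i) hN) hb0 ?_
    have hzero : ∀ y ∈ iterSpan q F r, coeffPairing b y = 0 := by
      intro y hy
      induction hy using Submodule.span_induction with
      | mem y hy => obtain ⟨j, rfl⟩ := hy; exact hbo j
      | zero => simp
      | add x y _ _ hx hy => rw [map_add, hx, hy, add_zero]
      | smul a x _ hx => rw [map_smul, hx, smul_zero]
    have := hzero _ htN
    rw [map_smul, smul_eq_mul, mul_eq_zero] at this
    exact this.resolve_left ht
  · have hmem : MvPolynomial.C s * MvPolynomial.X 0 ^ e * MvPolynomial.X 1 ^ 0 =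
        ∑ j, b j • (odeDer q)^[(j : ℕ)] F := by
      rw [← monomial_expo]
      ext1 m
      rw [MvPolynomial.coeff_sum]
      by_cases hm : m 0 + m 1 ≤ B
      · have := hsum (⟨m 0, by omega⟩, ⟨m 1, by omega⟩)
        simp only [hM, expo_eta] at this
        simp only [MvPolynomial.coeff_smul, smul_eq_mul]
        rw [this, MvPolynomial.coeff_monomial]
        congr 1
        rw [Prod.mk.injEq, Fin.mk.injEq, Fin.mk.injEq, eq_iff_iff]
        constructor
        · rintro rfl; simp
        · rintro ⟨h1, h2⟩; rw [← expo_eta m, h1, h2]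
      · rw [MvPolynomial.coeff_monomial, if_neg, Finset.sum_eq_zero]
        · intro j _
          rw [MvPolynomial.coeff_smul, (odeDer_iterate_mem_bddPoly hq2 hF j m).2 (by omega),
            smul_zero]
        · rintro rfl
          simp at hm
          omega
    have hev := congrArg (MvPolynomial.eval ![H, G]) hmem
    simp only [map_mul, MvPolynomial.eval_C, map_pow, MvPolynomial.eval_X,
        Matrix.cons_val_zero, pow_zero, mul_one, map_sum, MvPolynomial.smul_eval,
        eval_odeDer_iterate hH hG] at hev
    have hd : X ^ p ∣ s * H ^ e := by
      rw [hev]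
      exact Finset.dvd_sum fun j _ => (dvd_eulerD_iterate p hdvd _).mul_left _
    have hcop : IsCoprime (X ^ p : K[X]) (H ^ e) := by
      apply IsCoprime.pow
      rw [Polynomial.irreducible_X.coprime_iff_not_dvd, X_dvd_iff]
      exact hH0
    have hds := hcop.dvd_of_dvd_mul_right hd
    have := natDegree_le_of_dvd hds hs
    rw [natDegree_X_pow] at this
    omega

end ZeroEstimateMain

section StepanovMultiplicity

variable {K : Type*} [Field K] (p : ℕ) [CharP K p]

theorem pow_dvd_of_eulerD_iterate_eval_eq_zero {s : K} (hs0 : s ≠ 0) (hs1 : s ≠ 1) {n : ℕ}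
    (hn : n ≤ p) (P : K[X]) (h : ∀ i < n, ((eulerD K)^[i] P).eval s = 0) :
    (X - C s) ^ n ∣ P := by
  induction n generalizing P with
  | zero => simp
  | succ n ih =>
    by_cases hP : P = 0
    · simp [hP]
    have hroot : P.IsRoot s := h 0 (by omega)
    have h1 : (X - C s) ^ n ∣ derivative P := by
      have h2 := ih (by omega) (eulerD K P) fun i hi => by
        have := h (i + 1) (by omega)
        rwa [Function.iterate_succ_apply] at this
      rw [eulerD_apply] at h2
      refine (IsCoprime.pow_left ?_).dvd_of_dvd_mul_left h2
      rw [(irreducible_X_sub_C s).coprime_iff_not_dvd, dvd_iff_isRoot]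
      simp [hs0, sub_eq_zero, hs1]
    rw [← le_rootMultiplicity_iff hP]
    by_contra hlt
    push Not at hlt
    have hpos := (rootMultiplicity_pos hP).2 hroot
    have hne : ((P.rootMultiplicity s : ℕ) : K) ≠ 0 := by
      rw [Ne, CharP.cast_eq_zero_iff K p]
      intro hd
      have := Nat.le_of_dvd hpos hd
      omega
    have hder := derivative_rootMultiplicity_of_root_of_mem_nonZeroDivisors hroot
      (mem_nonZeroDivisors_of_ne_zero hne)
    by_cases hP' : derivative P = 0
    · obtain ⟨Q, hQ, hQs⟩ := exists_eq_pow_rootMultiplicity_mul_and_not_dvd P hP s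
      set m := P.rootMultiplicity s with hm
      obtain ⟨l, hl⟩ : ∃ l, m = l + 1 := ⟨m - 1, by omega⟩
      rw [hQ, derivative_mul, derivative_X_sub_C_pow, hl] at hP'
      have h3 : (X - C s) ^ l * (C ((m : ℕ) : K) * Q + (X - C s) * derivative Q) = 0 := by
        rw [← hP', hl]; simp only [Nat.add_sub_cancel, Nat.cast_add, Nat.cast_one, map_add, map_one, map_natCast]; ring
      have h4 := (mul_eq_zero.1 h3).resolve_left (pow_ne_zero _ (X_sub_C_ne_zero s))
      have h5 := congrArg (Polynomial.eval s) h4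
      simp only [eval_add, eval_mul, eval_C, eval_sub, eval_X, sub_self, zero_mul, add_zero,
        eval_zero] at h5
      rw [dvd_iff_isRoot] at hQs
      exact hQs ((mul_eq_zero.1 h5).resolve_left hne)
    · rw [← le_rootMultiplicity_iff hP'] at h1
      omega

theorem card_mul_le_natDegree {S : Finset K} (hS0 : ∀ s ∈ S, s ≠ 0) (hS1 : ∀ s ∈ S, s ≠ 1) {n : ℕ}
    (hn : n ≤ p) {P : K[X]} (hP : P ≠ 0)
    (h : ∀ s ∈ S, ∀ i < n, ((eulerD K)^[i] P).eval s = 0) : S.card * n ≤ P.natDegree := by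
  have hd : ∏ s ∈ S, (X - C s) ^ n ∣ P := by
    refine Finset.prod_dvd_of_coprime (fun a _ b _ hab => ?_) fun s hs =>
      pow_dvd_of_eulerD_iterate_eval_eq_zero p (hS0 s hs) (hS1 s hs) hn P (h s hs)
    exact (pairwise_coprime_X_sub_C Function.injective_id hab).pow
  have := natDegree_le_of_dvd hd hP
  rw [natDegree_prod _ _ fun s _ => pow_ne_zero _ (X_sub_C_ne_zero s)] at this
  simpa using this

end StepanovMultiplicity

section AuxiliaryPolynomial

variable {K : Type*} [Field K]

theorem eval_eq_sum_of_mem_bddPoly {B D : ℕ} {F : MvPolynomial (Fin 2) K[X]}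
    (hF : F ∈ bddPoly K B D) (H G : K[X]) : MvPolynomial.eval ![H, G] F =
      ∑ b ∈ range (B + 1), ∑ a ∈ range (B + 1),
        MvPolynomial.coeff (expo a b) F * H ^ a * G ^ b := by
  have h : F = ∑ b ∈ range (B + 1), ∑ a ∈ range (B + 1),
      MvPolynomial.monomial (expo a b) (MvPolynomial.coeff (expo a b) F) := by
    ext1 m
    simp_rw [MvPolynomial.coeff_sum, MvPolynomial.coeff_monomial]
    by_cases hm : m 0 + m 1 ≤ B
    · rw [Finset.sum_eq_single (m 1), Finset.sum_eq_single (m 0)]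
      · rw [expo_eta, if_pos rfl]
      · intro a _ ha
        rw [if_neg]
        rintro h; apply ha; rw [← h]; simp
      · intro h1; exact absurd (Finset.mem_range.2 (by omega)) h1
      · intro b _ hb
        refine Finset.sum_eq_zero fun a _ => ?_
        rw [if_neg]
        rintro h; apply hb; rw [← h]; simp
      · intro h1; exact absurd (Finset.mem_range.2 (by omega)) h1
    · rw [(hF m).2 (by omega)]
      symm
      refine Finset.sum_eq_zero fun b _ => Finset.sum_eq_zero fun a _ => ?_
      split_ifs with h
      · rw [h]; exact (hF m).2 (by omega)
      · rfl
  conv_lhs => rw [h]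
  simp_rw [monomial_expo]
  simp

/-- The index set of the coefficients of the auxiliary polynomial. -/
abbrev AuxIndex (k : ℕ) :=
  Fin (3 * k + 1) × Fin (3 * k + 1) × Fin (3 * k + 1) × Fin (k ^ 2 + 1)

/-- The `j`-th coefficient of the auxiliary polynomial. -/
def auxPoly {k : ℕ} (x : AuxIndex k → K) (j : Fin (3 * k + 1)) : MvPolynomial (Fin 2) K[X] :=
  ∑ a : Fin (3 * k + 1), ∑ b : Fin (3 * k + 1),
    MvPolynomial.C (∑ i : Fin (k ^ 2 + 1), C (x (j, a, b, i)) * X ^ (i : ℕ)) *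
      MvPolynomial.X 0 ^ (a : ℕ) * MvPolynomial.X 1 ^ (b : ℕ)

theorem auxPoly_add {k : ℕ} (x y : AuxIndex k → K) (j : Fin (3 * k + 1)) :
    auxPoly (x + y) j = auxPoly x j + auxPoly y j := by
  simp [auxPoly, add_mul, Finset.sum_add_distrib]

theorem auxPoly_smul {k : ℕ} (r : K) (x : AuxIndex k → K) (j : Fin (3 * k + 1)) :
    auxPoly (r • x) j = MvPolynomial.C (C r) * auxPoly x j := by
  simp only [auxPoly, Finset.mul_sum]
  refine Finset.sum_congr rfl fun a _ => Finset.sum_congr rfl fun b _ => ?_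
  rw [← mul_assoc, ← mul_assoc, ← map_mul, Finset.mul_sum]
  simp [mul_assoc]

theorem auxPoly_mem {k : ℕ} (x : AuxIndex k → K) (j : Fin (3 * k + 1)) :
    auxPoly x j ∈ bddPoly K (6 * k) (k ^ 2) := by
  refine sum_mem fun a _ => sum_mem fun b _ => monomial_mem_bddPoly (by omega) ?_
  refine natDegree_sum_le_of_forall_le _ _ fun i _ => ?_
  exact (natDegree_C_mul_X_pow_le _ _).trans (by omega)

theorem coeff_auxPoly {k : ℕ} (x : AuxIndex k → K) (j a b : Fin (3 * k + 1)) :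
    MvPolynomial.coeff (expo a b) (auxPoly x j) =
      ∑ i : Fin (k ^ 2 + 1), C (x (j, a, b, i)) * X ^ (i : ℕ) := by
  simp_rw [auxPoly, ← monomial_expo, MvPolynomial.coeff_sum, MvPolynomial.coeff_monomial]
  rw [Finset.sum_eq_single a, Finset.sum_eq_single b]
  · simp
  · intro b' _ hb
    rw [if_neg]
    intro h
    have := DFunLike.congr_fun h 1
    simp only [expo_one] at this
    exact hb (Fin.ext this)
  · simp
  · intro a' _ ha
    refine Finset.sum_eq_zero fun b' _ => ?_
    rw [if_neg]
    intro h
    have := DFunLike.congr_fun h 0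
    simp only [expo_zero] at this
    exact ha (Fin.ext this)
  · simp

theorem auxPoly_injective {k : ℕ} (x : AuxIndex k → K) (h : ∀ j, auxPoly x j = 0) : x = 0 := by
  funext ⟨j, a, b, i⟩
  have h1 := coeff_auxPoly x j a b
  rw [h j, MvPolynomial.coeff_zero] at h1
  have h2 := congrArg (fun P => P.coeff i) h1
  simp only [coeff_zero, finsetSum_coeff, coeff_C_mul_X_pow] at h2
  rw [Finset.sum_eq_single i] at h2
  · simpa using h2.symm
  · intro i' _ hi
    rw [if_neg]
    intro h; exact hi (Fin.ext h.symm)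
  · simp

/-- The vanishing conditions imposed on the auxiliary polynomial. -/
def auxCond {k : ℕ} (q : K[X]) (c : K) (i b : ℕ) (F : Fin (3 * k + 1) → MvPolynomial (Fin 2) K[X]) :
    K[X] :=
  ∑ j : Fin (3 * k + 1), X ^ (j : ℕ) * ∑ a ∈ range (6 * k + 1),
    C (c ^ a) * MvPolynomial.coeff (expo a b) ((odeDer q)^[i] (F j))

theorem odeDer_iterate_C_mul (q : K[X]) (r : K) (F : MvPolynomial (Fin 2) K[X]) (n : ℕ) :
    (odeDer q)^[n] (MvPolynomial.C (C r) * F) = MvPolynomial.C (C r) * (odeDer q)^[n] F := by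
  induction n with
  | zero => rfl
  | succ n ih =>
    rw [Function.iterate_succ_apply', ih, Derivation.leibniz, odeDer_C, eulerD_apply,
      Function.iterate_succ_apply']
    simp

/-- The vanishing conditions as a linear map. -/
def auxMap (k : ℕ) (q : K[X]) (c : K) : (AuxIndex k → K) →ₗ[K]
    (Fin (k ^ 2) × Fin (6 * k + 1) × Fin (3 * k ^ 2 + 3 * k) → K) where
  toFun x i := (auxCond q c i.1 i.2.1 (auxPoly x)).coeff i.2.2
  map_add' x y := by
    funext i
    simp only [auxCond, auxPoly_add, iterate_map_add, MvPolynomial.coeff_add, mul_add,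
      Finset.sum_add_distrib, coeff_add, Pi.add_apply]
  map_smul' r x := by
    funext i
    simp only [RingHom.id_apply, Pi.smul_apply, smul_eq_mul]
    rw [← coeff_C_mul]
    congr 1
    simp only [auxCond, auxPoly_smul, odeDer_iterate_C_mul, MvPolynomial.coeff_C_mul,
      Finset.mul_sum]
    exact Finset.sum_congr rfl fun j _ => Finset.sum_congr rfl fun a _ => by ring

theorem natDegree_auxCond_lt {k : ℕ} {q : K[X]} (hq : q.natDegree ≤ 2) (c : K) {i : ℕ}
    (hi : i < k ^ 2) (b : ℕ) (x : AuxIndex k → K) :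
    (auxCond q c i b (auxPoly x)).natDegree < 3 * k ^ 2 + 3 * k := by
  have hle : (auxCond q c i b (auxPoly x)).natDegree ≤ 3 * k + (k ^ 2 + 2 * i) := by
    refine natDegree_sum_le_of_forall_le _ _ fun j _ => natDegree_mul_le.trans ?_
    refine add_le_add ((natDegree_X_pow_le _).trans (by omega)) ?_
    refine natDegree_sum_le_of_forall_le _ _ fun a _ => (natDegree_C_mul_le _ _).trans ?_
    exact (odeDer_iterate_mem_bddPoly hq (auxPoly_mem x j) i _).1
  omega

theorem exists_auxPoly {k : ℕ} (hk : 0 < k) {q : K[X]} (hq : q.natDegree ≤ 2) (c : K) :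
    ∃ x : AuxIndex k → K, x ≠ 0 ∧
      ∀ i < k ^ 2, ∀ b < 6 * k + 1, auxCond q c i b (auxPoly x) = 0 := by
  have hker : LinearMap.ker (auxMap k q c) ≠ ⊥ := by
    apply LinearMap.ker_ne_bot_of_finrank_lt
    simp only [Module.finrank_fintype_fun_eq_card, Fintype.card_prod, Fintype.card_fin]
    have h1 : k ^ 4 ≤ k ^ 5 := Nat.pow_le_pow_right hk (by norm_num)
    have h2 : k ^ 3 ≤ k ^ 4 := Nat.pow_le_pow_right hk (by norm_num)
    nlinarith [Nat.zero_le (k ^ 2), Nat.zero_le (k ^ 3)]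
  obtain ⟨x, hx, hx0⟩ := (Submodule.ne_bot_iff _).1 hker
  refine ⟨x, hx0, fun i hi b hb => ?_⟩
  ext n
  by_cases hn : n < 3 * k ^ 2 + 3 * k
  · exact congrFun (LinearMap.mem_ker.1 hx) (⟨i, hi⟩, ⟨b, hb⟩, ⟨n, hn⟩)
  · exact coeff_eq_zero_of_natDegree_lt
      ((natDegree_auxCond_lt hq c hi b x).trans_le (not_lt.1 hn))

end AuxiliaryPolynomial

section StepanovBound

variable {K : Type*} [Field K] (p : ℕ) [CharP K p]

theorem eulerD_X_pow_mul (j : ℕ) (P : K[X]) :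
    eulerD K (X ^ (p * j) * P) = X ^ (p * j) * eulerD K P := by
  rw [Derivation.leibniz, smul_eq_mul, smul_eq_mul, eulerD_apply (X ^ (p * j)), derivative_X_pow,
    Nat.cast_mul, CharP.cast_eq_zero K p]
  simp

theorem eulerD_iterate_X_pow_mul (j n : ℕ) (P : K[X]) :
    (eulerD K)^[n] (X ^ (p * j) * P) = X ^ (p * j) * (eulerD K)^[n] P := by
  induction n with
  | zero => rfl
  | succ n ih =>
    rw [Function.iterate_succ_apply', ih, eulerD_X_pow_mul, Function.iterate_succ_apply']

variable [Fact p.Prime]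

theorem natDegree_eval_auxPoly_le {k h : ℕ} (H G : K[X]) (hH : H.natDegree ≤ h)
    (hG : G.natDegree ≤ h + 1) (x : AuxIndex k → K) (j : Fin (3 * k + 1)) :
    (MvPolynomial.eval ![H, G] (auxPoly x j)).natDegree ≤ k ^ 2 + 3 * k * (2 * h + 1) := by
  simp only [auxPoly, map_sum, map_mul, map_pow, MvPolynomial.eval_C, MvPolynomial.eval_X,
    Matrix.cons_val_zero, Matrix.cons_val_one]
  refine natDegree_sum_le_of_forall_le _ _ fun a _ =>
    natDegree_sum_le_of_forall_le _ _ fun b _ => ?_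
  have h1 : (∑ i : Fin (k ^ 2 + 1), C (x (j, a, b, i)) * X ^ (i : ℕ)).natDegree ≤ k ^ 2 := by
    refine natDegree_sum_le_of_forall_le _ _ fun i _ => ?_
    exact (natDegree_C_mul_X_pow_le _ _).trans (by omega)
  have h2 : (H ^ (a : ℕ)).natDegree ≤ 3 * k * h :=
    natDegree_pow_le.trans (Nat.mul_le_mul (by omega) hH)
  have h3 : (G ^ (b : ℕ)).natDegree ≤ 3 * k * (h + 1) :=
    natDegree_pow_le.trans (Nat.mul_le_mul (by omega) hG)
  refine natDegree_mul_le.trans ((add_le_add (natDegree_mul_le.trans (add_le_add h1 h2)) h3).trans ?_)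
  nlinarith

theorem stepanov_level_bound {q H G : K[X]} {N k h : ℕ} (hk : 0 < k)
    (hq : q.coeff 0 = 0) (hq2 : q.natDegree ≤ 2)
    (hH : eulerD K H = G) (hG : eulerD K G = q * H) (hH0 : H.coeff 0 ≠ 0)
    (hdeg : H.natDegree ≤ h) (hh : 2 * h + 1 ≤ p) (hind : FormIndependent H G N)
    (hN : (6 * k + 1) ^ 2 * (k ^ 2 + 2 * (6 * k + 1) ^ 2) < N)
    (hp : (6 * k + 1) ^ 2 * (k ^ 2 + 2 * (6 * k + 1) ^ 2) < p)
    {c : K} {S : Finset K} (hS0 : ∀ s ∈ S, s ≠ 0) (hS1 : ∀ s ∈ S, s ≠ 1)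
    (hSp : ∀ s ∈ S, s ^ p = s) (hSc : ∀ s ∈ S, H.eval s = c) :
    S.card * k ^ 2 ≤ 6 * k * p + k ^ 2 := by
  obtain ⟨x, hx, hcond⟩ := exists_auxPoly hk hq2 c
  set Φ : K[X] := ∑ j : Fin (3 * k + 1),
    X ^ (p * (j : ℕ)) * MvPolynomial.eval ![H, G] (auxPoly x j) with hΦ
  have hpp : 0 < p := (Fact.out : p.Prime).pos
  have hsq : k ^ 2 + 6 * k < (6 * k + 1) ^ 2 * (k ^ 2 + 2 * (6 * k + 1) ^ 2) := by nlinarith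
  have hzero : ∀ F ∈ bddPoly K (6 * k) (k ^ 2), X ^ p ∣ MvPolynomial.eval ![H, G] F → F = 0 :=
    fun F hF hd => odeDer_zero_estimate p hq hq2 hH hG hH0 hind (by omega) (by omega) hN hp hF hd
  have hΦ0 : Φ ≠ 0 := by
    intro h0
    apply hx
    apply auxPoly_injective
    have hall : ∀ n, ∀ j : Fin (3 * k + 1), (j : ℕ) = n → auxPoly x j = 0 := by
      intro n
      induction n using Nat.strong_induction_on with
      | _ n ih =>
        rintro j rfl
        apply hzero _ (auxPoly_mem x j)
        have h1 : X ^ (p * ((j : ℕ) + 1)) ∣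
            X ^ (p * (j : ℕ)) * MvPolynomial.eval ![H, G] (auxPoly x j) := by
          rw [hΦ, ← Finset.add_sum_erase _ _ (Finset.mem_univ j)] at h0
          rw [eq_neg_of_add_eq_zero_left h0, dvd_neg]
          refine Finset.dvd_sum fun i hi => ?_
          rcases lt_trichotomy (i : ℕ) j with hij | hij | hij
          · rw [ih i hij i rfl]; simp
          · exact absurd (Fin.ext hij) (Finset.ne_of_mem_erase hi)
          · exact (pow_dvd_pow X (Nat.mul_le_mul_left p hij)).mul_right _
        rw [mul_add, pow_add, mul_one] at h1
        exact (mul_dvd_mul_iff_left (pow_ne_zero _ X_ne_zero)).1 h1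
    exact fun j => hall j j rfl
  have hvan : ∀ s ∈ S, ∀ i < k ^ 2, ((eulerD K)^[i] Φ).eval s = 0 := by
    intro s hs i hi
    rw [hΦ, map_iterate_sum]
    simp_rw [eulerD_iterate_X_pow_mul, ← eval_odeDer_iterate hH hG]
    rw [eval_finsetSum]
    have h1 : ∀ j : Fin (3 * k + 1), (X ^ (p * (j : ℕ)) *
        MvPolynomial.eval ![H, G] ((odeDer q)^[i] (auxPoly x j))).eval s =
        ∑ b ∈ range (6 * k + 1), (G.eval s) ^ b * (X ^ (j : ℕ) * ∑ a ∈ range (6 * k + 1),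
          C (c ^ a) * MvPolynomial.coeff (expo a b) ((odeDer q)^[i] (auxPoly x j))).eval s := by
      intro j
      rw [eval_eq_sum_of_mem_bddPoly (odeDer_iterate_mem_bddPoly hq2 (auxPoly_mem x j) i)]
      simp only [eval_mul, eval_pow, eval_X, eval_finsetSum, pow_mul, hSp s hs, hSc s hs, eval_C,
        Finset.mul_sum]
      exact Finset.sum_congr rfl fun b _ => Finset.sum_congr rfl fun a _ => by ring
    rw [Finset.sum_congr rfl fun j _ => h1 j, Finset.sum_comm]
    refine Finset.sum_eq_zero fun b hb => ?_
    rw [← Finset.mul_sum, ← eval_finsetSum]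
    have h2 := hcond i hi b (Finset.mem_range.1 hb)
    unfold auxCond at h2
    rw [h2]
    simp
  have hGdeg : G.natDegree ≤ h + 1 := by
    have := natDegree_eulerD_le H
    rw [hH] at this
    omega
  have hΦdeg : Φ.natDegree ≤ p * (3 * k) + (k ^ 2 + 3 * k * (2 * h + 1)) := by
    refine natDegree_sum_le_of_forall_le _ _ fun j _ => natDegree_mul_le.trans ?_
    refine add_le_add ((natDegree_X_pow_le _).trans (Nat.mul_le_mul_left p (by omega))) ?_
    exact natDegree_eval_auxPoly_le H G hdeg hGdeg x j
  have hfin := card_mul_le_natDegree p hS0 hS1 (n := k ^ 2) (by omega) hΦ0 hvan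
  have : 3 * k * (2 * h + 1) ≤ 3 * k * p := Nat.mul_le_mul_left _ hh
  nlinarith

end StepanovBound

section FormIndependence

variable {K : Type*} [Field K]

theorem formIndependent_of_isCoprime {H G : K[X]} (hH : H ≠ 0) (hcop : IsCoprime H G) :
    FormIndependent H G H.natDegree := by
  intro e
  induction e with
  | zero =>
    intro c _ h i hi
    obtain rfl : i = 0 := by omega
    simpa using h
  | succ e ih =>
    intro c hc h
    rw [Finset.sum_range_succ'] at h
    have h1 : ∑ i ∈ range (e + 1), c (i + 1) * H ^ (i + 1) * G ^ (e + 1 - (i + 1)) =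
        H * ∑ i ∈ range (e + 1), c (i + 1) * H ^ i * G ^ (e - i) := by
      rw [Finset.mul_sum]
      refine Finset.sum_congr rfl fun i _ => ?_
      rw [Nat.add_sub_add_right]
      ring
    rw [h1] at h
    have h0 : c 0 = 0 := by
      by_contra hne
      have hd : H ∣ c 0 * G ^ (e + 1) := by
        refine ⟨-∑ i ∈ range (e + 1), c (i + 1) * H ^ i * G ^ (e - i), ?_⟩
        simp only [pow_zero, mul_one, Nat.sub_zero] at h
        linear_combination h
      have := natDegree_le_of_dvd ((hcop.pow_right (n := e + 1)).dvd_of_dvd_mul_right hd) hne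
      have := hc 0
      omega
    rw [h0, zero_mul, zero_mul, add_zero] at h
    have h2 := ih (fun i => c (i + 1)) (fun i => hc _) ((mul_eq_zero.1 h).resolve_left hH)
    intro i hi
    rcases i with _ | i
    · exact h0
    · exact h2 i (by omega)

theorem FormIndependent.mono {H G : K[X]} {N M : ℕ} (h : FormIndependent H G N) (hM : M ≤ N) :
    FormIndependent H G M := fun e c hc hs => h e c (fun i => (hc i).trans_le hM) hs

theorem FormIndependent.mul_left {H G r : K[X]} {N : ℕ} (hr : r ≠ 0)
    (h : FormIndependent H G N) : FormIndependent (r * H) (r * G) N := by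
  intro e c hc hs
  refine h e c hc ?_
  have h1 : ∑ i ∈ range (e + 1), c i * (r * H) ^ i * (r * G) ^ (e - i) =
      r ^ e * ∑ i ∈ range (e + 1), c i * H ^ i * G ^ (e - i) := by
    rw [Finset.mul_sum]
    refine Finset.sum_congr rfl fun i hi => ?_
    rw [← Nat.add_sub_of_le (Nat.lt_succ_iff.1 (Finset.mem_range.1 hi)), Nat.add_sub_cancel_left]
    ring
  rw [h1] at hs
  exact (mul_eq_zero.1 hs).resolve_left (pow_ne_zero _ hr)

theorem coeff_eulerD_succ (P : K[X]) (k : ℕ) :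
    (eulerD K P).coeff (k + 1) = k * P.coeff k - (k + 1) * P.coeff (k + 1) := by
  have h : eulerD K P = X * (X * derivative P) - X * derivative P := by rw [eulerD_apply]; ring
  rw [h, coeff_sub, coeff_X_mul, coeff_X_mul, coeff_derivative]
  rcases k with _ | k
  · simp
  · rw [coeff_X_mul, coeff_derivative]; push_cast; ring

theorem eulerD_X_sub_one_pow_mul (μ : ℕ) (P : K[X]) :
    eulerD K ((X - 1) ^ μ * P) = (X - 1) ^ μ * ((μ : K[X]) * X * P + eulerD K P) := by
  simp only [eulerD_apply, derivative_mul]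
  rcases μ with _ | μ
  · simp
  · rw [derivative_pow]
    simp only [derivative_sub, derivative_X, derivative_one, map_natCast]
    push_cast
    ring

variable (p : ℕ) [CharP K p]

theorem natDegree_eq_zero_of_derivative_eq_zero_of_lt {d : K[X]} (hd : derivative d = 0)
    (hlt : d.natDegree < p) : d.natDegree = 0 := by
  by_contra hne
  obtain ⟨n, hn⟩ := Nat.exists_eq_succ_of_ne_zero hne
  have h := congrArg (fun P => coeff P n) hd
  simp only [coeff_derivative, coeff_zero] at h
  rcases mul_eq_zero.1 h with h | h
  · rw [← Nat.succ_eq_add_one, ← hn, coeff_natDegree, leadingCoeff_eq_zero] at h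
    simp [h] at hne
  · have h' : ((n + 1 : ℕ) : K) = 0 := by exact_mod_cast h
    rw [CharP.cast_eq_zero_iff K p] at h'
    have := Nat.le_of_dvd (by omega) h'
    omega

theorem isUnit_of_dvd_eulerD {d : K[X]} (hd : d ∣ eulerD K d) (h0 : d.eval 0 ≠ 0)
    (h1 : d.eval 1 ≠ 0) (hlt : d.natDegree < p) : IsUnit d := by
  have hne : d ≠ 0 := by rintro rfl; simp at h0
  have hc0 : IsCoprime d X := by
    have := (irreducible_X_sub_C (0 : K)).coprime_iff_not_dvd (n := d)
    rw [dvd_iff_isRoot, map_zero, sub_zero] at this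
    exact (this.2 h0).symm
  have hc1 : IsCoprime d (X - 1) := by
    have := (irreducible_X_sub_C (1 : K)).coprime_iff_not_dvd (n := d)
    rw [dvd_iff_isRoot, map_one] at this
    exact (this.2 h1).symm
  have h2 : d ∣ derivative d := (hc0.mul_right hc1).dvd_of_dvd_mul_left hd
  have h3 : derivative d = 0 := by
    by_contra h
    have h4 := natDegree_le_of_dvd h2 h
    have h5 : d.natDegree ≠ 0 := by
      intro h6
      rw [natDegree_eq_zero] at h6
      obtain ⟨c, rfl⟩ := h6
      simp at h
    have := natDegree_derivative_lt h5
    omega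
  rw [isUnit_iff_degree_eq_zero, degree_eq_natDegree hne,
    natDegree_eq_zero_of_derivative_eq_zero_of_lt p h3 hlt]
  rfl

theorem isCoprime_of_eulerD_stable {P Q a b c d : K[X]} (hP : eulerD K P = a * P + b * Q)
    (hQ : eulerD K Q = c * P + d * Q) (h0 : P.eval 0 ≠ 0) (h1 : P.eval 1 ≠ 0)
    (hlt : P.natDegree < p) : IsCoprime P Q := by
  have hne : P ≠ 0 := by rintro rfl; simp at h0
  rw [← EuclideanDomain.gcd_isUnit_iff]
  set D := EuclideanDomain.gcd P Q with hD
  have hDP : D ∣ P := EuclideanDomain.gcd_dvd_left _ _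
  have hDQ : D ∣ Q := EuclideanDomain.gcd_dvd_right _ _
  refine isUnit_of_dvd_eulerD p ?_ (fun h => h0 ?_) (fun h => h1 ?_)
    ((natDegree_le_of_dvd hDP hne).trans_lt hlt)
  · conv_rhs => rw [hD, EuclideanDomain.gcd_eq_gcd_ab, map_add, Derivation.leibniz,
      Derivation.leibniz, hP, hQ]
    simp only [smul_eq_mul]
    exact dvd_add
      (dvd_add (hDP.mul_right _) (Dvd.dvd.mul_left (dvd_add (hDP.mul_left _) (hDQ.mul_left _)) _))
      (dvd_add (hDQ.mul_right _) (Dvd.dvd.mul_left (dvd_add (hDP.mul_left _) (hDQ.mul_left _)) _))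
  · obtain ⟨u, hu⟩ := hDP; rw [hu, eval_mul, h, zero_mul]
  · obtain ⟨u, hu⟩ := hDP; rw [hu, eval_mul, h, zero_mul]

variable [Fact p.Prime]

theorem le_natDegree_of_hypergeometric (hp : 3 < p) {q H G : K[X]}
    (hq : 144 * q = 31 * X - 27 * X ^ 2) (hH : eulerD K H = G) (hG : eulerD K G = q * H)
    (hH0 : H ≠ 0) : p ≤ 4 * H.natDegree + 3 := by
  set n := H.natDegree with hn
  have hz1 : H.coeff (n + 1) = 0 := coeff_eq_zero_of_natDegree_lt (by omega)
  have hz2 : H.coeff (n + 2) = 0 := coeff_eq_zero_of_natDegree_lt (by omega)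
  have e1 : G.coeff (n + 1) = n * H.coeff n := by rw [← hH, coeff_eulerD_succ, hz1]; ring
  have e2 : G.coeff (n + 2) = 0 := by
    rw [← hH, coeff_eulerD_succ, hz1, hz2]; ring
  have e3 : (q * H).coeff (n + 2) = (n + 1) * n * H.coeff n := by
    rw [← hG, coeff_eulerD_succ, e2, e1]; push_cast; ring
  have e4 : (144 * (q * H)).coeff (n + 2) = -27 * H.coeff n := by
    rw [← mul_assoc, hq]
    have : (31 * X - 27 * X ^ 2 : K[X]) * H = C 31 * (X * H) - C 27 * (X * (X * H)) := by
      rw [show (C 31 : K[X]) = 31 from rfl, show (C 27 : K[X]) = 27 from rfl]; ring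
    rw [this, coeff_sub, coeff_C_mul, coeff_C_mul, coeff_X_mul, coeff_X_mul, coeff_X_mul, hz1]
    ring
  have e5 : (144 * (q * H)).coeff (n + 2) = 144 * (q * H).coeff (n + 2) := by
    have : (144 : K[X]) = C 144 := rfl
    rw [this, coeff_C_mul]
  have hl : H.coeff n ≠ 0 := by rw [hn, coeff_natDegree]; simpa using hH0
  have e6 : (((4 * n + 1) * (4 * n + 3) * 9 : ℕ) : K) = 0 := by
    rw [e5, e3] at e4
    have : (144 * ((n : K) + 1) * n + 27) * H.coeff n = 0 := by linear_combination e4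
    have := (mul_eq_zero.1 this).resolve_right hl
    push_cast
    linear_combination this
  rw [CharP.cast_eq_zero_iff K p] at e6
  have hpp : p.Prime := Fact.out
  rcases (hpp.dvd_mul).1 e6 with h | h
  · rcases (hpp.dvd_mul).1 h with h | h
    · have := Nat.le_of_dvd (by omega) h; omega
    · have := Nat.le_of_dvd (by omega) h; omega
  · have : p ∣ 3 ^ 2 := h
    have := Nat.le_of_dvd (by omega) (hpp.dvd_of_dvd_pow this)
    omega

theorem formIndependent_of_hypergeometric (hp : 3 < p) {q H G : K[X]} {N : ℕ}
    (hq : 144 * q = 31 * X - 27 * X ^ 2) (hH : eulerD K H = G) (hG : eulerD K G = q * H)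
    (hH0 : H.eval 0 ≠ 0) (hdeg : 2 * H.natDegree + 1 ≤ p) (hN : 12 * N + 11 ≤ p) :
    FormIndependent H G N := by
  have hpp : p.Prime := Fact.out
  have hodd : p % 2 = 1 := (hpp.eq_two_or_odd).resolve_left (by omega)
  have hne : H ≠ 0 := by rintro rfl; simp at hH0
  have hn := le_natDegree_of_hypergeometric p hp hq hH hG hne
  obtain ⟨H1, hH1, hndvd⟩ := exists_eq_pow_rootMultiplicity_mul_and_not_dvd H hne 1
  set μ := H.rootMultiplicity 1 with hμ
  rw [map_one] at hH1 hndvd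
  have h11 : H1.eval 1 ≠ 0 := by
    rw [← map_one C, dvd_iff_isRoot] at hndvd; exact hndvd
  have hX1 : (X - 1 : K[X]) ≠ 0 := by rw [← map_one C]; exact X_sub_C_ne_zero 1
  have h10 : H1.eval 0 ≠ 0 := fun h => hH0 (by rw [hH1, eval_mul, h, mul_zero])
  have hH1ne : H1 ≠ 0 := by rintro rfl; simp at h10
  have hdegs : H.natDegree = μ + H1.natDegree := by
    rw [hH1, natDegree_mul (pow_ne_zero _ hX1) hH1ne, natDegree_pow, ← map_one C,
      natDegree_X_sub_C, mul_one]
  set G1 := (μ : K[X]) * X * H1 + eulerD K H1 with hG1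
  have hGG : G = (X - 1) ^ μ * G1 := by rw [← hH, hH1, eulerD_X_sub_one_pow_mul]
  have hQ : (μ : K[X]) * X * G1 + eulerD K G1 = q * H1 := by
    have := hG
    rw [hGG, eulerD_X_sub_one_pow_mul, hH1] at this
    refine mul_left_cancel₀ (pow_ne_zero μ hX1) ?_
    rw [this]; ring
  have hev : ((36 * μ * μ : ℕ) : K) = 1 := by
    have e1 := congrArg (Polynomial.eval 1) hQ
    have e2 := congrArg (Polynomial.eval 1) hq
    simp only [hG1, eval_add, eval_mul, eval_natCast, eval_X, eulerD_apply, eval_sub, eval_one,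
      eval_ofNat, eval_pow] at e1 e2
    have e4 : (144 * (μ : K) * μ - 4) * H1.eval 1 = 0 := by
      linear_combination 144 * e1 + H1.eval 1 * e2
    have e5 := (mul_eq_zero.1 e4).resolve_right h11
    have e6 : (4 : K) ≠ 0 := by
      have : ((4 : ℕ) : K) ≠ 0 := by
        rw [Ne, CharP.cast_eq_zero_iff K p]
        intro h
        have : p ∣ 2 ^ 2 := h
        have := Nat.le_of_dvd (by omega) (hpp.dvd_of_dvd_pow this)
        omega
      exact_mod_cast this
    push_cast
    refine mul_left_cancel₀ e6 ?_
    linear_combination e5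
  have hμpos : 0 < μ := by
    rcases Nat.eq_zero_or_pos μ with h | h
    · rw [h] at hev; simp at hev
    · exact h
  have hμle : 6 * μ ≤ p + 1 := by
    have h2 : (((6 * μ - 1) * (6 * μ + 1) : ℕ) : K) = 0 := by
      rw [Nat.cast_mul, Nat.cast_sub (by omega)]
      push_cast at hev ⊢
      linear_combination hev
    rw [CharP.cast_eq_zero_iff K p] at h2
    rcases (hpp.dvd_mul).1 h2 with ⟨k, hk⟩ | ⟨k, hk⟩
    · have : k < 3 := by
        by_contra hk3
        have := Nat.mul_le_mul_left p (not_lt.1 hk3)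
        omega
      interval_cases k <;> omega
    · have : k < 3 := by
        by_contra hk3
        have := Nat.mul_le_mul_left p (not_lt.1 hk3)
        omega
      interval_cases k <;> omega
  have hcop : IsCoprime H1 G1 := by
    refine isCoprime_of_eulerD_stable p (a := -((μ : K[X]) * X)) (b := 1) (c := q)
      (d := -((μ : K[X]) * X)) ?_ ?_ h10 h11 (by omega)
    · rw [hG1]; ring
    · linear_combination hQ
  have hfin := ((formIndependent_of_isCoprime hH1ne hcop).mono (M := N) (by omega)).mul_left
    (pow_ne_zero μ hX1)
  rwa [← hH1, ← hGG] at hfin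

end FormIndependence

section TracePolynomial

variable {K : Type*} [Field K]

theorem eulerD_eulerD_linear_pow (a b : K) (m : ℕ) :
    eulerD K (eulerD K ((C a + C b * X) ^ (m + 2))) = (C a + C b * X) ^ m *
      (((m + 2 : ℕ) : K[X]) * ((m + 1 : ℕ) : K[X]) * (X * (X - 1) * C b) ^ 2 +
        ((m + 2 : ℕ) : K[X]) * (C a + C b * X) * (X * (X - 1) * (2 * X - 1) * C b)) := by
  have hL : derivative (C a + C b * X) = C b := by simp
  generalize C a + C b * X = L at hL ⊢
  simp only [eulerD_apply, derivative_mul, derivative_pow_succ, derivative_sub, derivative_C,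
    derivative_X, derivative_one, map_add, map_natCast, map_one, hL, derivative_natCast]
  push_cast
  ring

/-- The auxiliary polynomial exhibiting the hypergeometric equation up to an exact derivative. -/
def gaussManinPoly (K : Type*) [Field K] : K[X][X] :=
  C X * (-12 - 68 * X - 87 * X ^ 2 + 31 * X ^ 4) +
    C (X ^ 2) * (24 + 104 * X + 114 * X ^ 2 - 27 * X ^ 4) +
    C (X ^ 3) * (-12 - 36 * X - 27 * X ^ 2)

theorem natDegree_gaussManinPoly_le : (gaussManinPoly K).natDegree ≤ 4 := by
  rw [gaussManinPoly]; compute_degree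

/-- The generic cubic as a polynomial in two variables. -/
def genericCubic (K : Type*) [Field K] : K[X][X] := X ^ 3 + C (X - 1) * (3 * X + 2)

theorem natDegree_genericCubic_le : (genericCubic K).natDegree ≤ 3 := by
  rw [genericCubic]; compute_degree

variable [Fintype K] (p : ℕ) [CharP K p]

theorem sum_eval_derivative_eq_zero [Fact p.Prime] (hcard : Fintype.card K = p) (P : K[X][X])
    (hP : P.natDegree ≤ 2 * (p - 1)) : ∑ z : K, (derivative P).eval (C z) = 0 := by
  have hpp : p.Prime := Fact.out
  have h1 : ∀ z : K, (derivative P).eval (C z) =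
      ∑ n ∈ range (P.natDegree + 1), P.coeff n * (n : K[X]) * C (z ^ (n - 1)) := fun z => by
    conv_lhs => rw [P.as_sum_range]
    simp only [derivative_sum, derivative_monomial, eval_finsetSum, eval_monomial, map_pow]
  simp only [h1]
  rw [Finset.sum_comm]
  refine Finset.sum_eq_zero fun n hn => ?_
  rw [← Finset.mul_sum, ← map_sum]
  have hn' : n ≤ 2 * (p - 1) := by have := Finset.mem_range.1 hn; omega
  rcases eq_or_ne n p with rfl | hne
  · rw [CharP.cast_eq_zero, mul_zero, zero_mul]
  rcases Nat.eq_zero_or_pos n with rfl | hpos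
  · simp
  suffices h : ∑ z : K, z ^ (n - 1) = 0 by rw [h, map_zero, mul_zero]
  rcases lt_or_ge (n - 1) (p - 1) with hlt | hge
  · exact FiniteField.sum_pow_lt_card_sub_one _ _ (by rwa [hcard])
  · have h2 : ∀ z : K, z ^ (n - 1) = z ^ (n - p) := fun z => by
      have h3 : z ^ p = z := by rw [← hcard]; exact FiniteField.pow_card z
      have hp0 := hpp.pos
      have h4 : n - 1 = p + (n - p - 1) := by omega
      have h5 : n - p = 1 + (n - p - 1) := by omega
      rw [h4, h5, pow_add, pow_add, h3, pow_one, ← h5]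
    simp only [h2]
    exact FiniteField.sum_pow_lt_card_sub_one _ _ (by rw [hcard]; omega)

/-- The polynomial `∑ z, (z³ + (X - 1)(3z + 2)) ^ m`, whose values are, for `m = (p - 1) / 2`,
the traces of Frobenius (modulo `p`) along a universal family of elliptic curves. -/
def tracePoly (K : Type*) [Field K] [Fintype K] (m : ℕ) : K[X] :=
  ∑ z : K, (C (z ^ 3 - 3 * z - 2) + C (3 * z + 2) * X) ^ m

theorem eval_tracePoly (m : ℕ) (x : K) : (tracePoly K m).eval x =
    ∑ z : K, (z ^ 3 + (x - 1) * (3 * z + 2)) ^ m := by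
  rw [tracePoly, eval_finsetSum]
  refine Finset.sum_congr rfl fun z _ => ?_
  simp only [eval_pow, eval_add, eval_mul, eval_C, eval_X]
  ring

theorem natDegree_tracePoly_le (m : ℕ) : (tracePoly K m).natDegree ≤ m := by
  refine natDegree_sum_le_of_forall_le _ _ fun z _ => natDegree_pow_le.trans ?_
  calc m * _ ≤ m * 1 := Nat.mul_le_mul_left m (by compute_degree)
    _ = m := mul_one m

theorem eval_zero_tracePoly_ne_zero [Fact p.Prime] (hcard : Fintype.card K = p) {m : ℕ}
    (hm : 2 * m + 1 = p) (hp : 3 < p) : (tracePoly K m).eval 0 ≠ 0 := by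
  have hpp : p.Prime := Fact.out
  have h3 : (-3 : K) ≠ 0 := by
    have : ((3 : ℕ) : K) ≠ 0 := by
      rw [Ne, CharP.cast_eq_zero_iff K p]
      intro h
      have := Nat.le_of_dvd (by omega) h
      omega
    simpa using this
  have h1 : ∀ z : K, (z ^ 3 + (0 - 1) * (3 * z + 2)) ^ m =
      (z - 2) ^ m - if z = -1 then (-3) ^ m else 0 := fun z => by
    have : z ^ 3 + (0 - 1) * (3 * z + 2) = (z - 2) * (z + 1) ^ 2 := by ring
    rw [this, mul_pow, ← pow_mul]
    split_ifs with hz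
    · subst hz
      rw [neg_add_cancel, zero_pow (by omega)]
      norm_num
    · have : (z + 1) ^ (2 * m) = 1 := by
        have h := FiniteField.pow_card_sub_one_eq_one (z + 1) (fun h => hz (eq_neg_of_add_eq_zero_left h))
        rwa [hcard, ← hm, Nat.add_sub_cancel] at h
      rw [this]; ring
  rw [eval_tracePoly]
  simp only [h1]
  rw [Finset.sum_sub_distrib, Finset.sum_ite_eq' Finset.univ (-1 : K)]
  have h2 : ∑ z : K, (z - 2) ^ m = 0 := by
    rw [Fintype.sum_equiv (Equiv.subRight (2 : K)) (fun z => (z - 2) ^ m) (fun z => z ^ m)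
      fun z => rfl]
    exact FiniteField.sum_pow_lt_card_sub_one _ _ (by rw [hcard]; omega)
  rw [h2, if_pos (Finset.mem_univ _), zero_sub]
  exact neg_ne_zero.2 (pow_ne_zero _ h3)

theorem eulerD_eulerD_tracePoly [Fact p.Prime] (hcard : Fintype.card K = p) {m : ℕ}
    (hm : 2 * m + 1 = p) (hp : 3 < p) :
    144 * eulerD K (eulerD K (tracePoly K m)) = (31 * X - 27 * X ^ 2) * tracePoly K m := by
  obtain ⟨n, rfl⟩ : ∃ n, m = n + 2 := ⟨m - 2, by omega⟩
  have hc : (2 * (n : K[X]) + 5) = 0 := by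
    have : ((2 * (n + 2) + 1 : ℕ) : K[X]) = 0 := by rw [hm]; exact CharP.cast_eq_zero _ _
    push_cast at this
    linear_combination this
  have h0 := sum_eval_derivative_eq_zero p hcard
    (gaussManinPoly K * genericCubic K ^ (n + 1)) (by
      have h1 := natDegree_gaussManinPoly_le (K := K)
      have h2 : (genericCubic K ^ (n + 1)).natDegree ≤ (n + 1) * 3 :=
        natDegree_pow_le.trans (Nat.mul_le_mul_left _ natDegree_genericCubic_le)
      have := (natDegree_mul_le (p := gaussManinPoly K) (q := genericCubic K ^ (n + 1)))
      omega)
  replace h0 := congrArg (2 * ·) h0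
  rw [mul_zero, Finset.mul_sum] at h0
  rw [← sub_eq_zero, ← h0, tracePoly, map_sum, map_sum, Finset.mul_sum, Finset.mul_sum,
    ← Finset.sum_sub_distrib]
  refine Finset.sum_congr rfl fun z _ => ?_
  have hg : genericCubic K = X ^ 3 - 3 * X - 2 + (3 * X + 2) * C X := by
    rw [genericCubic, map_sub, map_one]; ring
  have hgz : (genericCubic K).eval (C z) = C (z ^ 3 - 3 * z - 2) + C (3 * z + 2) * X := by
    rw [hg]
    simp only [eval_add, eval_mul, eval_sub, eval_pow, eval_X, eval_C, eval_ofNat, map_add, map_sub,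
      map_mul, map_pow, map_ofNat]
  have hgd : (derivative (genericCubic K)).eval (C z) = 3 * C z ^ 2 + 3 * (X - 1) := by
    rw [genericCubic]
    simp only [derivative_add, derivative_mul, derivative_C, derivative_X, derivative_ofNat,
      derivative_X_pow, eval_add, eval_mul, eval_pow, eval_X, eval_C, eval_ofNat, eval_zero]
    simp only [zero_mul, Nat.cast_ofNat, eval_one]
    ring
  rw [derivative_mul, derivative_pow_succ, eval_add, eval_mul, eval_mul, eval_mul, eval_mul, hgd,
    eval_pow, eval_pow, hgz, eulerD_eulerD_linear_pow]
  have hS : (gaussManinPoly K).eval (C z) =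
      X * (-12 - 68 * C z - 87 * C z ^ 2 + 31 * C z ^ 4) +
      X ^ 2 * (24 + 104 * C z + 114 * C z ^ 2 - 27 * C z ^ 4) +
      X ^ 3 * (-12 - 36 * C z - 27 * C z ^ 2) := by
    rw [gaussManinPoly]
    simp only [eval_add, eval_mul, eval_sub, eval_neg, eval_pow, eval_X, eval_C, eval_ofNat]
  have hSd : (derivative (gaussManinPoly K)).eval (C z) =
      X * (-68 - 174 * C z + 124 * C z ^ 3) +
      X ^ 2 * (104 + 228 * C z - 108 * C z ^ 3) +
      X ^ 3 * (-36 - 54 * C z) := by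
    rw [gaussManinPoly]
    simp only [derivative_add, derivative_sub, derivative_neg, derivative_mul, derivative_C,
      derivative_X, derivative_ofNat, derivative_X_pow, eval_add, eval_mul, eval_sub, eval_neg,
      eval_pow, eval_X, eval_C, eval_ofNat, eval_zero]
    simp only [zero_mul, Nat.cast_ofNat, eval_one]
    ring
  have hB : (C (3 * z + 2) : K[X]) = 3 * C z + 2 := by
    simp only [map_add, map_mul, map_ofNat]
  have hA : (C (z ^ 3 - 3 * z - 2) : K[X]) = C z ^ 3 - 3 * C z - 2 := by
    simp only [map_sub, map_mul, map_pow, map_ofNat]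
  have hn : (C ((n : K[X]) + 1)).eval (C z) = (n : K[X]) + 1 := eval_C
  rw [hS, hSd, hn, hB, hA]
  generalize (C z : K[X]) = w
  push_cast
  linear_combination (w ^ 3 - 3 * w - 2 + (3 * w + 2) * X) ^ n *
    (36 * (X * (X - 1) * (3 * w + 2)) ^ 2 * (2 * n + 1) +
      72 * (w ^ 3 - 3 * w - 2 + (3 * w + 2) * X) * (X * (X - 1) * (2 * X - 1) * (3 * w + 2)) -
      (X * (-12 - 68 * w - 87 * w ^ 2 + 31 * w ^ 4) +
      X ^ 2 * (24 + 104 * w + 114 * w ^ 2 - 27 * w ^ 4) +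
      X ^ 3 * (-12 - 36 * w - 27 * w ^ 2)) * (3 * w ^ 2 + 3 * (X - 1))) * hc

end TracePolynomial

section TraceLevelSets

variable {K : Type*} [Field K] [Fintype K] (p : ℕ) [CharP K p] [Fact p.Prime]

theorem card_level_tracePoly_mul_le (hcard : Fintype.card K = p) {m k : ℕ} (hm : 2 * m + 1 = p)
    (hk : 0 < k) (hp : 65536 * k ^ 4 ≤ p) {c : K} {S : Finset K} (hS0 : ∀ s ∈ S, s ≠ 0)
    (hS1 : ∀ s ∈ S, s ≠ 1) (hSc : ∀ s ∈ S, (tracePoly K m).eval s = c) :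
    S.card * k ^ 2 ≤ 6 * k * p + k ^ 2 := by
  have hpp : p.Prime := Fact.out
  have hk1 : 1 ≤ k ^ 4 := Nat.one_le_pow _ _ hk
  have hbd : (6 * k + 1) ^ 2 * (k ^ 2 + 2 * (6 * k + 1) ^ 2) ≤ 4851 * k ^ 4 := by
    have h : (6 * k + 1) ^ 2 ≤ (7 * k) ^ 2 := Nat.pow_le_pow_left (by omega) 2
    calc _ ≤ (7 * k) ^ 2 * (k ^ 2 + 2 * (7 * k) ^ 2) := by gcongr
      _ = _ := by ring
  have h144 : (144 : K) ≠ 0 := by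
    have : ((144 : ℕ) : K) ≠ 0 := by
      rw [Ne, CharP.cast_eq_zero_iff K p]
      intro h
      have := Nat.le_of_dvd (by omega) h
      omega
    exact_mod_cast this
  set q : K[X] := C (31 / 144) * X - C (27 / 144) * X ^ 2 with hq
  have h144' : (144 : K[X]) = C 144 := rfl
  have hq144 : 144 * q = 31 * X - 27 * X ^ 2 := by
    rw [hq, h144', mul_sub, ← mul_assoc, ← mul_assoc, ← map_mul, ← map_mul,
      mul_div_cancel₀ _ h144, mul_div_cancel₀ _ h144]
    rfl
  have hODE : eulerD K (eulerD K (tracePoly K m)) = q * tracePoly K m := by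
    have h := eulerD_eulerD_tracePoly p hcard hm (by omega)
    rw [← hq144, mul_assoc] at h
    refine mul_left_cancel₀ ?_ h
    rw [h144', Ne, C_eq_zero]
    exact h144
  have h0 := eval_zero_tracePoly_ne_zero p hcard hm (by omega)
  refine stepanov_level_bound p (N := 4851 * k ^ 4 + 1) (h := m) hk ?_ ?_ rfl hODE ?_
    (natDegree_tracePoly_le m) hm.le ?_ (by omega) (by omega) hS0 hS1 (fun s _ => ?_) hSc
  · simp [hq]
  · rw [hq]; compute_degree
  · rwa [coeff_zero_eq_eval_zero]
  · refine formIndependent_of_hypergeometric p (by omega) hq144 rfl hODE h0 ?_ (by omega)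
    have := natDegree_tracePoly_le (K := K) m
    omega
  · rw [← hcard]; exact FiniteField.pow_card s

theorem card_level_tracePoly_le (hcard : Fintype.card K = p) {m : ℕ} (hm : 2 * m + 1 = p)
    {c : K} {S : Finset K} (hS0 : ∀ s ∈ S, s ≠ 0)
    (hS1 : ∀ s ∈ S, s ≠ 1) (hSc : ∀ s ∈ S, (tracePoly K m).eval s = c) :
    (S.card : ℝ) ≤ 193 * (p : ℝ) ^ (3 / 4 : ℝ) := by
  have hpp : p.Prime := Fact.out
  set y : ℝ := (p : ℝ) ^ (1 / 4 : ℝ) with hy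
  have hp1 : (1 : ℝ) ≤ p := by exact_mod_cast hpp.one_le
  have hy1 : 1 ≤ y := Real.one_le_rpow hp1 (by norm_num)
  have hy4 : y ^ 4 = p := by
    rw [hy, ← Real.rpow_natCast, ← Real.rpow_mul (by positivity)]; norm_num
  have hy3 : (p : ℝ) ^ (3 / 4 : ℝ) = y ^ 3 := by
    rw [hy, ← Real.rpow_natCast, ← Real.rpow_mul (by positivity)]; norm_num
  rw [hy3]
  rcases lt_or_ge y 16 with hlt | hge
  · have h1 : (S.card : ℝ) ≤ y ^ 4 := by
      rw [hy4, ← hcard]; exact_mod_cast Finset.card_le_univ S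
    have h2 : 0 < y ^ 3 := by positivity
    nlinarith
  · set k := ⌊y / 16⌋₊ with hk
    have hk1 : (k : ℝ) ≤ y / 16 := Nat.floor_le (by positivity)
    have hk2 : y / 16 < k + 1 := Nat.lt_floor_add_one _
    have hkpos : 0 < k := Nat.floor_pos.2 (by linarith)
    have hk1' : (1 : ℝ) ≤ k := by exact_mod_cast hkpos
    have hp : 65536 * k ^ 4 ≤ p := by
      have : 65536 * (k : ℝ) ^ 4 ≤ (p : ℝ) := by
        calc 65536 * (k : ℝ) ^ 4 ≤ 65536 * (y / 16) ^ 4 := by gcongr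
          _ = (p : ℝ) := by rw [← hy4]; ring
      exact_mod_cast this
    have h := card_level_tracePoly_mul_le p hcard hm hkpos hp hS0 hS1 hSc
    have h' : (S.card : ℝ) * k ^ 2 ≤ 6 * k * y ^ 4 + k ^ 2 := by rw [hy4]; exact_mod_cast h
    have h2 : (S.card : ℝ) * k ≤ 6 * y ^ 4 + k := by
      refine le_of_mul_le_mul_right ?_ (show (0 : ℝ) < k by linarith)
      linarith
    have h3 : y ≤ 32 * k := by linarith
    refine le_of_mul_le_mul_right (h2.trans ?_) (show (0 : ℝ) < k by linarith)
    have h4 : y ^ 3 * y ≤ y ^ 3 * (32 * k) := by gcongr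
    have h5 : (1 : ℝ) * k ≤ y ^ 3 * k := by gcongr; exact one_le_pow₀ hy1
    nlinarith

end TraceLevelSets

section FrobeniusTrace

variable (p : ℕ) [Fact p.Prime]

theorem frobTrace_cast {m : ℕ} (hm : 2 * m + 1 = p) (A B : ZMod p) :
    ((frobTrace p A B : ℤ) : ZMod p) = -∑ y : ZMod p, (y ^ 3 + A * y + B) ^ m := by
  have hpp : p.Prime := Fact.out
  have hchar : ringChar (ZMod p) ≠ 2 := by
    rw [ZMod.ringChar_zmod_n]; omega
  have h1 : (Nat.card {P : ZMod p × ZMod p // P.2 ^ 2 = P.1 ^ 3 + A * P.1 + B}) =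
      ∑ y : ZMod p, Nat.card {z : ZMod p // z ^ 2 = y ^ 3 + A * y + B} := by
    rw [← Nat.card_sigma]
    exact Nat.card_congr
      { toFun := fun P => ⟨P.1.1, P.1.2, P.2⟩
        invFun := fun P => ⟨(P.1, P.2.1), P.2.2⟩
        left_inv := fun P => rfl
        right_inv := fun P => rfl }
  have h2 : ∀ c : ZMod p, ((Nat.card {z : ZMod p // z ^ 2 = c} : ℕ) : ZMod p) = c ^ m + 1 := by
    intro c
    have h3 := quadraticChar_card_sqrts hchar c
    have h4 : Nat.card {z : ZMod p // z ^ 2 = c} = {x : ZMod p | x ^ 2 = c}.toFinset.card := by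
      rw [Set.toFinset_card, Nat.card_eq_fintype_card]; rfl
    rw [h4]
    have h5 := congrArg (fun n : ℤ => (n : ZMod p)) h3
    simp only [Int.cast_natCast, Int.cast_add, Int.cast_one,
      quadraticChar_eq_pow_of_char_ne_two' hchar] at h5
    rw [h5, ZMod.card, show p / 2 = m by omega]
  rw [frobTrace, numPoints, h1]
  push_cast
  simp only [h2, Finset.sum_add_distrib]
  simp

theorem eval_tracePoly_of_frobTrace {m : ℕ} (hm : 2 * m + 1 = p) (hp : 3 < p) {A B : ZMod p}
    (hA : A ≠ 0) (hB : B ≠ 0) :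
    (tracePoly (ZMod p) m).eval (1 + 4 * A ^ 3 / (27 * B ^ 2)) = (frobTrace p A B : ℤ) ∨
    (tracePoly (ZMod p) m).eval (1 + 4 * A ^ 3 / (27 * B ^ 2)) = -(frobTrace p A B : ℤ) := by
  have hpp : p.Prime := Fact.out
  have hne : ∀ n : ℕ, 0 < n → n < p → (n : ZMod p) ≠ 0 := fun n h0 hn h => by
    rw [ZMod.natCast_eq_zero_iff] at h
    exact absurd (Nat.le_of_dvd h0 h) (by omega)
  have h2 : (2 : ZMod p) ≠ 0 := by exact_mod_cast hne 2 (by omega) (by omega)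
  have h3 : (3 : ZMod p) ≠ 0 := by exact_mod_cast hne 3 (by omega) (by omega)
  have h27 : (27 : ZMod p) ≠ 0 := by
    have : (27 : ZMod p) = 3 ^ 3 := by norm_num
    rw [this]; exact pow_ne_zero _ h3
  set d : ZMod p := 2 * A / (3 * B) with hd
  have hd0 : d ≠ 0 := div_ne_zero (mul_ne_zero h2 hA) (mul_ne_zero h3 hB)
  have hx : 4 * A ^ 3 / (27 * B ^ 2) * 3 = A * d ^ 2 := by rw [hd]; field_simp; ring
  have hx2 : 4 * A ^ 3 / (27 * B ^ 2) * 2 = B * d ^ 3 := by rw [hd]; field_simp; ring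
  have key : (tracePoly (ZMod p) m).eval (1 + 4 * A ^ 3 / (27 * B ^ 2)) =
      (d ^ m) ^ 3 * ∑ y : ZMod p, (y ^ 3 + A * y + B) ^ m := by
    rw [eval_tracePoly, Finset.mul_sum]
    symm
    refine Fintype.sum_equiv (Equiv.mulRight₀ d hd0) _ _ fun y => ?_
    change _ = ((y * d) ^ 3 + (1 + 4 * A ^ 3 / (27 * B ^ 2) - 1) * (3 * (y * d) + 2)) ^ m
    rw [← pow_mul, mul_comm m 3, pow_mul, ← mul_pow]
    congr 1
    linear_combination -(y * d) * hx - hx2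
  have hsq : (d ^ m) * (d ^ m) = 1 := by
    rw [← pow_add, ← two_mul, show 2 * m = p - 1 by omega]
    exact ZMod.pow_card_sub_one_eq_one hd0
  have hF := frobTrace_cast p hm A B
  rw [key]
  rcases mul_self_eq_one_iff.1 hsq with h | h
  · right; rw [h, hF]; ring
  · left; rw [h, hF]; ring

end FrobeniusTrace

section GoodReduction

theorem exists_minor_ne_zero {f g : ℤ[X]} (hfg : Nondeg f g) : ∃ i j : ℕ,
    (4 * f ^ 3).coeff i * (g ^ 2).coeff j - (4 * f ^ 3).coeff j * (g ^ 2).coeff i ≠ 0 := by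
  by_contra! hall
  obtain ⟨hΔ, hj⟩ := hfg
  set φ := Int.castRingHom ℚ
  have hg : g ≠ 0 := by
    rintro rfl
    refine hj ⟨1728, ?_⟩
    simp only [Dpoly, Polynomial.map_mul, Polynomial.map_add, Polynomial.map_pow, Polynomial.map_neg,
      Polynomial.map_ofNat, Polynomial.map_zero]
    rw [show (C 1728 : ℚ[X]) = 1728 from rfl]
    ring
  obtain ⟨j, hj0⟩ : ∃ j, (g ^ 2).coeff j ≠ 0 := by
    by_contra! h
    exact hg (pow_eq_zero_iff (two_ne_zero) |>.1 (Polynomial.ext h))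
  have hj0' : ((g ^ 2).coeff j : ℚ) ≠ 0 := by exact_mod_cast hj0
  set κ : ℚ := ((4 * f ^ 3).coeff j : ℚ) / (g ^ 2).coeff j with hκ
  have hF : (4 * f ^ 3).map φ = C κ * (g ^ 2).map φ := by
    ext i
    rw [coeff_C_mul, coeff_map, coeff_map]
    change (((4 * f ^ 3).coeff i : ℤ) : ℚ) = κ * (((g ^ 2).coeff i : ℤ) : ℚ)
    rw [hκ, div_mul_eq_mul_div, eq_div_iff hj0']
    have := hall i j
    rw [sub_eq_zero] at this
    exact_mod_cast this
  have hD : (Dpoly f g).map φ = C (-16 * (κ + 27)) * (g ^ 2).map φ := by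
    have : Dpoly f g = -16 * (4 * f ^ 3) - 16 * 27 * g ^ 2 := by rw [Dpoly]; ring
    rw [this, Polynomial.map_sub, Polynomial.map_mul, hF, Polynomial.map_mul]
    simp only [Polynomial.map_mul, Polynomial.map_neg, Polynomial.map_ofNat, map_mul, map_add,
      map_neg, show (C 16 : ℚ[X]) = 16 from rfl, show (C 27 : ℚ[X]) = 27 from rfl]
    ring
  have hκ27 : κ + 27 ≠ 0 := by
    intro h
    rw [h, mul_zero, map_zero, zero_mul, Polynomial.map_eq_zero_iff Int.cast_injective] at hD
    exact hΔ hD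
  refine hj ⟨1728 * κ / (κ + 27), ?_⟩
  rw [hD, ← mul_assoc, ← map_mul]
  have h1 : 1728 * κ / (κ + 27) * (-16 * (κ + 27)) = -27648 * κ := by field_simp; ring
  rw [h1]
  rw [Polynomial.map_mul, Polynomial.map_pow, Polynomial.map_ofNat] at hF
  rw [map_mul, mul_assoc, ← hF, map_neg, show (C 27648 : ℚ[X]) = 27648 from rfl]
  ring

end GoodReduction

section LevelSetReduction

variable (p : ℕ) [Fact p.Prime]

/-- The residue classes modulo `p` at which the family has good reduction and the
prescribed Frobenius trace. -/
def traceFiber (f g : ℤ[X]) (p : ℕ) [Fact p.Prime] (a : ℤ) : Finset (ZMod p) :=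
  Finset.univ.filter fun t =>
    ((Dpoly f g).map (Int.castRingHom (ZMod p))).eval t ≠ 0 ∧
      frobTrace p ((f.map (Int.castRingHom (ZMod p))).eval t)
        ((g.map (Int.castRingHom (ZMod p))).eval t) = a

theorem card_le_of_eval_eq_zero {K : Type*} [Field K] {P : K[X]} (hP : P ≠ 0) {d : ℕ}
    (hd : P.natDegree ≤ d) {S : Finset K} (hS : ∀ t ∈ S, P.eval t = 0) : S.card ≤ d := by
  calc _ ≤ P.roots.toFinset.card := Finset.card_le_card fun t ht => by
        rw [Multiset.mem_toFinset, mem_roots hP]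
        exact hS t ht
    _ ≤ _ := (Multiset.toFinset_card_le _).trans ((card_roots' P).trans hd)

theorem card_traceFiber_le_of_minor {f g : ℤ[X]} {m : ℕ} (hm : 2 * m + 1 = p) (hp : 3 < p)
    {i j : ℕ} (hij : (((4 * f ^ 3).coeff i * (g ^ 2).coeff j -
      (4 * f ^ 3).coeff j * (g ^ 2).coeff i : ℤ) : ZMod p) ≠ 0) (a : ℤ) :
    ((traceFiber f g p a).card : ℝ) ≤ f.natDegree + g.natDegree +
      (3 * f.natDegree + 2 * g.natDegree) * (386 * (p : ℝ) ^ (3 / 4 : ℝ)) := by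
  have hpp : p.Prime := Fact.out
  have h3 : (3 : ZMod p) ≠ 0 := fun h => by
    have : ((3 : ℕ) : ZMod p) = 0 := by exact_mod_cast h
    rw [ZMod.natCast_eq_zero_iff] at this
    exact absurd (Nat.le_of_dvd (by omega) this) (by omega)
  have h2 : (2 : ZMod p) ≠ 0 := fun h => by
    have : ((2 : ℕ) : ZMod p) = 0 := by exact_mod_cast h
    rw [ZMod.natCast_eq_zero_iff] at this
    exact absurd (Nat.le_of_dvd (by omega) this) (by omega)
  have h4 : (4 : ZMod p) ≠ 0 := by
    have : (4 : ZMod p) = 2 ^ 2 := by norm_num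
    rw [this]; exact pow_ne_zero _ h2
  have h27 : (27 : ZMod p) ≠ 0 := by
    have : (27 : ZMod p) = 3 ^ 3 := by norm_num
    rw [this]; exact pow_ne_zero _ h3
  set φ := Int.castRingHom (ZMod p) with hφ
  set F := f.map φ with hF
  set G := g.map φ with hG
  have hcF : ∀ n, (((4 * f ^ 3).coeff n : ℤ) : ZMod p) = (4 * F ^ 3).coeff n := fun n => by
    rw [hF, ← Polynomial.map_pow, ← Polynomial.map_ofNat φ, ← Polynomial.map_mul, coeff_map]; rfl
  have hcG : ∀ n, (((g ^ 2).coeff n : ℤ) : ZMod p) = (G ^ 2).coeff n := fun n => by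
    rw [hG, ← Polynomial.map_pow, coeff_map]; rfl
  rw [Int.cast_sub, Int.cast_mul, Int.cast_mul, hcF, hcF, hcG, hcG] at hij
  have hF0 : F ≠ 0 := fun h => hij (by rw [h]; simp)
  have hG0 : G ≠ 0 := fun h => hij (by rw [h]; simp)
  have hFG : ∀ κ : ZMod p, 4 * F ^ 3 - C κ * G ^ 2 ≠ 0 := fun κ h => hij (by
    rw [sub_eq_zero.1 h, coeff_C_mul, coeff_C_mul]; ring)
  have hdF : F.natDegree ≤ f.natDegree := natDegree_map_le
  have hdG : G.natDegree ≤ g.natDegree := natDegree_map_le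
  have hdFG : ∀ κ : ZMod p, (4 * F ^ 3 - C κ * G ^ 2).natDegree ≤
      3 * f.natDegree + 2 * g.natDegree := fun κ => by
    refine (natDegree_sub_le _ _).trans (max_le ?_ ?_)
    · have : (4 * F ^ 3 : (ZMod p)[X]) = C 4 * F ^ 3 := rfl
      rw [this]
      refine (natDegree_C_mul_le _ _).trans (natDegree_pow_le.trans ?_)
      omega
    · refine (natDegree_C_mul_le _ _).trans (natDegree_pow_le.trans ?_)
      omega
  set L : ZMod p → Finset (ZMod p) := fun c =>
    Finset.univ.filter fun s => s ≠ 0 ∧ s ≠ 1 ∧ (tracePoly (ZMod p) m).eval s = c with hL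
  have hLc : ∀ c, ((L c).card : ℝ) ≤ 193 * (p : ℝ) ^ (3 / 4 : ℝ) := fun c =>
    card_level_tracePoly_le p (ZMod.card p) hm (c := c)
      (fun s hs => (Finset.mem_filter.1 hs).2.1) (fun s hs => (Finset.mem_filter.1 hs).2.2.1)
      (fun s hs => (Finset.mem_filter.1 hs).2.2.2)
  set R : ZMod p → Finset (ZMod p) := fun s =>
    Finset.univ.filter fun t => (4 * F ^ 3 - C (27 * (s - 1)) * G ^ 2).eval t = 0 with hR
  have hRc : ∀ s, (R s).card ≤ 3 * f.natDegree + 2 * g.natDegree := fun s =>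
    card_le_of_eval_eq_zero (hFG _) (hdFG _) fun t ht => (Finset.mem_filter.1 ht).2
  have hsub : traceFiber f g p a ⊆ (Finset.univ.filter fun t => F.eval t = 0) ∪
      (Finset.univ.filter fun t => G.eval t = 0) ∪ (L (a : ZMod p) ∪ L (-(a : ZMod p))).biUnion R := by
    intro t ht
    obtain ⟨-, hΔ, hfr⟩ := Finset.mem_filter.1 ht
    by_cases hA : F.eval t = 0
    · exact Finset.mem_union_left _ (Finset.mem_union_left _ (by simpa using hA))
    by_cases hB : G.eval t = 0
    · exact Finset.mem_union_left _ (Finset.mem_union_right _ (by simpa using hB))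
    refine Finset.mem_union_right _ ?_
    have hcase := eval_tracePoly_of_frobTrace p hm hp hA hB
    rw [hfr] at hcase
    set s := 1 + 4 * F.eval t ^ 3 / (27 * G.eval t ^ 2) with hs
    have hs1 : s ≠ 1 := by
      rw [hs, Ne, add_eq_left]
      exact div_ne_zero (mul_ne_zero h4 (pow_ne_zero _ hA)) (mul_ne_zero h27 (pow_ne_zero _ hB))
    have hsB : s * (27 * G.eval t ^ 2) = 27 * G.eval t ^ 2 + 4 * F.eval t ^ 3 := by
      rw [hs]; field_simp
    have hs0 : s ≠ 0 := by
      intro h0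
      rw [h0, zero_mul] at hsB
      apply hΔ
      rw [Dpoly]
      simp only [Polynomial.map_mul, Polynomial.map_add, Polynomial.map_pow, Polynomial.map_neg,
        Polynomial.map_ofNat, eval_mul, eval_add, eval_pow, eval_neg, eval_ofNat]
      linear_combination 16 * hsB
    refine Finset.mem_biUnion.2 ⟨s, ?_, ?_⟩
    · rw [Finset.mem_union]
      rcases hcase with h | h
      · left; exact Finset.mem_filter.2 ⟨Finset.mem_univ _, hs0, hs1, h⟩
      · right; exact Finset.mem_filter.2 ⟨Finset.mem_univ _, hs0, hs1, h⟩
    · refine Finset.mem_filter.2 ⟨Finset.mem_univ _, ?_⟩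
      simp only [eval_sub, eval_mul, eval_pow, eval_C, eval_ofNat]
      linear_combination -hsB
  have h1 : (traceFiber f g p a).card ≤ f.natDegree + g.natDegree +
      ((L (a : ZMod p)).card + (L (-(a : ZMod p))).card) * (3 * f.natDegree + 2 * g.natDegree) := by
    refine (Finset.card_le_card hsub).trans ((Finset.card_union_le _ _).trans
      (add_le_add ((Finset.card_union_le _ _).trans (add_le_add ?_ ?_)) ?_))
    · exact card_le_of_eval_eq_zero hF0 hdF fun t ht => (Finset.mem_filter.1 ht).2
    · exact card_le_of_eval_eq_zero hG0 hdG fun t ht => (Finset.mem_filter.1 ht).2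
    · refine (Finset.card_biUnion_le_card_mul _ _ _ fun s _ => hRc s).trans ?_
      exact Nat.mul_le_mul_right _ (Finset.card_union_le _ _)
  have h1' : ((traceFiber f g p a).card : ℝ) ≤ f.natDegree + g.natDegree +
      ((L (a : ZMod p)).card + (L (-(a : ZMod p))).card) * (3 * f.natDegree + 2 * g.natDegree) := by
    exact_mod_cast h1
  refine h1'.trans ?_
  have := hLc a
  have := hLc (-a)
  have h5 : (0 : ℝ) ≤ 3 * f.natDegree + 2 * g.natDegree := by positivity
  rw [mul_comm (((L (a : ZMod p)).card : ℝ) + _)]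
  gcongr
  linarith

theorem exists_card_traceFiber_le {f g : ℤ[X]} (hfg : Nondeg f g) :
    ∃ C : ℝ, 0 < C ∧ ∀ (p : ℕ) [Fact p.Prime] (a : ℤ),
      ((traceFiber f g p a).card : ℝ) ≤ C * (p : ℝ) ^ (3 / 4 : ℝ) := by
  obtain ⟨i, j, hij⟩ := exists_minor_ne_zero hfg
  set M := (4 * f ^ 3).coeff i * (g ^ 2).coeff j - (4 * f ^ 3).coeff j * (g ^ 2).coeff i with hM
  refine ⟨(f.natDegree + g.natDegree + (3 * f.natDegree + 2 * g.natDegree) * 386) +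
    (M.natAbs + 4), by positivity, fun p hp a => ?_⟩
  have hpp : p.Prime := Fact.out
  have hp1 : (1 : ℝ) ≤ p := by exact_mod_cast hpp.one_le
  set Y : ℝ := (p : ℝ) ^ (3 / 4 : ℝ) with hY
  have hY1 : 1 ≤ Y := Real.one_le_rpow hp1 (by norm_num)
  have hY2 : (p : ℝ) = Y * (p : ℝ) ^ (1 / 4 : ℝ) := by
    rw [hY, ← Real.rpow_add (by linarith)]; norm_num
  have hY3 : (p : ℝ) ^ (1 / 4 : ℝ) ≤ p := by
    conv_rhs => rw [← Real.rpow_one (p : ℝ)]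
    exact Real.rpow_le_rpow_of_exponent_le hp1 (by norm_num)
  have hD : (0 : ℝ) ≤ f.natDegree + g.natDegree + (3 * f.natDegree + 2 * g.natDegree) * 386 := by
    positivity
  rcases le_or_gt p (M.natAbs + 4) with hle | hgt
  · have h1 : ((traceFiber f g p a).card : ℝ) ≤ p := by
      have := Finset.card_le_univ (traceFiber f g p a)
      rw [ZMod.card] at this
      exact_mod_cast this
    have h2 : (p : ℝ) ≤ (M.natAbs + 4) * Y := by
      rw [hY2, mul_comm]
      gcongr
      exact hY3.trans (by exact_mod_cast hle)
    exact h1.trans (h2.trans (mul_le_mul_of_nonneg_right (by linarith) (by positivity)))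
  · have hodd : p % 2 = 1 := (hpp.eq_two_or_odd).resolve_left (by omega)
    have h := card_traceFiber_le_of_minor p (f := f) (g := g) (m := p / 2) (by omega) (by omega)
      (i := i) (j := j) (by
        rw [← hM, Ne, ZMod.intCast_zmod_eq_zero_iff_dvd]
        intro hd
        have := Nat.le_of_dvd (Int.natAbs_pos.2 hij) (Int.natCast_dvd.1 hd)
        omega) a
    refine h.trans ?_
    have e1 : ((f.natDegree : ℝ) + g.natDegree) * 1 ≤ (f.natDegree + g.natDegree) * Y := by gcongr
    have e2 : (0 : ℝ) ≤ (M.natAbs + 4) * Y := by positivity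
    rw [← hY]
    linarith

end LevelSetReduction

section AdditiveEnergy

variable {p : ℕ} [Fact p.Prime] {ι : Type*}

/-- The exponential sum over `W` of the frequencies `m * φ w`. -/
def expSum (W : Finset ι) (φ : ι → ZMod p) (m : ZMod p) : ℂ :=
  ∑ w ∈ W, ZMod.stdAddChar (m * φ w)

theorem sum_stdAddChar_mul (b : ZMod p) :
    ∑ m : ZMod p, ZMod.stdAddChar (m * b) = if b = 0 then (p : ℂ) else 0 := by
  have h := AddChar.sum_mulShift b (ZMod.isPrimitive_stdAddChar p)
  rw [h, ZMod.card]
  split_ifs <;> simp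

theorem sum_norm_expSum_sq (W : Finset ι) (φ : ι → ZMod p) :
    ∑ m, ‖expSum W φ m‖ ^ 2 = p * ((W ×ˢ W).filter fun w => φ w.1 = φ w.2).card := by
  have h : ∑ m, ((‖expSum W φ m‖ ^ 2 : ℝ) : ℂ) =
      (p : ℂ) * ((W ×ˢ W).filter fun w => φ w.1 = φ w.2).card := by
    have h1 : ∀ m, ((‖expSum W φ m‖ ^ 2 : ℝ) : ℂ) =
        ∑ w ∈ W ×ˢ W, ZMod.stdAddChar (m * (φ w.1 - φ w.2)) := fun m => by
      rw [Complex.ofReal_pow, ← Complex.mul_conj', expSum, map_sum, Finset.sum_mul_sum,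
        ← Finset.sum_product']
      refine Finset.sum_congr rfl fun w _ => ?_
      rw [← AddChar.map_neg_eq_conj, ← AddChar.map_add_eq_mul]
      congr 1; ring
    simp only [h1]
    rw [Finset.sum_comm]
    simp only [sum_stdAddChar_mul, sub_eq_zero]
    rw [← Finset.sum_filter, Finset.sum_const, nsmul_eq_mul, mul_comm]
  exact_mod_cast h

theorem norm_expSum_le (W : Finset ι) (φ : ι → ZMod p) (m : ZMod p) : ‖expSum W φ m‖ ≤ W.card := by
  refine (norm_sum_le _ _).trans ?_
  simp [AddChar.norm_apply]

theorem card_filter_add_mem_eq (W : Finset ι) (φ : ι → ZMod p) (S : Finset (ZMod p)) :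
    (p : ℂ) * ((W ×ˢ W).filter fun w => φ w.1 + φ w.2 ∈ S).card =
      ∑ m, expSum W φ m * expSum W φ m * expSum S (fun t => -t) m := by
  have h1 : ∀ m, expSum W φ m * expSum W φ m * expSum S (fun t => -t) m =
      ∑ w ∈ W ×ˢ W, ∑ t ∈ S, ZMod.stdAddChar (m * (φ w.1 + φ w.2 - t)) := fun m => by
    simp only [expSum]
    rw [Finset.sum_mul_sum, ← Finset.sum_product', Finset.sum_mul_sum]
    refine Finset.sum_congr rfl fun w _ => Finset.sum_congr rfl fun t _ => ?_
    rw [← AddChar.map_add_eq_mul, ← AddChar.map_add_eq_mul]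
    congr 1; ring
  simp only [h1]
  rw [Finset.sum_comm, Finset.card_filter, Nat.cast_sum, Finset.mul_sum]
  refine Finset.sum_congr rfl fun w _ => ?_
  rw [Finset.sum_comm]
  simp only [sum_stdAddChar_mul, sub_eq_zero, Finset.sum_ite_eq]
  split_ifs <;> simp

theorem card_filter_add_mem_le (W : Finset ι) (φ : ι → ZMod p) (S : Finset (ZMod p)) {B : ℝ}
    (hB : ∀ m, m ≠ 0 → ‖expSum W φ m‖ ≤ B) :
    (((W ×ˢ W).filter fun w => φ w.1 + φ w.2 ∈ S).card : ℝ) ≤ (W.card : ℝ) ^ 2 * S.card / p +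
      B * √(((W ×ˢ W).filter fun w => φ w.1 = φ w.2).card * S.card) := by
  have hp : (0 : ℝ) < p := by exact_mod_cast (Fact.out : p.Prime).pos
  have hB0 : 0 ≤ B := (norm_nonneg _).trans (hB 1 one_ne_zero)
  set Q := ((W ×ˢ W).filter fun w => φ w.1 = φ w.2).card with hQ
  have h1 := congrArg norm (card_filter_add_mem_eq W φ S)
  rw [norm_mul, Complex.norm_natCast, Complex.norm_natCast] at h1
  have h2 : ∀ m : ZMod p, ‖expSum W φ m * expSum W φ m * expSum S (fun t => -t) m‖ ≤
      (if m = 0 then (W.card : ℝ) ^ 2 * S.card else 0) +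
        B * (‖expSum W φ m‖ * ‖expSum S (fun t => -t) m‖) := fun m => by
    rw [norm_mul, norm_mul]
    have hS := norm_expSum_le S (fun t : ZMod p => -t) m
    have hW := norm_expSum_le W φ m
    split_ifs with hm
    · have : 0 ≤ B * (‖expSum W φ m‖ * ‖expSum S (fun t => -t) m‖) := by positivity
      have h3 : ‖expSum W φ m‖ * ‖expSum W φ m‖ * ‖expSum S (fun t => -t) m‖ ≤
        (W.card : ℝ) * W.card * S.card := by gcongr
      nlinarith
    · rw [zero_add, mul_assoc]
      gcongr
      exact hB m hm
  have h3 : ∑ m, ‖expSum W φ m‖ * ‖expSum S (fun t => -t) m‖ ≤ p * √(Q * S.card) := by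
    refine (Real.sum_mul_le_sqrt_mul_sqrt _ _ _).trans ?_
    rw [sum_norm_expSum_sq, sum_norm_expSum_sq, ← Real.sqrt_mul (by positivity)]
    have h4 : ((S ×ˢ S).filter fun w => -w.1 = -w.2).card = S.card := by
      rw [← Finset.diag_card S]
      congr 1
      ext w
      simp only [Finset.mem_filter, Finset.mem_product, Finset.mem_diag, neg_inj]
      constructor
      · rintro ⟨⟨h1, -⟩, h2⟩; exact ⟨h1, h2⟩
      · rintro ⟨h1, h2⟩; exact ⟨⟨h1, h2 ▸ h1⟩, h2⟩
    rw [h4, ← hQ, show (p * Q * (p * S.card) : ℝ) = p ^ 2 * (Q * S.card) by ring,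
      Real.sqrt_mul (by positivity), Real.sqrt_sq hp.le]
  have h5 : (p : ℝ) * ((W ×ˢ W).filter fun w => φ w.1 + φ w.2 ∈ S).card ≤
      (W.card : ℝ) ^ 2 * S.card + B * (p * √(Q * S.card)) := by
    rw [h1]
    refine (norm_sum_le _ _).trans ((Finset.sum_le_sum fun m _ => h2 m).trans ?_)
    rw [Finset.sum_add_distrib, Finset.sum_ite_eq' Finset.univ (0 : ZMod p),
      if_pos (Finset.mem_univ _), ← Finset.mul_sum]
    gcongr
  refine le_of_mul_le_mul_left (h5.trans (le_of_eq ?_)) hp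
  field_simp

end AdditiveEnergy

theorem exists_card_divisors_le {ε : ℝ} (hε : 0 < ε) :
    ∃ C : ℝ, 1 ≤ C ∧ ∀ n : ℕ, n ≠ 0 → (n.divisors.card : ℝ) ≤ C * (n : ℝ) ^ ε := by
  set K : ℝ := 1 + 1 / (ε * Real.log 2) with hK
  have hl : 0 < ε * Real.log 2 := mul_pos hε (Real.log_pos one_lt_two)
  have hK1 : 1 ≤ K := le_add_of_nonneg_right (by positivity)
  set P : ℕ := ⌈(2 : ℝ) ^ (1 / ε)⌉₊ with hP
  refine ⟨K ^ P, one_le_pow₀ hK1, fun n hn => ?_⟩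
  have hbig : ∀ q : ℕ, P ≤ q → ∀ e : ℕ, ((e + 1 : ℕ) : ℝ) ≤ ((q : ℝ) ^ ε) ^ e := by
    intro q hq e
    have h1 : (2 : ℝ) ≤ (q : ℝ) ^ ε := by
      have h2 : (2 : ℝ) ^ (1 / ε) ≤ q := (Nat.le_ceil _).trans (by exact_mod_cast hq)
      calc (2 : ℝ) = ((2 : ℝ) ^ (1 / ε)) ^ ε := by
            rw [← Real.rpow_mul zero_le_two, one_div_mul_cancel hε.ne', Real.rpow_one]
        _ ≤ _ := Real.rpow_le_rpow (by positivity) h2 hε.le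
    calc ((e + 1 : ℕ) : ℝ) ≤ (2 : ℝ) ^ e := by exact_mod_cast Nat.lt_two_pow_self
      _ ≤ _ := pow_le_pow_left₀ zero_le_two h1 e
  have hsmall : ∀ q : ℕ, 2 ≤ q → ∀ e : ℕ, ((e + 1 : ℕ) : ℝ) ≤ K * ((q : ℝ) ^ ε) ^ e := by
    intro q hq e
    have h1 : 1 + ε * Real.log 2 ≤ (q : ℝ) ^ ε := by
      calc 1 + ε * Real.log 2 ≤ Real.exp (ε * Real.log 2) := by
            linarith [Real.add_one_le_exp (ε * Real.log 2)]
        _ = (2 : ℝ) ^ ε := by rw [Real.rpow_def_of_pos two_pos, mul_comm]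
        _ ≤ _ := Real.rpow_le_rpow zero_le_two (by exact_mod_cast hq) hε.le
    have h2 : 1 + e * (ε * Real.log 2) ≤ ((q : ℝ) ^ ε) ^ e :=
      (one_add_mul_le_pow (by linarith) e).trans (pow_le_pow_left₀ (by positivity) h1 e)
    have h3 : ((e + 1 : ℕ) : ℝ) ≤ K * (1 + e * (ε * Real.log 2)) := by
      have : K * (1 + e * (ε * Real.log 2)) =
          1 + 1 / (ε * Real.log 2) + e * (ε * Real.log 2) + e := by
        rw [hK]; field_simp; ring
      rw [this]
      push_cast
      have : 0 ≤ 1 / (ε * Real.log 2) + e * (ε * Real.log 2) := by positivity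
      linarith
    exact h3.trans (mul_le_mul_of_nonneg_left h2 (by linarith))
  have hn' : (n : ℝ) ^ ε = ∏ q ∈ n.primeFactors, ((q : ℝ) ^ ε) ^ n.factorization q := by
    conv_lhs => rw [← Nat.prod_factorization_pow_eq_self hn]
    rw [Finsupp.prod, Nat.support_factorization, Nat.cast_prod,
      ← Real.finsetProd_rpow _ _ fun i _ => by positivity]
    refine Finset.prod_congr rfl fun q _ => ?_
    rw [Nat.cast_pow, ← Real.rpow_natCast, ← Real.rpow_natCast, ← Real.rpow_mul (by positivity),
      ← Real.rpow_mul (by positivity), mul_comm]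
  rw [Nat.card_divisors hn, Nat.cast_prod, hn']
  calc ∏ q ∈ n.primeFactors, ((n.factorization q + 1 : ℕ) : ℝ)
      ≤ ∏ q ∈ n.primeFactors, (if q < P then K else 1) * ((q : ℝ) ^ ε) ^ n.factorization q := by
        refine Finset.prod_le_prod (fun _ _ => by positivity) fun q hq => ?_
        split_ifs with h
        · exact hsmall q (Nat.prime_of_mem_primeFactors hq).two_le _
        · rw [one_mul]; exact hbig q (not_lt.1 h) _
    _ = (∏ q ∈ n.primeFactors, if q < P then K else 1) * _ := Finset.prod_mul_distrib
    _ ≤ K ^ P * _ := by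
        refine mul_le_mul_of_nonneg_right ?_ (by positivity)
        rw [← Finset.prod_filter, Finset.prod_const]
        refine pow_le_pow_right₀ hK1 ?_
        calc _ ≤ (Finset.range P).card := Finset.card_le_card fun q hq =>
              Finset.mem_range.2 (Finset.mem_filter.1 hq).2
          _ = P := Finset.card_range P

/-- Every nonzero natural number up to `N` has at most `D` divisors. -/
def DivisorBound (N D : ℕ) : Prop :=
  ∀ n, n ≠ 0 → n ≤ N → n.divisors.card ≤ D

theorem card_filter_intCast_eq_le {p : ℕ} [hp : Fact p.Prime] {A B : ℤ} (hAB : A ≤ B)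
    (c : ZMod p) :
    (((Ioc A B).filter fun n : ℤ => (n : ZMod p) = c).card : ℝ) ≤ (B - A) / p + 1 := by
  have hpp : (0 : ℤ) < p := by exact_mod_cast hp.out.pos
  have h := Int.Ioc_filter_modEq_card A B hpp (c.val : ℤ)
  have h2 : ((Ioc A B).filter fun n : ℤ => (n : ZMod p) = c) =
      (Ioc A B).filter fun n : ℤ => n ≡ c.val [ZMOD p] := by
    ext n
    simp only [Finset.mem_filter, ← ZMod.intCast_eq_intCast_iff, Int.cast_natCast,
      ZMod.natCast_zmod_val]
  have hp0 : (0 : ℚ) < p := by exact_mod_cast hp.out.pos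
  have h3 : ((((Ioc A B).filter fun n : ℤ => n ≡ c.val [ZMOD p]).card : ℤ) : ℚ) ≤
      (B - A) / p + 1 := by
    rw [h, Int.cast_max, Int.cast_zero, Int.cast_natCast, Int.cast_natCast]
    refine max_le ?_ ?_
    · rw [Int.cast_sub]
      have h5 := Int.floor_le (((B : ℚ) - c.val) / p)
      have h6 := Int.lt_floor_add_one (((A : ℚ) - c.val) / p)
      have h7 : ((B : ℚ) - A) / p = (B - c.val) / p - (A - c.val) / p := by ring
      linarith
    · have : (0 : ℚ) ≤ (B - A) / p :=
        div_nonneg (sub_nonneg.2 (by exact_mod_cast hAB)) hp0.le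
      linarith
  rw [h2]
  have h4 := (Rat.cast_le (K := ℝ)).2 h3
  push_cast at h4
  exact_mod_cast h4

/-- The residue `u / v` modulo `p` attached to a pair `(u, v)`. -/
def ratioMod (p : ℕ) [Fact p.Prime] (w : ℕ × ℕ) : ZMod p := (w.1 : ZMod p) * (w.2 : ZMod p)⁻¹

/-- The box `[1, τ]²`. -/
def pairBox (τ : ℕ) : Finset (ℕ × ℕ) := Icc 1 τ ×ˢ Icc 1 τ

theorem mem_pairBox {τ : ℕ} {w : ℕ × ℕ} :
    w ∈ pairBox τ ↔ (1 ≤ w.1 ∧ w.1 ≤ τ) ∧ 1 ≤ w.2 ∧ w.2 ≤ τ := by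
  simp [pairBox]

theorem card_pairBox (τ : ℕ) : (pairBox τ).card = τ ^ 2 := by
  simp [pairBox, sq]

theorem natCast_ne_zero_of_le {p τ v : ℕ} (hτ : τ < p) (h1 : 1 ≤ v) (h2 : v ≤ τ) :
    (v : ZMod p) ≠ 0 := by
  rw [Ne, ZMod.natCast_eq_zero_iff]
  exact Nat.not_dvd_of_pos_of_lt h1 (h2.trans_lt hτ)

theorem card_ratioMod_eq_le {p : ℕ} [hp : Fact p.Prime] {τ D : ℕ} (hτ : τ < p)
    (hD : DivisorBound (p ^ 2) D) :
    (((pairBox τ ×ˢ pairBox τ).filter fun w => ratioMod p w.1 = ratioMod p w.2).card : ℝ) ≤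
      D * (τ ^ 2 * (τ ^ 2 / p + 1)) := by
  set S := (pairBox τ ×ˢ pairBox τ).filter fun w => ratioMod p w.1 = ratioMod p w.2 with hS
  let F : (ℕ × ℕ) × (ℕ × ℕ) → Σ _ : ℕ × ℕ, ℤ := fun w =>
    ⟨(w.1.1, w.2.2), ((w.2.1 * w.1.2 : ℕ) : ℤ)⟩
  let R := (pairBox τ).sigma fun w =>
    (Ioc (0 : ℤ) (τ ^ 2)).filter fun n : ℤ => (n : ZMod p) = (w.1 * w.2 : ZMod p)
  have hmaps : ∀ w ∈ S, F w ∈ R := by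
    rintro ⟨⟨u, v⟩, ⟨u', v'⟩⟩ hw
    rw [hS, Finset.mem_filter, Finset.mem_product, mem_pairBox, mem_pairBox, ratioMod,
      ratioMod] at hw
    obtain ⟨⟨⟨⟨hu1, hu2⟩, hv1, hv2⟩, ⟨hu'1, hu'2⟩, hv'1, hv'2⟩, he⟩ := hw
    simp only [F, R, Finset.mem_sigma, mem_pairBox, Finset.mem_filter, Finset.mem_Ioc]
    refine ⟨⟨⟨hu1, hu2⟩, hv'1, hv'2⟩, ⟨?_, ?_⟩, ?_⟩
    · exact_mod_cast Nat.mul_pos hu'1 hv1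
    · rw [sq]; exact_mod_cast Nat.mul_le_mul hu'2 hv2
    · have h1 := natCast_ne_zero_of_le hτ hv1 hv2
      have h2 := natCast_ne_zero_of_le hτ hv'1 hv'2
      push_cast
      field_simp at he
      rw [he, mul_comm]
  have hfib : ∀ b ∈ R, (S.filter fun w => F w = b).card ≤ D := by
    rintro ⟨⟨u, v'⟩, n⟩ hb
    simp only [R, Finset.mem_sigma, Finset.mem_filter, Finset.mem_Ioc] at hb
    obtain ⟨-, ⟨hn0, hn1⟩, -⟩ := hb
    have hnD : n.natAbs.divisors.card ≤ D := by
      refine hD _ (by omega) ?_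
      have : (τ : ℤ) ^ 2 ≤ (p : ℤ) ^ 2 := by exact_mod_cast Nat.pow_le_pow_left hτ.le 2
      zify
      rw [abs_of_pos hn0]
      linarith
    refine le_trans (Finset.card_le_card_of_injOn (fun w => w.1.2) ?_ ?_) hnD
    · rintro ⟨⟨a, v⟩, ⟨u', b⟩⟩ hw
      simp only [F, Finset.coe_filter, Set.mem_ofPred_eq, Sigma.mk.injEq, heq_eq_eq] at hw
      obtain ⟨-, -, hw⟩ := hw
      simp only [Finset.mem_coe, Nat.mem_divisors]
      exact ⟨⟨u', by rw [← hw, Int.natAbs_natCast, mul_comm]⟩, by omega⟩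
    · rintro ⟨⟨a, v⟩, ⟨u', b⟩⟩ hw ⟨⟨a₁, v₁⟩, ⟨u₁', b₁⟩⟩ hw₁ (hvv : v = v₁)
      subst hvv
      simp only [F, hS, Finset.coe_filter, Finset.mem_filter, Finset.mem_product, mem_pairBox,
        Set.mem_ofPred_eq, Sigma.mk.injEq, heq_eq_eq, Prod.mk.injEq] at hw hw₁
      obtain ⟨⟨⟨⟨-, hv1, -⟩, -⟩, -⟩, ⟨ha, hb⟩, hn⟩ := hw
      obtain ⟨-, ⟨ha₁, hb₁⟩, hn₁⟩ := hw₁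
      have : u' = u₁' := by
        have h3 : u' * v = u₁' * v := by exact_mod_cast hn.trans hn₁.symm
        exact Nat.eq_of_mul_eq_mul_right hv1 h3
      simp [ha, hb, ha₁, hb₁, this]
  have hcard : (R.card : ℝ) ≤ τ ^ 2 * (τ ^ 2 / p + 1) := by
    rw [Finset.card_sigma, Nat.cast_sum]
    refine (Finset.sum_le_sum fun w _ => card_filter_intCast_eq_le (sq_nonneg _) _).trans ?_
    rw [Finset.sum_const, card_pairBox, nsmul_eq_mul]
    push_cast
    rw [sub_zero]
  calc (S.card : ℝ) ≤ (D * R.card : ℕ) := by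
        exact_mod_cast Finset.card_le_mul_card_image_of_maps_to hmaps D hfib
    _ ≤ _ := by
        push_cast
        exact mul_le_mul_of_nonneg_left hcard (by positivity)

theorem four_mul_abs_valMinAbs_le {p : ℕ} [hp : Fact p.Prime] (b : ZMod p) :
    4 * |(b.valMinAbs : ℝ)| ≤ p * ‖ZMod.stdAddChar b - 1‖ := by
  have hp0 : (0 : ℝ) < p := by exact_mod_cast hp.out.pos
  set h := b.valMinAbs with hh
  have hle : |(h : ℝ)| ≤ p / 2 := by
    have h1 := ZMod.natAbs_valMinAbs_le b
    have h2 : (h.natAbs : ℝ) ≤ ((p / 2 : ℕ) : ℝ) := by exact_mod_cast h1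
    rw [Nat.cast_natAbs, Int.cast_abs] at h2
    exact h2.trans Nat.cast_div_le
  have hz : ZMod.stdAddChar b =
      Complex.exp (Complex.I * ((2 * (Real.pi * h / p) : ℝ) : ℂ)) := by
    rw [← ZMod.coe_valMinAbs b, ← hh, ZMod.stdAddChar_coe]
    congr 1
    push_cast
    ring
  have habs : |Real.pi * h / p| = Real.pi * |(h : ℝ)| / p := by
    rw [abs_div, abs_mul, abs_of_pos Real.pi_pos, abs_of_pos hp0]
  have hsin : 2 / Real.pi * |Real.pi * h / p| ≤ |Real.sin (Real.pi * h / p)| := by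
    refine Real.mul_abs_le_abs_sin ?_
    rw [habs, div_le_iff₀ hp0]
    nlinarith [Real.pi_pos]
  rw [hz, Complex.norm_exp_I_mul_ofReal_sub_one, mul_div_cancel_left₀ _ (two_ne_zero' ℝ),
    norm_mul, Real.norm_eq_abs, Real.norm_eq_abs, abs_two]
  have h3 : 2 / Real.pi * |Real.pi * h / p| = 2 * |(h : ℝ)| / p := by
    rw [habs]
    field_simp
  rw [h3, div_le_iff₀ hp0] at hsin
  linarith

theorem norm_sum_stdAddChar_le {p : ℕ} [hp : Fact p.Prime] {b : ZMod p} (τ : ℕ) :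
    2 * |(b.valMinAbs : ℝ)| * ‖∑ u ∈ Icc 1 τ, ZMod.stdAddChar (b * (u : ZMod p))‖ ≤ p := by
  set z : ℂ := ZMod.stdAddChar b with hz
  have hnorm : ‖z‖ = 1 := by simp [hz, AddChar.norm_apply]
  have hsum : ∑ u ∈ Icc 1 τ, ZMod.stdAddChar (b * (u : ZMod p)) =
      (∑ i ∈ range τ, z ^ i) * z := by
    rw [Finset.sum_mul, ← Finset.Ico_add_one_right_eq_Icc, Finset.sum_Ico_eq_sum_range]
    refine Finset.sum_congr rfl fun i _ => ?_
    rw [← pow_succ, mul_comm b, ← nsmul_eq_mul, AddChar.map_nsmul_eq_pow, add_comm]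
  have hgeom : ‖∑ i ∈ range τ, z ^ i‖ * ‖z - 1‖ ≤ 2 := by
    rw [← norm_mul, geom_sum_mul]
    refine (norm_sub_le _ _).trans ?_
    rw [norm_pow, hnorm, one_pow, norm_one]
    norm_num
  have h4 := four_mul_abs_valMinAbs_le b
  rw [hsum, norm_mul, hnorm, mul_one]
  have h5 := mul_le_mul_of_nonneg_right h4 (norm_nonneg (∑ i ∈ range τ, z ^ i))
  have hp0 : (0 : ℝ) ≤ p := by positivity
  nlinarith [mul_le_mul_of_nonneg_left hgeom hp0]

theorem card_filter_abs_valMinAbs_le {p : ℕ} [hp : Fact p.Prime] {τ D H : ℕ} (hτ : τ < p)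
    (hD : DivisorBound (p ^ 2) D) (hH : τ * H ≤ p ^ 2) {m : ZMod p} (hm : m ≠ 0) :
    (((Icc 1 τ).filter fun v : ℕ =>
      |(m * (v : ZMod p)⁻¹).valMinAbs| ≤ (H : ℤ)).card : ℝ) ≤
      D * ((2 * (τ * H) + 1) / p + 1) := by
  set S := (Icc 1 τ).filter fun v : ℕ => |(m * (v : ZMod p)⁻¹).valMinAbs| ≤ (H : ℤ) with hS
  let F : ℕ → ℤ := fun v => v * (m * (v : ZMod p)⁻¹).valMinAbs
  set R := (Ioc (-(τ * H : ℤ) - 1) (τ * H)).filter fun n : ℤ => (n : ZMod p) = m with hR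
  have hmaps : ∀ v ∈ S, F v ∈ R := by
    intro v hv
    rw [hS, Finset.mem_filter, Finset.mem_Icc] at hv
    obtain ⟨⟨hv1, hv2⟩, hv3⟩ := hv
    have hv0 := natCast_ne_zero_of_le hτ hv1 hv2
    have habs : |F v| ≤ τ * H := by
      simp only [F]
      rw [abs_mul, Nat.abs_cast]
      exact mul_le_mul (by exact_mod_cast hv2) hv3 (abs_nonneg _) (by positivity)
    rw [abs_le] at habs
    rw [hR, Finset.mem_filter, Finset.mem_Ioc]
    refine ⟨⟨by linarith, habs.2⟩, ?_⟩
    simp only [F]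
    push_cast
    field_simp
  have hfib : ∀ n ∈ R, (S.filter fun v => F v = n).card ≤ D := by
    intro n hn
    rw [hR, Finset.mem_filter, Finset.mem_Ioc] at hn
    obtain ⟨⟨hn0, hn1⟩, hnm⟩ := hn
    have hnz : n ≠ 0 := by
      rintro rfl
      exact hm (by rw [← hnm, Int.cast_zero])
    have hnD : n.natAbs.divisors.card ≤ D := by
      refine hD _ (by omega) (le_trans ?_ hH)
      zify
      exact abs_le.2 ⟨by omega, hn1⟩
    refine le_trans (Finset.card_le_card fun v hv => ?_) hnD
    obtain ⟨-, hv⟩ := Finset.mem_filter.1 hv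
    rw [Nat.mem_divisors]
    exact ⟨Int.natCast_dvd.1 ⟨_, hv.symm⟩, by omega⟩
  have hcard : (R.card : ℝ) ≤ (2 * (τ * H) + 1) / p + 1 := by
    have h0 : (0 : ℤ) ≤ τ * H := by positivity
    refine (card_filter_intCast_eq_le (by linarith) m).trans (le_of_eq ?_)
    push_cast
    ring
  calc (S.card : ℝ) ≤ (D * R.card : ℕ) := by
        exact_mod_cast Finset.card_le_mul_card_image_of_maps_to hmaps D hfib
    _ ≤ _ := by
        push_cast
        exact mul_le_mul_of_nonneg_left hcard (by positivity)

theorem norm_expSum_ratioMod_le {p : ℕ} [hp : Fact p.Prime] {τ D : ℕ} (hτ1 : 1 ≤ τ)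
    (hτ : τ < p) (hD : DivisorBound (p ^ 2) D) {m : ZMod p} (hm : m ≠ 0) :
    ‖expSum (pairBox τ) (ratioMod p) m‖ ≤ 5 * D * (τ * √τ) := by
  have hp0 : (0 : ℝ) < p := by exact_mod_cast hp.out.pos
  have hp1 : (1 : ℝ) ≤ p := by exact_mod_cast hp.out.one_le
  have hτ0 : (0 : ℝ) < τ := by exact_mod_cast hτ1
  have hτp : (τ : ℝ) < p := by exact_mod_cast hτ
  have hs0 : 0 < √(τ : ℝ) := Real.sqrt_pos.2 hτ0
  have hs1 : 1 ≤ √(τ : ℝ) := Real.one_le_sqrt.2 (by exact_mod_cast hτ1)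
  have hss : √(τ : ℝ) * √(τ : ℝ) = τ := Real.mul_self_sqrt hτ0.le
  have hsp : √(τ : ℝ) ≤ p := by nlinarith
  have hD1 : (1 : ℝ) ≤ D := by
    have h := hD 1 one_ne_zero (Nat.one_le_pow _ _ hp.out.pos)
    rw [Nat.divisors_one, Finset.card_singleton] at h
    exact_mod_cast h
  set H : ℕ := ⌊(p : ℝ) / √(τ : ℝ)⌋₊ with hH
  have hH1 : (H : ℝ) ≤ p / √(τ : ℝ) := Nat.floor_le (by positivity)
  have hH2 : (p : ℝ) / √(τ : ℝ) < H + 1 := Nat.lt_floor_add_one _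
  have hτH : (τ : ℝ) * H ≤ √(τ : ℝ) * p := by
    calc (τ : ℝ) * H ≤ τ * (p / √(τ : ℝ)) := mul_le_mul_of_nonneg_left hH1 hτ0.le
      _ = (√(τ : ℝ) * √(τ : ℝ)) * (p / √(τ : ℝ)) := by rw [hss]
      _ = _ := by field_simp
  have hτH' : τ * H ≤ p ^ 2 := by
    have : (τ : ℝ) * H ≤ (p : ℝ) ^ 2 := by nlinarith
    exact_mod_cast this
  let P : ℕ → Prop := fun v => |(m * (v : ZMod p)⁻¹).valMinAbs| ≤ (H : ℤ)
  have hbad : (((Icc 1 τ).filter P).card : ℝ) ≤ D * (4 * √(τ : ℝ)) := by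
    refine (card_filter_abs_valMinAbs_le hτ hD hτH' hm).trans
      (mul_le_mul_of_nonneg_left ?_ (by positivity))
    have : (2 * ((τ : ℝ) * H) + 1) / p ≤ 3 * √(τ : ℝ) := by
      rw [div_le_iff₀ hp0]
      nlinarith
    linarith
  let I : ℕ → ℝ := fun v =>
    ‖∑ u ∈ Icc 1 τ, ZMod.stdAddChar (m * (v : ZMod p)⁻¹ * (u : ZMod p))‖
  have htriv : ∀ v, I v ≤ τ := fun v => by
    refine (norm_sum_le _ _).trans (le_of_eq ?_)
    simp [AddChar.norm_apply]
  have hgood : ∀ v, ¬ P v → I v ≤ √(τ : ℝ) := fun v hv => by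
    have h1 := norm_sum_stdAddChar_le (b := m * (v : ZMod p)⁻¹) τ
    have h2 : (p : ℝ) / √(τ : ℝ) ≤ |((m * (v : ZMod p)⁻¹).valMinAbs : ℝ)| := by
      refine hH2.le.trans ?_
      have h3 : (H : ℤ) + 1 ≤ |(m * (v : ZMod p)⁻¹).valMinAbs| := not_le.1 hv
      exact_mod_cast h3
    rw [div_le_iff₀ hs0] at h2
    have hI : 0 ≤ I v := norm_nonneg _
    set A := |((m * (v : ZMod p)⁻¹).valMinAbs : ℝ)| with hA
    have hA0 : 0 < A := by
      by_contra hcon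
      nlinarith [abs_nonneg ((m * (v : ZMod p)⁻¹).valMinAbs : ℝ)]
    have h4 : A * (2 * I v) ≤ A * √(τ : ℝ) := by
      have : 2 * A * I v ≤ p := h1
      linarith
    linarith [le_of_mul_le_mul_left h4 hA0]
  have hexp : ‖expSum (pairBox τ) (ratioMod p) m‖ ≤ ∑ v ∈ Icc 1 τ, I v := by
    rw [expSum, pairBox, Finset.sum_product_right]
    refine (norm_sum_le _ _).trans (le_of_eq (Finset.sum_congr rfl fun v _ => ?_))
    simp only [I]
    congr 1
    refine Finset.sum_congr rfl fun u _ => ?_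
    rw [ratioMod]
    congr 1
    ring
  refine hexp.trans ?_
  rw [← Finset.sum_filter_add_sum_filter_not (Icc 1 τ) P]
  have h5 : ∑ v ∈ (Icc 1 τ).filter P, I v ≤ D * (4 * √(τ : ℝ)) * τ := by
    refine (Finset.sum_le_card_nsmul _ _ _ fun v _ => htriv v).trans ?_
    rw [nsmul_eq_mul]
    exact mul_le_mul_of_nonneg_right hbad hτ0.le
  have h6 : ∑ v ∈ (Icc 1 τ).filter fun v => ¬ P v, I v ≤ τ * √(τ : ℝ) := by
    refine (Finset.sum_le_card_nsmul _ _ _ fun v hv =>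
      hgood v (Finset.mem_filter.1 hv).2).trans ?_
    rw [nsmul_eq_mul]
    refine mul_le_mul_of_nonneg_right ?_ hs0.le
    exact_mod_cast (Finset.card_filter_le _ _).trans (by simp)
  nlinarith [mul_pos hτ0 hs0]

theorem num_den_mem_pairBox {T : ℝ} {r : ℚ} (hr : r ∈ FT T) :
    (r.num.toNat, r.den) ∈ pairBox ⌊T⌋₊ ∧ (r.num.toNat : ℤ) = r.num := by
  simp only [FT, Finset.mem_image, Finset.mem_filter, Finset.mem_product, Finset.mem_Icc] at hr
  obtain ⟨⟨u, v⟩, ⟨⟨⟨hu1, hu2⟩, hv1, hv2⟩, huv⟩, rfl⟩ := hr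
  simp only at *
  have hcop : u.natAbs.Coprime v.natAbs := huv
  have hnum := Rat.num_div_eq_of_coprime (by omega) hcop
  have hden := Rat.den_div_eq_of_coprime (by omega) hcop
  have hT : ((⌊T⌋₊ : ℕ) : ℤ) = ⌊T⌋ := by
    rw [← Int.floor_toNat, Int.toNat_of_nonneg (by omega)]
  rw [mem_pairBox]
  simp only
  rw [hnum]
  omega

theorem injOn_num_den_FT (T : ℝ) :
    Set.InjOn (fun r : ℚ => (r.num.toNat, r.den)) (FT T : Set ℚ) := by
  intro r hr s hs h
  have h1 := (num_den_mem_pairBox hr).2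
  have h2 := (num_den_mem_pairBox hs).2
  simp only [Prod.mk.injEq] at h
  exact Rat.ext (by rw [← h1, ← h2, h.1]) h.2

theorem card_FT_le (T : ℝ) : (FT T).card ≤ ⌊T⌋₊ ^ 2 := by
  rw [← card_pairBox]
  exact Finset.card_le_card_of_injOn _ (fun r hr => (num_den_mem_pairBox hr).1) (injOn_num_den_FT T)

theorem redQ_eq_cast {p : ℕ} [Fact p.Prime] (t : ℚ) : redQ p t = (t : ZMod p) := by
  rw [redQ, Rat.cast_def, div_eq_mul_inv]

theorem redQ_add {p : ℕ} [Fact p.Prime] {T : ℝ} (hT : T < p) (hT0 : 0 ≤ T) {r s : ℚ}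
    (hr : r ∈ FT T) (hs : s ∈ FT T) :
    redQ p (r + s) = ratioMod p (r.num.toNat, r.den) + ratioMod p (s.num.toNat, s.den) := by
  have hτ : ⌊T⌋₊ < p := by
    exact_mod_cast (Nat.floor_le hT0).trans_lt hT
  obtain ⟨hr1, hr2⟩ := num_den_mem_pairBox hr
  obtain ⟨hs1, hs2⟩ := num_den_mem_pairBox hs
  have hrd := natCast_ne_zero_of_le hτ (mem_pairBox.1 hr1).2.1 (mem_pairBox.1 hr1).2.2
  have hsd := natCast_ne_zero_of_le hτ (mem_pairBox.1 hs1).2.1 (mem_pairBox.1 hs1).2.2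
  rw [redQ_eq_cast, Rat.cast_add_of_ne_zero hrd hsd, Rat.cast_def, Rat.cast_def, ratioMod,
    ratioMod, ← hr2, ← hs2, div_eq_mul_inv, div_eq_mul_inv, Int.cast_natCast, Int.cast_natCast]
  rfl

/-- The pairs from `F(T)` whose sum gives a curve with good reduction at `p` and trace `c`. -/
def tracePairs (f g : ℤ[X]) (T : ℝ) (p : ℕ) (c : ℤ) : Finset (ℚ × ℚ) :=
  (FT T ×ˢ FT T).filter fun rs => goodRed f g p (rs.1 + rs.2) ∧ apE f g p (rs.1 + rs.2) = c

theorem card_tracePairs_le_pow (f g : ℤ[X]) {T : ℝ} (hT : 0 ≤ T) (p : ℕ) (c : ℤ) :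
    ((tracePairs f g T p c).card : ℝ) ≤ T ^ 4 := by
  have h1 : (tracePairs f g T p c).card ≤ ⌊T⌋₊ ^ 4 := by
    refine (Finset.card_filter_le _ _).trans ?_
    rw [Finset.card_product]
    calc _ ≤ ⌊T⌋₊ ^ 2 * ⌊T⌋₊ ^ 2 := Nat.mul_le_mul (card_FT_le T) (card_FT_le T)
      _ = _ := by ring
  calc ((tracePairs f g T p c).card : ℝ) ≤ (⌊T⌋₊ : ℝ) ^ 4 := by exact_mod_cast h1
    _ ≤ T ^ 4 := pow_le_pow_left₀ (by positivity) (Nat.floor_le hT) 4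

theorem card_tracePairs_le_card_filter (f g : ℤ[X]) {p : ℕ} [Fact p.Prime] {T : ℝ} (hT : T < p)
    (hT0 : 0 ≤ T) (c : ℤ) :
    (tracePairs f g T p c).card ≤
      ((pairBox ⌊T⌋₊ ×ˢ pairBox ⌊T⌋₊).filter fun w =>
        ratioMod p w.1 + ratioMod p w.2 ∈ traceFiber f g p c).card := by
  refine Finset.card_le_card_of_injOn
    (fun rs => ((rs.1.num.toNat, rs.1.den), (rs.2.num.toNat, rs.2.den))) ?_ ?_
  · rintro ⟨r, s⟩ h
    obtain ⟨h1, h2, h3⟩ := Finset.mem_filter.1 (Finset.mem_coe.1 h)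
    obtain ⟨hr, hs⟩ := Finset.mem_product.1 h1
    rw [Finset.mem_coe, Finset.mem_filter]
    refine ⟨Finset.mem_product.2 ⟨(num_den_mem_pairBox hr).1, (num_den_mem_pairBox hs).1⟩, ?_⟩
    simp only
    rw [← redQ_add hT hT0 hr hs, traceFiber, Finset.mem_filter]
    exact ⟨Finset.mem_univ _, h2.2, h3⟩
  · rintro ⟨r, s⟩ h ⟨r', s'⟩ h' he
    obtain ⟨hr, hs⟩ := Finset.mem_product.1 (Finset.mem_filter.1 (Finset.mem_coe.1 h)).1
    obtain ⟨hr', hs'⟩ := Finset.mem_product.1 (Finset.mem_filter.1 (Finset.mem_coe.1 h')).1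
    obtain ⟨he1, he2⟩ := Prod.mk.inj he
    exact Prod.ext (injOn_num_den_FT T hr hr' he1) (injOn_num_den_FT T hs hs' he2)

theorem card_filter_ratioMod_add_mem_le {p : ℕ} [hp : Fact p.Prime] {τ D : ℕ} (hτ1 : 1 ≤ τ)
    (hτ : τ < p) (hD : DivisorBound (p ^ 2) D) (S : Finset (ZMod p)) :
    (((pairBox τ ×ˢ pairBox τ).filter fun w =>
        ratioMod p w.1 + ratioMod p w.2 ∈ S).card : ℝ) ≤
      (τ : ℝ) ^ 4 * S.card / p +
        5 * (D : ℝ) ^ 2 * (τ ^ 2 * √(τ * (τ ^ 2 / p + 1) * S.card)) := by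
  have h := card_filter_add_mem_le (pairBox τ) (ratioMod p) S
    fun m hm => norm_expSum_ratioMod_le hτ1 hτ hD hm
  refine h.trans (add_le_add (le_of_eq ?_) ?_)
  · rw [card_pairBox]
    push_cast
    ring
  have hD1 : (1 : ℝ) ≤ D := by
    have h := hD 1 one_ne_zero (Nat.one_le_pow _ _ hp.out.pos)
    rw [Nat.divisors_one, Finset.card_singleton] at h
    exact_mod_cast h
  set X : ℝ := τ * (τ ^ 2 / p + 1) * S.card with hX
  have h1 : √((((pairBox τ ×ˢ pairBox τ).filter fun w =>
      ratioMod p w.1 = ratioMod p w.2).card : ℝ) * S.card) * √(τ : ℝ) ≤ D * (τ * √X) := by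
    rw [← Real.sqrt_mul (by positivity)]
    refine Real.sqrt_le_iff.2 ⟨by positivity, ?_⟩
    have hX0 : 0 ≤ X := by positivity
    have hQ := mul_le_mul_of_nonneg_right (card_ratioMod_eq_le hτ hD)
      (by positivity : (0 : ℝ) ≤ S.card * τ)
    calc _ = _ * ((S.card : ℝ) * τ) := by ring
      _ ≤ _ := hQ
      _ = D * (τ ^ 2 * X) := by rw [hX]; ring
      _ ≤ D * (D * (τ ^ 2 * X)) :=
        mul_le_mul_of_nonneg_left (le_mul_of_one_le_left (by positivity) hD1) (by positivity)
      _ = (D * (τ * √X)) ^ 2 := by rw [mul_pow, mul_pow, Real.sq_sqrt hX0]; ring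
  have h2 := mul_le_mul_of_nonneg_left h1 (by positivity : (0 : ℝ) ≤ 5 * D * τ)
  linarith

theorem main_term_add_error_term_le {t T P s C d K : ℝ} (ht : 0 ≤ t) (htT : t ≤ T) (hP1 : 1 ≤ P)
    (hPT : P ≤ T) (hs0 : 0 ≤ s) (hs : s ≤ C * P ^ 3) (hC : 0 ≤ C) (hd : 0 ≤ d) (hdK : d ≤ K) :
    t ^ 4 * s / P ^ 4 + 5 * d * (t ^ 2 * √(t * (t ^ 2 / P ^ 4 + 1) * s)) ≤
      (C + 5 * K * (C + 1)) * (T ^ 4 * P⁻¹ + T ^ 3 * P) := by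
  have hP0 : 0 < P := by linarith
  have hT0 : 0 < T := by linarith
  have hK : 0 ≤ K := hd.trans hdK
  have hfirst : t ^ 4 * s / P ^ 4 ≤ C * (T ^ 4 * P⁻¹ + T ^ 3 * P) := by
    calc t ^ 4 * s / P ^ 4 ≤ T ^ 4 * (C * P ^ 3) / P ^ 4 := by gcongr
      _ = C * (T ^ 4 * P⁻¹) := by field_simp
      _ ≤ _ := mul_le_mul_of_nonneg_left (le_add_of_nonneg_right (by positivity)) hC
  have hsqrt : √(t * (t ^ 2 / P ^ 4 + 1) * s) ≤ (C + 1) * (T ^ 2 * P⁻¹ + T * P) := by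
    refine Real.sqrt_le_iff.2 ⟨by positivity, ?_⟩
    calc t * (t ^ 2 / P ^ 4 + 1) * s
        ≤ T * (T ^ 2 / P ^ 4 + 1) * (C * P ^ 3) := by gcongr
      _ = C * (T ^ 3 * P⁻¹ + T * (P * P * P)) := by field_simp
      _ ≤ (C + 1) ^ 2 * (2 * T ^ 3 + T ^ 2 * P ^ 2) := by
          have h1 : T ^ 3 * P⁻¹ ≤ T ^ 3 := mul_le_of_le_one_right (by positivity)
            (inv_le_one_of_one_le₀ hP1)
          have h2 : T * (P * P * P) ≤ T ^ 2 * P ^ 2 := by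
            have := mul_le_mul_of_nonneg_left hPT (by positivity : 0 ≤ T * P ^ 2)
            linarith
          have h3 : C ≤ (C + 1) ^ 2 := by nlinarith
          have h4 : 0 ≤ T ^ 3 := by positivity
          exact mul_le_mul h3 (by linarith) (by positivity) (by positivity)
      _ ≤ ((C + 1) * (T ^ 2 * P⁻¹ + T * P)) ^ 2 := by
          rw [mul_pow]
          refine mul_le_mul_of_nonneg_left ?_ (by positivity)
          have h1 : (T ^ 2 * P⁻¹ + T * P) ^ 2 =
              (T ^ 2 * P⁻¹) ^ 2 + (2 * T ^ 3 + T ^ 2 * P ^ 2) := by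
            field_simp
            ring
          rw [h1]
          exact le_add_of_nonneg_left (by positivity)
  have hsecond : 5 * d * (t ^ 2 * √(t * (t ^ 2 / P ^ 4 + 1) * s)) ≤
      5 * K * (T ^ 2 * ((C + 1) * (T ^ 2 * P⁻¹ + T * P))) := by
    gcongr
  linarith

theorem exists_card_tracePairs_le {f g : ℤ[X]} (hfg : Nondeg f g) {ε : ℝ} (hε : 0 < ε) :
    ∃ C : ℝ, 1 ≤ C ∧ ∀ T : ℝ, 1 ≤ T → ∀ (p : ℕ) [Fact p.Prime] (c : ℤ), T < p →
      ((tracePairs f g T p c).card : ℝ) ≤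
        C * (p : ℝ) ^ ε *
          (T ^ 4 * (p : ℝ) ^ (-(1 / 4) : ℝ) + T ^ 3 * (p : ℝ) ^ (1 / 4 : ℝ)) := by
  obtain ⟨C₁, hC₁, hfib⟩ := exists_card_traceFiber_le hfg
  obtain ⟨C₂, hC₂, hdiv⟩ := exists_card_divisors_le (ε := ε / 4) (by positivity)
  refine ⟨1 + C₁ + 5 * C₂ ^ 2 * (C₁ + 1), ?_, fun T hT p hp c hTp => ?_⟩
  · have : 0 ≤ 5 * C₂ ^ 2 * (C₁ + 1) := by positivity
    linarith
  have hp1 : (1 : ℝ) ≤ p := by exact_mod_cast hp.out.one_le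
  have hp0 : (0 : ℝ) < p := by linarith
  have hT0 : (0 : ℝ) < T := by linarith
  set E : ℝ := (p : ℝ) ^ ε with hE
  have hE1 : 1 ≤ E := Real.one_le_rpow hp1 hε.le
  set P : ℝ := (p : ℝ) ^ (1 / 4 : ℝ) with hP
  have hP1 : 1 ≤ P := Real.one_le_rpow hp1 (by norm_num)
  have hP0 : 0 < P := by linarith
  have hP4 : (p : ℝ) = P ^ 4 := by
    rw [hP, ← Real.rpow_natCast, ← Real.rpow_mul hp0.le]; norm_num
  have hP3 : (p : ℝ) ^ (3 / 4 : ℝ) = P ^ 3 := by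
    rw [hP, ← Real.rpow_natCast, ← Real.rpow_mul hp0.le]; norm_num
  rw [Real.rpow_neg hp0.le, ← hP]
  set M : ℝ := T ^ 4 * P⁻¹ + T ^ 3 * P with hM
  have hM0 : 0 ≤ M := by positivity
  have hEM : M ≤ E * M := le_mul_of_one_le_left hM0 hE1
  rcases lt_or_ge T P with hTP | hTP
  · have h1 : T ^ 4 ≤ M := by
      have h2 : T ^ 4 ≤ T ^ 3 * P := by
        rw [pow_succ T 3]
        exact mul_le_mul_of_nonneg_left hTP.le (by positivity)
      have h3 : 0 ≤ T ^ 4 * P⁻¹ := by positivity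
      linarith
    have h2 : 0 ≤ (C₁ + 5 * C₂ ^ 2 * (C₁ + 1)) * (E * M) := by positivity
    have h3 := card_tracePairs_le_pow f g hT0.le p c
    linarith
  set τ : ℕ := ⌊T⌋₊ with hτ
  have hτT : (τ : ℝ) ≤ T := Nat.floor_le hT0.le
  have hτ1 : 1 ≤ τ := Nat.le_floor (by exact_mod_cast hT)
  have hτp : τ < p := by exact_mod_cast hτT.trans_lt hTp
  set D : ℕ := ⌊C₂ * ((p ^ 2 : ℕ) : ℝ) ^ (ε / 4)⌋₊ with hD
  have hDB : DivisorBound (p ^ 2) D := fun n hn hnp => by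
    refine Nat.le_floor ((hdiv n hn).trans (mul_le_mul_of_nonneg_left ?_ (by linarith)))
    exact Real.rpow_le_rpow (by positivity) (by exact_mod_cast hnp) (by positivity)
  have hD2 : (D : ℝ) ^ 2 ≤ C₂ ^ 2 * E := by
    have h1 : (D : ℝ) ≤ C₂ * ((p ^ 2 : ℕ) : ℝ) ^ (ε / 4) := Nat.floor_le (by positivity)
    refine (pow_le_pow_left₀ (by positivity) h1 2).trans (le_of_eq ?_)
    rw [mul_pow, hE]
    congr 1
    push_cast
    rw [← Real.rpow_natCast, ← Real.rpow_natCast, ← Real.rpow_mul hp0.le,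
      ← Real.rpow_mul hp0.le]
    congr 1
    push_cast
    ring
  set S := traceFiber f g p c with hS
  have hSc : (S.card : ℝ) ≤ C₁ * P ^ 3 := by rw [← hP3]; exact hfib p c
  have hmain := card_filter_ratioMod_add_mem_le hτ1 hτp hDB S
  have hcard : ((tracePairs f g T p c).card : ℝ) ≤ _ :=
    (Nat.cast_le.2 (card_tracePairs_le_card_filter f g hTp hT0.le c)).trans hmain
  rw [hP4] at hcard
  have h5 := hcard.trans (main_term_add_error_term_le (Nat.cast_nonneg τ) hτT hP1 hTP
    (Nat.cast_nonneg _) hSc hC₁.le (by positivity) hD2)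
  have h6 := mul_le_mul_of_nonneg_left hEM hC₁.le
  have h7 : 0 ≤ E * M := by positivity
  rw [← hM] at h5
  linarith

theorem sum_Icc_rpow_neg_one_fourth_le (N : ℕ) :
    ∑ n ∈ Icc 1 N, (n : ℝ) ^ (-(1 / 4) : ℝ) ≤ 4 / 3 * (N : ℝ) ^ (3 / 4 : ℝ) := by
  induction N with
  | zero => simp
  | succ N ih =>
    rw [Finset.sum_Icc_succ_top (by omega)]
    have hN0 : (0 : ℝ) ≤ N := by positivity
    have hN1 : (0 : ℝ) < ((N + 1 : ℕ) : ℝ) := by positivity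
    set b : ℝ := (N : ℝ) ^ (1 / 4 : ℝ) with hb
    set a : ℝ := ((N + 1 : ℕ) : ℝ) ^ (1 / 4 : ℝ) with ha
    have ha0 : 0 < a := by positivity
    have hb0 : 0 ≤ b := by positivity
    have hb4 : b ^ 4 = N := by
      rw [hb, ← Real.rpow_natCast, ← Real.rpow_mul hN0]; norm_num
    have ha4 : a ^ 4 = N + 1 := by
      rw [ha, ← Real.rpow_natCast, ← Real.rpow_mul hN1.le]; norm_num
    have hb3 : (N : ℝ) ^ (3 / 4 : ℝ) = b ^ 3 := by
      rw [hb, ← Real.rpow_natCast, ← Real.rpow_mul hN0]; norm_num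
    have ha3 : ((N + 1 : ℕ) : ℝ) ^ (3 / 4 : ℝ) = a ^ 3 := by
      rw [ha, ← Real.rpow_natCast, ← Real.rpow_mul hN1.le]; norm_num
    rw [hb3] at ih
    rw [ha3, Real.rpow_neg hN1.le, ← ha]
    have h : a⁻¹ ≤ 4 / 3 * (a ^ 3 - b ^ 3) := by
      rw [inv_le_iff_one_le_mul₀ ha0]
      have h1 : 0 ≤ (a - b) ^ 2 * (a ^ 2 + 2 * a * b + 3 * b ^ 2) := by positivity
      nlinarith
    linarith

theorem sum_piSeq_eq (f g : ℤ[X]) (a : ℕ → ℤ) (T x : ℝ) :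
    ∑ rs ∈ FT T ×ˢ FT T, (piSeq f g a (rs.1 + rs.2) x : ℝ) =
      ∑ p ∈ (Icc 1 ⌊x⌋₊).filter Nat.Prime, ((tracePairs f g T p (a p)).card : ℝ) := by
  have h1 : ∀ rs : ℚ × ℚ, (piSeq f g a (rs.1 + rs.2) x : ℝ) =
      ∑ p ∈ (Icc 1 ⌊x⌋₊).filter Nat.Prime,
        if goodRed f g p (rs.1 + rs.2) ∧ apE f g p (rs.1 + rs.2) = a p then (1 : ℝ) else 0 := by
    intro rs
    rw [Finset.sum_boole, Finset.filter_filter, piSeq]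
  simp_rw [h1]
  rw [Finset.sum_comm]
  refine Finset.sum_congr rfl fun p _ => ?_
  rw [Finset.sum_boole, tracePairs]

/-- Theorem 1.3 (Lang–Trotter on average over sums of two elements of `F(T)`). -/
theorem LT_average_FT_sums (f g : Polynomial ℤ) (hfg : Nondeg f g) (ε : ℝ) (hε : 0 < ε) :
    ∃ C : ℝ, 0 < C ∧ ∀ T x : ℝ, 1 ≤ T → 2 ≤ x → ∀ a : ℕ → ℤ,
      (∑ rs ∈ (FT T ×ˢ FT T).filter fun rs => aeval (rs.1 + rs.2) (Dpoly f g) ≠ 0,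
          (piSeq f g a (rs.1 + rs.2) x : ℝ)) ≤
        C * (T ^ 5 + T ^ 3 * x ^ (5 / 4 + ε) + T ^ 4 * x ^ (3 / 4 + ε)) := by
  obtain ⟨C, hC1, hC⟩ := exists_card_tracePairs_le hfg hε
  refine ⟨2 * C, by linarith, fun T x hT hx a => ?_⟩
  have hT0 : 0 < T := by linarith
  have hx0 : 0 < x := by linarith
  refine (Finset.sum_le_sum_of_subset_of_nonneg (Finset.filter_subset _ _)
    fun _ _ _ => Nat.cast_nonneg _).trans ?_
  rw [sum_piSeq_eq]
  set N := ⌊x⌋₊ with hN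
  have hNx : (N : ℝ) ≤ x := Nat.floor_le hx0.le
  have hpt : ∀ p ∈ (Icc 1 N).filter Nat.Prime, ((tracePairs f g T p (a p)).card : ℝ) ≤
      (if p ≤ ⌊T⌋₊ then T ^ 4 else 0) +
        (C * x ^ ε * T ^ 4 * (p : ℝ) ^ (-(1 / 4) : ℝ) + C * x ^ ε * T ^ 3 * x ^ (1 / 4 : ℝ)) := by
    intro p hp
    obtain ⟨hpN, hpp⟩ := Finset.mem_filter.1 hp
    have hpx : (p : ℝ) ≤ x := (Nat.cast_le.2 (Finset.mem_Icc.1 hpN).2).trans hNx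
    split_ifs with h
    · have h1 := card_tracePairs_le_pow f g hT0.le p (a p)
      have : 0 ≤ C * x ^ ε * T ^ 4 * (p : ℝ) ^ (-(1 / 4) : ℝ) +
        C * x ^ ε * T ^ 3 * x ^ (1 / 4 : ℝ) := by positivity
      linarith
    · have : Fact p.Prime := ⟨hpp⟩
      have hTp : T < p := (Nat.floor_lt hT0.le).1 (not_le.1 h)
      refine (hC T hT p (a p) hTp).trans ?_
      rw [zero_add]
      calc _ ≤ C * x ^ ε * (T ^ 4 * (p : ℝ) ^ (-(1 / 4) : ℝ) + T ^ 3 * x ^ (1 / 4 : ℝ)) := by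
            have h1 : (p : ℝ) ^ ε ≤ x ^ ε := Real.rpow_le_rpow (by positivity) hpx hε.le
            have h2 : (p : ℝ) ^ (1 / 4 : ℝ) ≤ x ^ (1 / 4 : ℝ) :=
              Real.rpow_le_rpow (by positivity) hpx (by norm_num)
            gcongr
        _ = _ := by ring
  refine (Finset.sum_le_sum hpt).trans ?_
  refine (Finset.sum_le_sum_of_subset_of_nonneg (Finset.filter_subset _ _)
    fun p _ _ => ?_).trans ?_
  · have : 0 ≤ if p ≤ ⌊T⌋₊ then T ^ 4 else 0 := by split_ifs <;> positivity
    positivity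
  rw [Finset.sum_add_distrib, Finset.sum_add_distrib, ← Finset.mul_sum, Finset.sum_const,
    Nat.card_Icc, nsmul_eq_mul, Nat.add_sub_cancel]
  have hsmall : ∑ p ∈ Icc 1 N, (if p ≤ ⌊T⌋₊ then T ^ 4 else 0) ≤ T ^ 5 := by
    rw [← Finset.sum_filter, Finset.sum_const, nsmul_eq_mul, pow_succ' T 4]
    refine mul_le_mul_of_nonneg_right ?_ (by positivity)
    refine le_trans (Nat.cast_le.2 (?_ : _ ≤ ⌊T⌋₊)) (Nat.floor_le hT0.le)
    calc _ ≤ (Icc 1 ⌊T⌋₊).card := Finset.card_le_card fun p hp => by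
          simp only [Finset.mem_filter, Finset.mem_Icc] at hp ⊢
          exact ⟨hp.1.1, hp.2⟩
      _ = ⌊T⌋₊ := by simp
  have hx34 : x ^ (3 / 4 + ε) = x ^ ε * x ^ (3 / 4 : ℝ) := by
    rw [← Real.rpow_add hx0, add_comm]
  have hx54 : x ^ (5 / 4 + ε) = x ^ ε * (x * x ^ (1 / 4 : ℝ)) := by
    rw [← Real.rpow_one_add' hx0.le (by norm_num), ← Real.rpow_add hx0]
    norm_num [add_comm]
  have h34 : C * x ^ ε * T ^ 4 * ∑ p ∈ Icc 1 N, (p : ℝ) ^ (-(1 / 4) : ℝ) ≤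
      C * x ^ ε * T ^ 4 * (4 / 3 * x ^ (3 / 4 : ℝ)) := by
    refine mul_le_mul_of_nonneg_left ((sum_Icc_rpow_neg_one_fourth_le N).trans ?_)
      (by positivity)
    have := Real.rpow_le_rpow (Nat.cast_nonneg N) hNx (by norm_num : (0 : ℝ) ≤ 3 / 4)
    linarith
  have h54 : (N : ℝ) * (C * x ^ ε * T ^ 3 * x ^ (1 / 4 : ℝ)) ≤
      x * (C * x ^ ε * T ^ 3 * x ^ (1 / 4 : ℝ)) :=
    mul_le_mul_of_nonneg_right hNx (by positivity)
  rw [hx34, hx54]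
  have h1 : 0 ≤ C * x ^ ε * T ^ 4 * x ^ (3 / 4 : ℝ) := by positivity
  have h2 : 0 ≤ C * x ^ ε * T ^ 3 * (x * x ^ (1 / 4 : ℝ)) := by positivity
  have h3 : T ^ 5 ≤ C * T ^ 5 := le_mul_of_one_le_left (by positivity) hC1
  have h4 : 0 ≤ C * T ^ 5 := by positivity
  linarith
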